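/- Assume sp < n. Let μ be a Borel measure with finite total mass, g ∈ W^{s,p}_loc(ℝⁿ) ∩ L^{p−1}_{sp}(ℝⁿ), and let u be a SOLA of the Dirichlet problem −L_Φ u = μ in Ω, u = g on ℝⁿ∖Ω. Suppose there is a function h : [0,∞] → [0,∞] with ∫₀ h(r)^{1/(p−1)} dr/r < ∞ such that |μ|(B_r) ≤ h(r) r^{n−sp} for every ball B_r ⊂ ℝⁿ of radius r. Then u is continuous in Ω. -/

import Mathlib

noncomputable section

open MeasureTheory Metric Set Filter Topology
open scoped ENNReal NNReal

/-- Euclidean space `ℝⁿ`. -/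
abbrev Rn (n : ℕ) : Type := EuclideanSpace ℝ (Fin n)

/-- `q_* = max {1, p-1}`. -/
def qStar (p : ℝ) : ℝ := max 1 (p - 1)

/-- `q̄ = min {n(p-1)/(n-s), p}`. -/
def qBar (n : ℕ) (s p : ℝ) : ℝ := min ((n : ℝ) * (p - 1) / ((n : ℝ) - s)) p

/-- Gagliardo seminorm raised to the power `p`, as an `ℝ≥0∞`-valued double integral. -/
def gagliardo (n : ℕ) (s p : ℝ) (O : Set (Rn n)) (v : Rn n → ℝ) : ℝ≥0∞ :=
  ∫⁻ x in O, ∫⁻ y in O, ENNReal.ofReal (|v x - v y| ^ p / ‖x - y‖ ^ ((n : ℝ) + s * p))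

/-- `v ∈ W^{s,p}(O)`. -/
def memWsp (n : ℕ) (s p : ℝ) (O : Set (Rn n)) (v : Rn n → ℝ) : Prop :=
  AEMeasurable v (volume.restrict O) ∧
    (∫⁻ x in O, ENNReal.ofReal (|v x| ^ p)) < ⊤ ∧ gagliardo n s p O v < ⊤

/-- `Tail(v; x₀, r)`. -/
def tailFn (n : ℕ) (s p : ℝ) (v : Rn n → ℝ) (x₀ : Rn n) (r : ℝ) : ℝ≥0∞ :=
  (ENNReal.ofReal (r ^ (s * p)) *
      ∫⁻ x in (ball x₀ r)ᶜ,
        ENNReal.ofReal (|v x| ^ (p - 1) / ‖x - x₀‖ ^ ((n : ℝ) + s * p))) ^ (1 / (p - 1))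

/-- `v ∈ L^{p-1}_{sp}(ℝⁿ)`. -/
def memTailSpace (n : ℕ) (s p : ℝ) (v : Rn n → ℝ) : Prop :=
  AEMeasurable v (volume : Measure (Rn n)) ∧
    (∀ R : ℝ, (∫⁻ x in ball (0 : Rn n) R, ENNReal.ofReal (|v x| ^ (p - 1))) < ⊤) ∧
    ∀ z : Rn n, ∀ r : ℝ, 0 < r → tailFn n s p v z r < ⊤

/-- `φ ∈ C_0^∞(O)`. -/
def IsTestFun (n : ℕ) (O : Set (Rn n)) (φ : Rn n → ℝ) : Prop :=
  ContDiff ℝ (⊤ : ℕ∞) φ ∧ HasCompactSupport φ ∧ tsupport φ ⊆ O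

/-- The nonlocal form `⟨-L_Φ u, φ⟩`. -/
def nonlocalForm (n : ℕ) (Φ : ℝ → ℝ) (K : Rn n → Rn n → ℝ) (u φ : Rn n → ℝ) : ℝ :=
  ∫ x : Rn n, ∫ y : Rn n, Φ (u x - u y) * (φ x - φ y) * K x y

/-- Ellipticity/coercivity bounds on the kernel `K`. -/
def KernelBounds (n : ℕ) (Λ s p : ℝ) (K : Rn n → Rn n → ℝ) : Prop :=
  Measurable (Function.uncurry K) ∧
    ∀ x y : Rn n, x ≠ y →
      1 / (Λ * ‖x - y‖ ^ ((n : ℝ) + s * p)) ≤ K x y ∧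
        K x y ≤ Λ / ‖x - y‖ ^ ((n : ℝ) + s * p)

/-- Structure conditions on `Φ`. -/
def PhiBounds (Λ p : ℝ) (Φ : ℝ → ℝ) : Prop :=
  Continuous Φ ∧ Φ 0 = 0 ∧
    ∀ t : ℝ, |t| ^ p / Λ ≤ Φ t * t ∧ Φ t * t ≤ Λ * |t| ^ p

/-- `∫ φ dμ` for a signed measure `μ`. -/
def sintegral (n : ℕ) (μ : MeasureTheory.SignedMeasure (Rn n)) (φ : Rn n → ℝ) : ℝ :=
  (∫ x, φ x ∂μ.toJordanDecomposition.posPart) -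
    ∫ x, φ x ∂μ.toJordanDecomposition.negPart

/-- Weak (energy) solution of `-L_Φ u = f` in `Ω`, `u = g` on `ℝⁿ ∖ Ω`. -/
def WeakSol (n : ℕ) (Φ : ℝ → ℝ) (K : Rn n → Rn n → ℝ) (s p : ℝ)
    (Ω : Set (Rn n)) (f g u : Rn n → ℝ) : Prop :=
  memWsp n s p univ u ∧ (∀ᵐ x : Rn n, x ∉ Ω → u x = g x) ∧
    ∀ φ : Rn n → ℝ, IsTestFun n Ω φ → nonlocalForm n Φ K u φ = ∫ x : Rn n, φ x * f x

/-- Weak subsolution of the homogeneous equation `-L_Φ w = 0` in `Ω`. -/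
def WeakSubSol (n : ℕ) (Φ : ℝ → ℝ) (K : Rn n → Rn n → ℝ) (s p : ℝ)
    (Ω : Set (Rn n)) (w : Rn n → ℝ) : Prop :=
  memWsp n s p univ w ∧
    ∀ φ : Rn n → ℝ, IsTestFun n Ω φ → (∀ x, 0 ≤ φ x) → nonlocalForm n Φ K w φ ≤ 0

/-- The approximation properties required of a SOLA. -/
def SOLAApprox (n : ℕ) (Φ : ℝ → ℝ) (K : Rn n → Rn n → ℝ) (s p : ℝ)
    (Ω : Set (Rn n)) (μ : MeasureTheory.SignedMeasure (Rn n)) (g u : Rn n → ℝ)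
    (uj μj gj : ℕ → Rn n → ℝ) : Prop :=
  (∀ j, ContDiff ℝ (⊤ : ℕ∞) (μj j) ∧ HasCompactSupport (μj j)) ∧
  (∀ j, ContDiff ℝ (⊤ : ℕ∞) (gj j) ∧ HasCompactSupport (gj j)) ∧
  (∀ j, WeakSol n Φ K s p Ω (μj j) (gj j) (uj j)) ∧
  (∀ᵐ x : Rn n, Tendsto (fun j => uj j x) atTop (𝓝 (u x))) ∧
  (∀ q : ℝ, qStar p ≤ q → q < qBar n s p → ∀ z : Rn n, ∀ r : ℝ, 0 < r →
    Tendsto (fun j => ∫⁻ x in ball z r, ENNReal.ofReal (|uj j x - u x| ^ q)) atTop (𝓝 0)) ∧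
  (∀ φ : Rn n → ℝ, Continuous φ → HasCompactSupport φ → tsupport φ ⊆ Ω →
    Tendsto (fun j => ∫ x : Rn n, φ x * μj j x) atTop (𝓝 (sintegral n μ φ))) ∧
  (∀ z : Rn n, ∀ r : ℝ, 0 < r →
    Filter.limsup (fun j => ∫⁻ x in ball z r, ENNReal.ofReal |μj j x|) atTop
      ≤ μ.totalVariation (closedBall z r)) ∧
  (∀ z : Rn n, ∀ r : ℝ, 0 < r →
    Tendsto (fun j =>
        (∫⁻ x in ball z r, ENNReal.ofReal (|gj j x - g x| ^ p)) +
          gagliardo n s p (ball z r) (fun x => gj j x - g x)) atTop (𝓝 0) ∧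
      Tendsto (fun j => tailFn n s p (fun x => gj j x - g x) z r) atTop (𝓝 0))

/-- SOLA of the Dirichlet problem `-L_Φ u = μ` in `Ω`, `u = g` on `ℝⁿ ∖ Ω`. -/
def IsSOLA (n : ℕ) (Φ : ℝ → ℝ) (K : Rn n → Rn n → ℝ) (s p : ℝ)
    (Ω : Set (Rn n)) (μ : MeasureTheory.SignedMeasure (Rn n)) (g u : Rn n → ℝ) : Prop :=
  (∀ h q : ℝ, 0 < h → h < s → qStar p ≤ q → q < qBar n s p → memWsp n h q Ω u) ∧
  (∀ φ : Rn n → ℝ, IsTestFun n Ω φ → nonlocalForm n Φ K u φ = sintegral n μ φ) ∧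
  (∀ᵐ x : Rn n, x ∉ Ω → u x = g x) ∧
  ∃ uj μj gj : ℕ → Rn n → ℝ, SOLAApprox n Φ K s p Ω μ g u uj μj gj

/-- Truncated Wolff potential `W^ν_{s,p}(x₀, r)`. -/
def wolff (n : ℕ) (s p : ℝ) (ν : Measure (Rn n)) (x₀ : Rn n) (r : ℝ) : ℝ≥0∞ :=
  ∫⁻ ρ in Ioc (0 : ℝ) r,
    (ν (ball x₀ ρ) / ENNReal.ofReal (ρ ^ ((n : ℝ) - s * p))) ^ (1 / (p - 1)) /
      ENNReal.ofReal ρ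

/-- Integral average of `u` over `B_r(x₀)`. -/
def ballAvg (n : ℕ) (u : Rn n → ℝ) (x₀ : Rn n) (r : ℝ) : ℝ :=
  ⨍ x in ball x₀ r, u x

/-- Local excess `A(f; x₀, r)`. -/
def locExcess (n : ℕ) (p : ℝ) (f : Rn n → ℝ) (x₀ : Rn n) (r : ℝ) : ℝ≥0∞ :=
  ((volume (ball x₀ r))⁻¹ *
      ∫⁻ x in ball x₀ r, ENNReal.ofReal (|f x - ballAvg n f x₀ r| ^ qStar p)) ^ (1 / qStar p)

/-- Global excess `E(f; x₀, r)`. -/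
def excess (n : ℕ) (s p : ℝ) (f : Rn n → ℝ) (x₀ : Rn n) (r : ℝ) : ℝ≥0∞ :=
  locExcess n p f x₀ r + tailFn n s p (fun x => f x - ballAvg n f x₀ r) x₀ r

/-- `g ∈ W^{s,p}_loc(ℝⁿ) ∩ L^{p-1}_{sp}(ℝⁿ)`. -/
def BoundaryDatum (n : ℕ) (s p : ℝ) (g : Rn n → ℝ) : Prop :=
  (∀ z : Rn n, ∀ r : ℝ, 0 < r → memWsp n s p (ball z r) g) ∧ memTailSpace n s p g

/-- Symmetric measurable kernel with ellipticity bounds. -/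
def SymKernel (n : ℕ) (Λ s p : ℝ) (Kt : Rn n → Rn n → ℝ) : Prop :=
  KernelBounds n Λ s p Kt ∧ ∀ x y : Rn n, Kt x y = Kt y x

/-- Weak solution of the kernel-`Kt` fractional `p`-Laplace equation with datum `f` in `O`. -/
def WeakSolP (n : ℕ) (Kt : Rn n → Rn n → ℝ) (s p : ℝ) (O : Set (Rn n))
    (f u : Rn n → ℝ) : Prop :=
  memWsp n s p univ u ∧
    ∀ φ : Rn n → ℝ, IsTestFun n O φ →
      (∫ x : Rn n, ∫ y : Rn n,
          |u x - u y| ^ (p - 2) * (u x - u y) * (φ x - φ y) * Kt x y) =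
        ∫ x : Rn n, φ x * f x

/-- Structural parameters of the equation, together with a small auxiliary exponent `ξ`. -/
structure Prm where
  n : ℕ
  s : ℝ
  p : ℝ
  ξ : ℝ
  L : ℝ
  hn : 1 ≤ n
  hs : 0 < s
  hs1 : s < 1
  hp : 1 < p
  hξ : 0 < ξ
  hq : (p - 1) * (1 + ξ) ≤ p
  hκ : (p - 1) * (1 + ξ) ≤ (p - 1 - ξ) * (1 + s * p / n)
  hL : 1 ≤ L

namespace Prm

variable (P : Prm)

/-- The integrability exponent used for the local part of the excess. -/
def q : ℝ := (P.p - 1) * (1 + P.ξ)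

/-- The kernel exponent `n + sp`. -/
def N : ℝ := (P.n : ℝ) + P.s * P.p

/-- The Sobolev gain `1 + sp/n`. -/
def κ : ℝ := 1 + P.s * P.p / P.n

/-- Bounded concave truncation of the positive part. -/
def g (t : ℝ) : ℝ := 1 - (1 + max t 0) ^ (-P.ξ)

/-- The function whose energy is controlled by testing with `g`. -/
def V (t : ℝ) : ℝ := max t 0 * (1 + max t 0) ^ (-(1 + P.ξ) / P.p)

/-- The lower order term in the Caccioppoli inequality when testing with `g`. -/
def R (t : ℝ) : ℝ := (max t 0) ^ P.p * (1 + max t 0) ^ (P.q - P.p)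

/-- The odd power `|t|^{p-2} t`. -/
def J (t : ℝ) : ℝ := (SignType.sign t : ℝ) * |t| ^ (P.p - 1)

lemma p_pos : 0 < P.p := by linarith [P.hp]
lemma p1_pos : 0 < P.p - 1 := by linarith [P.hp]
lemma n_pos : (0 : ℝ) < P.n := by exact_mod_cast P.hn
lemma sp_pos : 0 < P.s * P.p := mul_pos P.hs P.p_pos
lemma N_pos : 0 < P.N := by unfold N; linarith [P.sp_pos, P.n_pos]
lemma κ_gt : 1 < P.κ := by
  unfold κ; linarith [div_pos P.sp_pos P.n_pos]
lemma q_pos : 0 < P.q := mul_pos P.p1_pos (by linarith [P.hξ])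
lemma q_le : P.q ≤ P.p := P.hq
lemma p1_le_q : P.p - 1 ≤ P.q := by
  unfold q; nlinarith [P.p1_pos, P.hξ]
lemma L_pos : 0 < P.L := by linarith [P.hL]

lemma J_of_nonneg {t : ℝ} (ht : 0 ≤ t) : P.J t = t ^ (P.p - 1) := by
  unfold J
  rcases ht.eq_or_lt with h | h
  · subst h; simp [Real.zero_rpow P.p1_pos.ne']
  · simp [sign_pos h, abs_of_pos h]

lemma J_neg (t : ℝ) : P.J (-t) = - P.J t := by
  unfold J; simp [Left.sign_neg]

lemma J_mul (a b : ℝ) : P.J (a * b) = P.J a * P.J b := by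
  unfold J
  rw [sign_mul, abs_mul, Real.mul_rpow (abs_nonneg _) (abs_nonneg _)]
  push_cast; ring

lemma abs_J (t : ℝ) : |P.J t| = |t| ^ (P.p - 1) := by
  rcases le_total 0 t with h | h
  · rw [P.J_of_nonneg h, abs_of_nonneg (Real.rpow_nonneg h _), abs_of_nonneg h]
  · have := P.J_of_nonneg (neg_nonneg.2 h)
    rw [J_neg] at this
    rw [← abs_neg, this, abs_of_nonneg (Real.rpow_nonneg (by linarith) _), abs_of_nonpos h]

@[fun_prop] lemma measurable_g : Measurable P.g := by unfold g; fun_prop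
@[fun_prop] lemma measurable_V : Measurable P.V := by unfold V; fun_prop
@[fun_prop] lemma measurable_R : Measurable P.R := by unfold R; fun_prop

lemma g_of_nonpos {t : ℝ} (h : t ≤ 0) : P.g t = 0 := by simp [g, max_eq_right h]
lemma V_of_nonpos {t : ℝ} (h : t ≤ 0) : P.V t = 0 := by simp [V, max_eq_right h]
lemma R_of_nonpos {t : ℝ} (h : t ≤ 0) : P.R t = 0 := by
  simp [R, max_eq_right h, Real.zero_rpow P.p_pos.ne']

lemma g_le_one (t : ℝ) : P.g t ≤ 1 := by
  unfold g
  have : 0 ≤ (1 + max t 0) ^ (-P.ξ) := Real.rpow_nonneg (by positivity) _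
  linarith

lemma g_mono : Monotone P.g := by
  intro a b h
  unfold g
  have : (1 + max b 0) ^ (-P.ξ) ≤ (1 + max a 0) ^ (-P.ξ) :=
    Real.rpow_le_rpow_of_nonpos (by positivity) (by gcongr) (by linarith [P.hξ])
  linarith

lemma g_nonneg (t : ℝ) : 0 ≤ P.g t := by
  rcases le_total t 0 with h | h
  · rw [P.g_of_nonpos h]
  · have := P.g_mono h
    rwa [P.g_of_nonpos le_rfl] at this

lemma V_nonneg (t : ℝ) : 0 ≤ P.V t := by unfold V; positivity
lemma R_nonneg (t : ℝ) : 0 ≤ P.R t := by unfold R; positivity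

lemma one_sub_rpow_neg_le {x c : ℝ} (hx : 0 < x) : 1 - x ^ (-c) ≤ c * Real.log x := by
  rw [Real.rpow_def_of_pos hx]
  have := Real.add_one_le_exp (Real.log x * -c)
  linarith

lemma g_diff_le {a b : ℝ} (h : b ≤ a) : P.g a - P.g b ≤ P.ξ * (a - b) := by
  have key : P.g a - P.g b ≤ P.ξ * (max a 0 - max b 0) := by
    unfold g
    set A := max a 0 with hA
    set B := max b 0 with hB
    have hB0 : 0 ≤ B := le_max_right _ _
    have hAB : B ≤ A := max_le_max_right _ h
    have h1 : (1 + A) ^ (-P.ξ) = (1 + B) ^ (-P.ξ) * ((1 + A) / (1 + B)) ^ (-P.ξ) := by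
      rw [← Real.mul_rpow (by positivity) (by positivity)]; congr 1; field_simp
    have h2 := one_sub_rpow_neg_le (c := P.ξ) (x := (1 + A) / (1 + B)) (by positivity)
    have h3 := Real.log_le_sub_one_of_pos (x := (1 + A) / (1 + B)) (by positivity)
    have h4 : (1 + A) / (1 + B) - 1 ≤ A - B := by
      rw [div_sub_one (by positivity), div_le_iff₀ (by positivity)]; nlinarith
    have h5 : (1 + B) ^ (-P.ξ) ≤ 1 :=
      Real.rpow_le_one_of_one_le_of_nonpos (by linarith) (by linarith [P.hξ])
    have h6 : 0 ≤ 1 - ((1 + A) / (1 + B)) ^ (-P.ξ) := by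
      have : ((1 + A) / (1 + B)) ^ (-P.ξ) ≤ 1 :=
        Real.rpow_le_one_of_one_le_of_nonpos (by rw [le_div_iff₀] <;> linarith)
          (by linarith [P.hξ])
      linarith
    have h7 : P.ξ * Real.log ((1 + A) / (1 + B)) ≤ P.ξ * (A - B) :=
      mul_le_mul_of_nonneg_left (by linarith) P.hξ.le
    rw [h1]
    nlinarith
  have : max a 0 - max b 0 ≤ a - b := by
    rcases le_total a 0 with ha | ha <;> rcases le_total b 0 with hb | hb <;>
      simp [ha, hb] <;> linarith
  nlinarith [P.hξ]

lemma lipschitz_g : LipschitzWith P.ξ.toNNReal P.g := by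
  apply LipschitzWith.of_dist_le_mul
  intro a b
  rw [Real.dist_eq, Real.dist_eq, Real.coe_toNNReal _ P.hξ.le]
  rcases le_total b a with h | h
  · rw [abs_of_nonneg (sub_nonneg.2 (P.g_mono h)), abs_of_nonneg (sub_nonneg.2 h)]
    exact P.g_diff_le h
  · rw [abs_sub_comm, abs_sub_comm a,
      abs_of_nonneg (sub_nonneg.2 (P.g_mono h)), abs_of_nonneg (sub_nonneg.2 h)]
    exact P.g_diff_le h

/-- The derivative weight of `g`. -/
def H (t : ℝ) : ℝ := (1 + t) ^ (-(1 + P.ξ))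

lemma g_lower {a b : ℝ} (hb : 0 ≤ b) (h : b ≤ a) :
    P.ξ * P.H a * (a - b) ≤ P.g a - P.g b := by
  have ha : 0 ≤ a := hb.trans h
  unfold g H
  rw [max_eq_left ha, max_eq_left hb]
  have h1 : (1 + b) ^ (-P.ξ) = (1 + a) ^ (-P.ξ) * ((1 + b) / (1 + a)) ^ (-P.ξ) := by
    rw [← Real.mul_rpow (by positivity) (by positivity)]; congr 1; field_simp
  have h2 := one_sub_rpow_neg_le (c := P.ξ) (x := (1 + b) / (1 + a)) (by positivity)
  have h3 := Real.log_le_sub_one_of_pos (x := (1 + b) / (1 + a)) (by positivity)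
  have h4 : (1 + b) / (1 + a) - 1 = - ((a - b) / (1 + a)) := by field_simp; ring
  have h5 : (1 + a) ^ (-(1 + P.ξ)) = (1 + a) ^ (-P.ξ) / (1 + a) := by
    rw [show -(1 + P.ξ) = -P.ξ - 1 by ring, Real.rpow_sub_one (by positivity)]
  have h6 : 0 < (1 + a) ^ (-P.ξ) := by positivity
  have h7 : P.ξ * ((a - b) / (1 + a)) ≤ ((1 + b) / (1 + a)) ^ (-P.ξ) - 1 := by
    nlinarith [P.hξ]
  rw [h1, h5]
  calc _ = (1 + a) ^ (-P.ξ) * (P.ξ * ((a - b) / (1 + a))) := by ring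
    _ ≤ (1 + a) ^ (-P.ξ) * (((1 + b) / (1 + a)) ^ (-P.ξ) - 1) := by gcongr
    _ = _ := by ring

lemma g_upper {t : ℝ} (ht : 0 ≤ t) : P.g t ≤ (1 + P.ξ) * (t / (1 + t)) := by
  have h1 := P.g_le_one t
  have h2 := P.g_diff_le ht
  rw [P.g_of_nonpos le_rfl] at h2
  rw [← mul_div_assoc, le_div_iff₀ (by positivity)]
  nlinarith

lemma H_nonneg {t : ℝ} (ht : 0 ≤ t) : 0 ≤ P.H t := by unfold H; positivity
lemma H_pos {t : ℝ} (ht : 0 ≤ t) : 0 < P.H t := by unfold H; positivity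

lemma V_pow_eq {t : ℝ} (ht : 0 ≤ t) : P.V t = t * P.H t ^ (1 / P.p) := by
  unfold V H
  rw [max_eq_left ht, ← Real.rpow_mul (by positivity)]; ring_nf

lemma V_diff_le {a b : ℝ} (hb : 0 ≤ b) (h : b ≤ a) :
    P.V a - P.V b ≤ (a - b) * P.H a ^ (1 / P.p) := by
  rw [P.V_pow_eq (hb.trans h), P.V_pow_eq hb]
  have : P.H a ^ (1 / P.p) ≤ P.H b ^ (1 / P.p) := by
    apply Real.rpow_le_rpow (P.H_nonneg (hb.trans h)) _ (by have := P.p_pos; positivity)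
    unfold H
    exact Real.rpow_le_rpow_of_nonpos (by positivity) (by gcongr) (by linarith [P.hξ])
  nlinarith

lemma R_eq {t : ℝ} (ht : 0 ≤ t) : P.R t = t ^ P.q * (t / (1 + t)) ^ (P.p - P.q) := by
  unfold R
  rw [max_eq_left ht, Real.div_rpow ht (by positivity)]
  rcases ht.eq_or_lt with h | h
  · subst h; simp [Real.zero_rpow P.p_pos.ne', Real.zero_rpow P.q_pos.ne']
  · rw [show P.q - P.p = -(P.p - P.q) by ring, Real.rpow_neg (by positivity), ← mul_div_assoc,
      ← Real.rpow_add h, div_eq_mul_inv]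
    ring_nf

lemma frac_mono {a b : ℝ} (ha : 0 ≤ a) (h : a ≤ b) : a / (1 + a) ≤ b / (1 + b) := by
  rw [div_le_div_iff₀ (by linarith) (by linarith)]; nlinarith

lemma R_mono : Monotone P.R := by
  intro a b h
  rcases le_total a 0 with ha | ha
  · rw [P.R_of_nonpos ha]; exact P.R_nonneg b
  · have hb := ha.trans h
    rw [P.R_eq ha, P.R_eq hb]
    have := P.q_le
    have := P.q_pos
    have := frac_mono ha h
    gcongr

lemma V_mono : Monotone P.V := by
  intro a b h
  rcases le_total a 0 with ha | ha
  · rw [P.V_of_nonpos ha]; exact P.V_nonneg b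
  · have hb := ha.trans h
    have e : ∀ {t : ℝ}, 0 ≤ t → P.V t = t ^ (1 - (1 + P.ξ) / P.p) *
        (t / (1 + t)) ^ ((1 + P.ξ) / P.p) := by
      intro t ht
      unfold V
      have h0 : 0 < (1 + P.ξ) / P.p := div_pos (by linarith [P.hξ]) P.p_pos
      rcases ht.eq_or_lt with h | h
      · subst h; simp [Real.zero_rpow h0.ne']
      · rw [max_eq_left ht, Real.div_rpow ht (by positivity), neg_div,
          Real.rpow_neg (by positivity), ← mul_div_assoc, ← Real.rpow_add h]
        simp [div_eq_mul_inv]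
    rw [e ha, e hb]
    have h1 : (1 + P.ξ) / P.p ≤ 1 := by
      rw [div_le_one P.p_pos]
      have h2 := P.hκ
      have h3 : 0 < (P.p - 1 - P.ξ) * P.κ := lt_of_lt_of_le P.q_pos h2
      have h4 : 0 < P.p - 1 - P.ξ := pos_of_mul_pos_left h3 (by linarith [P.κ_gt])
      linarith
    have h2 : 0 ≤ 1 - (1 + P.ξ) / P.p := by linarith
    have h3 : 0 ≤ (1 + P.ξ) / P.p := div_nonneg (by linarith [P.hξ]) P.p_pos.le
    have := frac_mono ha h
    gcongr

lemma R_le_rpow {t : ℝ} (ht : 0 ≤ t) : P.R t ≤ t ^ P.q := by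
  rw [P.R_eq ht]
  have : (t / (1 + t)) ^ (P.p - P.q) ≤ 1 :=
    Real.rpow_le_one (by positivity) (by rw [div_le_one (by positivity)]; linarith)
      (by linarith [P.q_le])
  nlinarith [Real.rpow_nonneg ht P.q]

lemma rpow_le_R {t d : ℝ} (hd : 0 < d) (ht : d ≤ t) :
    t ^ P.q ≤ ((1 + d) / d) ^ (P.p - P.q) * P.R t := by
  have h0 : 0 < t := hd.trans_le ht
  rw [P.R_eq h0.le]
  have h1 : ((d / (1 + d))) ^ (P.p - P.q) ≤ (t / (1 + t)) ^ (P.p - P.q) :=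
    Real.rpow_le_rpow (by positivity) (frac_mono hd.le ht) (by linarith [P.q_le])
  have h2 : ((1 + d) / d) ^ (P.p - P.q) * ((d / (1 + d))) ^ (P.p - P.q) = 1 := by
    rw [← Real.mul_rpow (by positivity) (by positivity)]
    rw [show (1 + d) / d * (d / (1 + d)) = 1 by field_simp, Real.one_rpow]
  have h3 : 0 ≤ t ^ P.q := by positivity
  have h4 : 0 ≤ ((1 + d) / d) ^ (P.p - P.q) := by positivity
  calc t ^ P.q = t ^ P.q * (((1 + d) / d) ^ (P.p - P.q) * ((d / (1 + d))) ^ (P.p - P.q)) := by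
        rw [h2, mul_one]
    _ ≤ t ^ P.q * (((1 + d) / d) ^ (P.p - P.q) * (t / (1 + t)) ^ (P.p - P.q)) := by gcongr
    _ = _ := by ring

lemma R_mul_le {l : ℝ} (hl : 1 ≤ l) (t : ℝ) : P.R (l * t) ≤ l ^ P.p * P.R t := by
  rcases le_total t 0 with ht | ht
  · rw [P.R_of_nonpos ht, P.R_of_nonpos (mul_nonpos_of_nonneg_of_nonpos (by linarith) ht)]; simp
  · unfold R
    rw [max_eq_left ht, max_eq_left (by positivity), Real.mul_rpow (by positivity) ht, mul_assoc]
    have : (1 + l * t) ^ (P.q - P.p) ≤ (1 + t) ^ (P.q - P.p) :=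
      Real.rpow_le_rpow_of_nonpos (by positivity) (by nlinarith) (by linarith [P.q_le])
    gcongr

lemma R_max_le (a b : ℝ) : P.R (max a b) ≤ P.R a + P.R b := by
  rcases le_total a b with h | h
  · rw [max_eq_right h]; linarith [P.R_nonneg a]
  · rw [max_eq_left h]; linarith [P.R_nonneg b]

lemma R_add_le (a b : ℝ) : P.R (a + b) ≤ 2 ^ P.p * (P.R a + P.R b) := by
  calc P.R (a + b) ≤ P.R (2 * max a b) :=
        P.R_mono (by linarith [le_max_left a b, le_max_right a b])
    _ ≤ 2 ^ P.p * P.R (max a b) := P.R_mul_le (by norm_num) _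
    _ ≤ _ := by gcongr; exact P.R_max_le a b

lemma R_div_le {l : ℝ} (hl : 0 < l) (hl1 : l ≤ 1) (t : ℝ) :
    P.R (t / l) ≤ (1 / l) ^ P.p * P.R t := by
  rw [show t / l = 1 / l * t by ring]
  exact P.R_mul_le (by rw [le_div_iff₀ hl]; linarith) t

lemma R_one_pow {t : ℝ} (ht : 0 ≤ t) (ht1 : t ≤ 1) : t ^ P.p ≤ 2 ^ P.p * P.R t := by
  unfold R
  rw [max_eq_left ht]
  have h1 : (2 : ℝ) ^ (P.q - P.p) ≤ (1 + t) ^ (P.q - P.p) :=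
    Real.rpow_le_rpow_of_nonpos (by positivity) (by linarith) (by linarith [P.q_le])
  have h2 : (1 : ℝ) ≤ 2 ^ P.p * 2 ^ (P.q - P.p) := by
    rw [← Real.rpow_add (by norm_num)]
    exact Real.one_le_rpow (by norm_num) (by linarith [P.q_pos])
  have h3 : 0 ≤ t ^ P.p := by positivity
  calc t ^ P.p ≤ t ^ P.p * (2 ^ P.p * 2 ^ (P.q - P.p)) := le_mul_of_one_le_right h3 h2
    _ ≤ t ^ P.p * (2 ^ P.p * (1 + t) ^ (P.q - P.p)) := by gcongr
    _ = _ := by ring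

lemma V_rpow_p {t : ℝ} (ht : 0 ≤ t) : P.V t ^ P.p = t ^ P.p * P.H t := by
  rw [P.V_pow_eq ht, Real.mul_rpow ht (Real.rpow_nonneg (P.H_nonneg ht) _), ← Real.rpow_mul
    (P.H_nonneg ht), one_div_mul_cancel P.p_pos.ne', Real.rpow_one]

lemma V_rpow_le_R (t : ℝ) : P.V t ^ P.p ≤ P.R t := by
  rcases le_total t 0 with ht | ht
  · rw [P.V_of_nonpos ht, P.R_of_nonpos ht, Real.zero_rpow P.p_pos.ne']
  · rw [P.V_rpow_p ht]
    unfold R H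
    rw [max_eq_left ht]
    have : -(1 + P.ξ) ≤ P.q - P.p := by unfold q; nlinarith [P.hξ, P.p_pos]
    gcongr
    linarith

lemma R_le_V {t d : ℝ} (hd : 0 < d) (ht : d ≤ t) :
    P.R t ≤ ((1 + d) / d) ^ (P.p * (P.κ - 1)) * P.V t ^ (P.p * P.κ) := by
  have h0 : 0 < t := hd.trans_le ht
  rw [Real.rpow_mul (P.V_nonneg t), P.V_rpow_p h0.le, Real.mul_rpow (by positivity)
    (P.H_nonneg h0.le), ← Real.rpow_mul h0.le]
  unfold R H
  rw [max_eq_left h0.le, ← Real.rpow_mul (by positivity)]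
  have e1 : P.p * P.κ = P.p + P.p * (P.κ - 1) := by ring
  rw [e1, Real.rpow_add h0]
  have hp := P.p_pos
  have hk := P.κ_gt
  have e2 : (1 + t) ^ (P.p * (P.κ - 1)) ≤
      ((1 + d) / d) ^ (P.p * (P.κ - 1)) * t ^ (P.p * (P.κ - 1)) := by
    rw [← Real.mul_rpow (by positivity) h0.le]
    apply Real.rpow_le_rpow (by positivity) _ (mul_nonneg hp.le (by linarith))
    rw [div_mul_eq_mul_div, le_div_iff₀ hd]; nlinarith
  have e3 : (1 + t) ^ (P.q - P.p) ≤
      (1 + t) ^ (P.p * (P.κ - 1)) * (1 + t) ^ (-(1 + P.ξ) * P.κ) := by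
    rw [← Real.rpow_add (by positivity)]
    apply Real.rpow_le_rpow_of_exponent_le (by linarith)
    have : P.q ≤ (P.p - 1 - P.ξ) * P.κ := P.hκ
    nlinarith
  calc t ^ P.p * (1 + t) ^ (P.q - P.p)
      ≤ t ^ P.p * ((1 + t) ^ (P.p * (P.κ - 1)) * (1 + t) ^ (-(1 + P.ξ) * P.κ)) := by gcongr
    _ ≤ t ^ P.p * (((1 + d) / d) ^ (P.p * (P.κ - 1)) * t ^ (P.p * (P.κ - 1)) *
          (1 + t) ^ (-(1 + P.ξ) * P.κ)) := by gcongr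
    _ = _ := by ring

end Prm

namespace Prm

variable (P : Prm)

lemma young_aux {X Z e : ℝ} (hX : 0 ≤ X) (hZ : 0 ≤ Z) (he : 0 < e) :
    X ^ (P.p - 1) * Z ≤ e * X ^ P.p + e ^ (1 - P.p) * Z ^ P.p := by
  have hp := P.p1_pos
  have split : ∀ {t : ℝ}, 0 ≤ t → t ^ P.p = t ^ (P.p - 1) * t := by
    intro t ht
    rcases ht.eq_or_lt with h | h
    · subst h; simp [Real.zero_rpow P.p_pos.ne']
    · rw [← Real.rpow_add_one h.ne']; ring_nf
  have h1 : 0 ≤ e * X ^ P.p := by positivity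
  have h2 : 0 ≤ e ^ (1 - P.p) * Z ^ P.p := by positivity
  rcases le_total Z (e * X) with h | h
  · have : X ^ (P.p - 1) * Z ≤ X ^ (P.p - 1) * (e * X) := by gcongr
    rw [split hX] at *
    nlinarith
  · have hXZ : X ≤ Z / e := by rw [le_div_iff₀ he]; linarith
    have : X ^ (P.p - 1) * Z ≤ (Z / e) ^ (P.p - 1) * Z := by gcongr
    have e1 : (Z / e) ^ (P.p - 1) * Z = e ^ (1 - P.p) * Z ^ P.p := by
      rw [split hZ, Real.div_rpow hZ he.le, show 1 - P.p = -(P.p - 1) by ring,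
        Real.rpow_neg he.le]; ring
    linarith

lemma rpow_sub_rpow_le {e h : ℝ} (he : 0 ≤ e) (heh : e ≤ h) :
    h ^ P.p - e ^ P.p ≤ P.p * h ^ (P.p - 1) * (h - e) := by
  rcases (he.trans heh).eq_or_lt with h0 | h0
  · have : e = h := le_antisymm heh (h0 ▸ he)
    subst this; simp
  · have := one_add_mul_self_le_rpow_one_add (s := e / h - 1) (p := P.p)
      (by have : 0 ≤ e / h := by positivity
          linarith) P.hp.le
    rw [add_sub_cancel, Real.div_rpow he h0.le, le_div_iff₀ (by positivity)] at this
    have e1 : h ^ P.p = h ^ (P.p - 1) * h := by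
      rw [← Real.rpow_add_one h0.ne']; ring_nf
    have e2 : (1 + P.p * (e / h - 1)) * h ^ P.p = h ^ P.p - P.p * h ^ (P.p - 1) * (h - e) := by
      rw [e1]; field_simp; ring
    linarith

lemma add_rpow_le_two {x y r : ℝ} (hx : 0 ≤ x) (hy : 0 ≤ y) (hr : 0 ≤ r) :
    (x + y) ^ r ≤ 2 ^ r * (x ^ r + y ^ r) := by
  calc (x + y) ^ r ≤ (2 * max x y) ^ r :=
        Real.rpow_le_rpow (by positivity) (by linarith [le_max_left x y, le_max_right x y]) hr
    _ = 2 ^ r * max x y ^ r := Real.mul_rpow (by norm_num) (le_max_of_le_left hx)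
    _ ≤ _ := by
      gcongr
      rcases le_total x y with h | h
      · rw [max_eq_right h]; linarith [Real.rpow_nonneg hx r]
      · rw [max_eq_left h]; linarith [Real.rpow_nonneg hy r]

/-- The absorption constant in the pointwise Caccioppoli inequality. -/
def cC : ℝ := (P.ξ / 2) ^ (1 - P.p) * (P.p * (1 + P.ξ)) ^ P.p + P.ξ / 2

/-- The coercivity constant in the pointwise Caccioppoli inequality. -/
def cc : ℝ := min (P.ξ / 2 * 2⁻¹ ^ P.p) (1 / 2)

lemma cc_pos : 0 < P.cc := by
  have := P.hξ
  unfold cc; positivity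

lemma cC_nonneg : 0 ≤ P.cC := by
  have := P.hξ
  have := P.p_pos
  unfold cC; positivity

lemma ptwise {a b e h : ℝ} (hba : b ≤ a) (he : 0 ≤ e) (hh : 0 ≤ h) :
    P.cc * (|P.V a * e - P.V b * h| ^ P.p + max (-b) 0 ^ (P.p - 1) * (P.g a * e ^ P.p)) ≤
      (a - b) ^ (P.p - 1) * (P.g a * e ^ P.p - P.g b * h ^ P.p) + P.cC * (P.R a * |e - h| ^ P.p) := by
  have hp := P.p_pos
  have hp1 := P.p1_pos
  have hξ := P.hξ
  have hab : 0 ≤ a - b := by linarith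
  have hcc := P.cc_pos
  have hCC := P.cC_nonneg
  have hbad : 0 ≤ P.cC * (P.R a * |e - h| ^ P.p) := by
    have := P.R_nonneg a; positivity
  rcases le_or_gt a 0 with ha | ha
  · rw [P.V_of_nonpos ha, P.V_of_nonpos (hba.trans ha), P.g_of_nonpos ha,
      P.g_of_nonpos (hba.trans ha)]
    simp only [zero_mul, sub_self, abs_zero, Real.zero_rpow hp.ne', mul_zero, add_zero, zero_add]
    exact hbad
  have split : ∀ {t : ℝ}, 0 ≤ t → t ^ P.p = t ^ (P.p - 1) * t := by
    intro t ht
    rcases ht.eq_or_lt with h | h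
    · subst h; simp [Real.zero_rpow P.p_pos.ne']
    · rw [← Real.rpow_add_one h.ne']; ring_nf
  rcases le_or_gt b 0 with hb | hb
  · rw [P.V_of_nonpos hb, P.g_of_nonpos hb, zero_mul, sub_zero, zero_mul, sub_zero,
      abs_of_nonneg (mul_nonneg (P.V_nonneg a) he), Real.mul_rpow (P.V_nonneg a) he,
      P.V_rpow_p ha.le, max_eq_left (by linarith : 0 ≤ -b)]
    have h1 : a ^ P.p * P.H a * P.ξ ≤ (a - b) ^ (P.p - 1) * P.g a := by
      have h2 := P.g_lower le_rfl ha.le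
      rw [P.g_of_nonpos le_rfl, sub_zero, sub_zero] at h2
      have h3 : a ^ (P.p - 1) ≤ (a - b) ^ (P.p - 1) :=
        Real.rpow_le_rpow ha.le (by linarith) hp1.le
      calc a ^ P.p * P.H a * P.ξ = a ^ (P.p - 1) * (P.ξ * P.H a * a) := by rw [split ha.le]; ring
        _ ≤ a ^ (P.p - 1) * P.g a := by gcongr
        _ ≤ _ := by have := P.g_nonneg a; gcongr
    have h4 : (-b) ^ (P.p - 1) * P.g a ≤ (a - b) ^ (P.p - 1) * P.g a := by
      have := P.g_nonneg a
      have : 0 ≤ -b := by linarith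
      gcongr
      linarith
    have h5 : 0 ≤ e ^ P.p := by positivity
    have h6 : P.cc ≤ P.ξ / 2 := by
      refine (min_le_left _ _).trans ?_
      have : (2⁻¹ : ℝ) ^ P.p ≤ 1 := Real.rpow_le_one (by norm_num) (by norm_num) hp.le
      nlinarith
    have h7 : P.cc ≤ 1 / 2 := min_le_right _ _
    have h8 : 0 ≤ a ^ P.p * P.H a * e ^ P.p := by have := P.H_nonneg ha.le; positivity
    have h9 : 0 ≤ (-b) ^ (P.p - 1) * P.g a * e ^ P.p := by
      have := P.g_nonneg a
      have : 0 ≤ -b := by linarith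
      positivity
    have h10 := mul_le_mul_of_nonneg_right h1 h5
    have h11 := mul_le_mul_of_nonneg_right h4 h5
    have h12 := mul_le_mul_of_nonneg_right h6 h8
    have h13 := mul_le_mul_of_nonneg_right h7 h9
    nlinarith
  · rw [max_eq_right (by linarith : -b ≤ 0), Real.zero_rpow hp1.ne', zero_mul, add_zero]
    set z := a - b with hz
    have hH := P.H_pos ha.le
    have hD := P.g_lower hb.le hba
    have hga := P.g_nonneg a
    have hgb := P.g_nonneg b
    have hRa := P.R_nonneg a
    have hY : 0 ≤ |e - h| := abs_nonneg _
    have hzz := split hab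
    have hz1 : 0 ≤ z ^ (P.p - 1) := by positivity
    -- coercive part
    have hgood : P.cc * |P.V a * e - P.V b * h| ^ P.p ≤
        P.ξ / 2 * (z ^ P.p * P.H a * h ^ P.p) + P.ξ / 2 * (P.R a * |e - h| ^ P.p) := by
      have e1 : |P.V a * e - P.V b * h| ≤ z * P.H a ^ (1 / P.p) * h + P.V a * |e - h| := by
        have : P.V a * e - P.V b * h = (P.V a - P.V b) * h + P.V a * (e - h) := by ring
        rw [this]
        refine (abs_add_le _ _).trans ?_
        rw [abs_mul, abs_mul, abs_of_nonneg (P.V_nonneg a), abs_of_nonneg hh,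
          abs_of_nonneg (sub_nonneg.2 (P.V_mono hba))]
        have := P.V_diff_le hb.le hba
        gcongr
      have e2 : |P.V a * e - P.V b * h| ^ P.p ≤
          2 ^ P.p * (z ^ P.p * P.H a * h ^ P.p + P.R a * |e - h| ^ P.p) := by
        refine (Real.rpow_le_rpow (abs_nonneg _) e1 hp.le).trans ?_
        have hv := P.V_nonneg a
        refine (add_rpow_le_two (by positivity) (by positivity) hp.le).trans ?_
        rw [Real.mul_rpow (by positivity) hh, Real.mul_rpow hab (by positivity),
          Real.mul_rpow hv hY, ← Real.rpow_mul hH.le, one_div_mul_cancel hp.ne', Real.rpow_one]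
        have := P.V_rpow_le_R a
        gcongr
      have e3 : P.cc ≤ P.ξ / 2 * 2⁻¹ ^ P.p := min_le_left _ _
      have e4 : (2⁻¹ : ℝ) ^ P.p * 2 ^ P.p = 1 := by
        rw [← Real.mul_rpow (by norm_num) (by norm_num)]; norm_num
      calc _ ≤ P.ξ / 2 * 2⁻¹ ^ P.p *
            (2 ^ P.p * (z ^ P.p * P.H a * h ^ P.p + P.R a * |e - h| ^ P.p)) := by gcongr
        _ = P.ξ / 2 * (2⁻¹ ^ P.p * 2 ^ P.p) *
            ((z ^ P.p * P.H a * h ^ P.p + P.R a * |e - h| ^ P.p)) := by ring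
        _ = _ := by rw [e4]; ring
    have hD' : P.ξ * (z ^ P.p * P.H a) ≤ z ^ (P.p - 1) * (P.g a - P.g b) := by
      calc _ = z ^ (P.p - 1) * (P.ξ * P.H a * z) := by rw [hzz]; ring
        _ ≤ _ := by gcongr
    rcases le_total h e with heh | heh
    · have k1 : h ^ P.p ≤ e ^ P.p := Real.rpow_le_rpow hh heh hp.le
      have k2 : P.g a * e ^ P.p - P.g b * h ^ P.p ≥ (P.g a - P.g b) * h ^ P.p := by
        nlinarith
      have k3 : z ^ (P.p - 1) * ((P.g a - P.g b) * h ^ P.p) ≤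
          z ^ (P.p - 1) * (P.g a * e ^ P.p - P.g b * h ^ P.p) := by gcongr
      have k4 := mul_le_mul_of_nonneg_right hD' (Real.rpow_nonneg hh P.p)
      have k5 : P.ξ / 2 ≤ P.cC := by
        unfold cC; have : 0 ≤ (P.ξ / 2) ^ (1 - P.p) * (P.p * (1 + P.ξ)) ^ P.p := by positivity
        linarith
      have k6 : 0 ≤ P.R a * |e - h| ^ P.p := by positivity
      have k7 := mul_le_mul_of_nonneg_right k5 k6
      have k8 : 0 ≤ P.ξ * (z ^ P.p * P.H a) * h ^ P.p := by positivity
      nlinarith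
    · have habs : |e - h| = h - e := by rw [abs_sub_comm, abs_of_nonneg (by linarith)]
      have m1 := P.rpow_sub_rpow_le he heh
      rw [← habs] at m1
      -- absorption
      have m2 : z ^ (P.p - 1) * (P.g a * (P.p * h ^ (P.p - 1) * |e - h|)) ≤
          P.ξ / 2 * (z ^ P.p * P.H a * h ^ P.p) +
          (P.ξ / 2) ^ (1 - P.p) * (P.p * (1 + P.ξ)) ^ P.p * (P.R a * |e - h| ^ P.p) := by
        have y := P.young_aux (X := z * h) (Z := P.g a * P.p / P.H a * |e - h|) (e := P.ξ / 2)
          (by positivity) (by positivity) (by positivity)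
        rw [Real.mul_rpow hab hh, Real.mul_rpow hab hh,
          Real.mul_rpow (by positivity) hY] at y
        have y2 : P.H a * (P.g a * P.p / P.H a) ^ P.p ≤ (P.p * (1 + P.ξ)) ^ P.p * P.R a := by
          rw [Real.div_rpow (by positivity) hH.le, Real.mul_rpow hga hp.le]
          have g1 : P.g a ^ P.p ≤ ((1 + P.ξ) * (a / (1 + a))) ^ P.p :=
            Real.rpow_le_rpow hga (P.g_upper ha.le) hp.le
          have g2 : P.H a ^ (1 - P.p) * (a / (1 + a)) ^ P.p = P.R a := by
            unfold H R q
            rw [max_eq_left ha.le, ← Real.rpow_mul (by positivity), Real.div_rpow ha.le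
              (by positivity), div_eq_mul_inv, ← Real.rpow_neg (by positivity), mul_left_comm,
              ← Real.rpow_add (by positivity)]
            ring_nf
          have g3 : P.H a * (P.H a ^ P.p)⁻¹ = P.H a ^ (1 - P.p) := by
            rw [Real.rpow_sub hH, Real.rpow_one]; rfl
          calc P.H a * (P.g a ^ P.p * P.p ^ P.p / P.H a ^ P.p)
              = P.H a ^ (1 - P.p) * (P.g a ^ P.p * P.p ^ P.p) := by rw [← g3]; field_simp
            _ ≤ P.H a ^ (1 - P.p) * (((1 + P.ξ) * (a / (1 + a))) ^ P.p * P.p ^ P.p) := by gcongr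
            _ = _ := by
              rw [Real.mul_rpow (by positivity) (by positivity),
                Real.mul_rpow hp.le (by positivity), ← g2]; ring
        have y3 := mul_le_mul_of_nonneg_left y hH.le
        calc _ = P.H a * (z ^ (P.p - 1) * h ^ (P.p - 1) * (P.g a * P.p / P.H a * |e - h|)) := by
              field_simp
          _ ≤ _ := y3
          _ = P.ξ / 2 * (z ^ P.p * P.H a * h ^ P.p) + (P.ξ / 2) ^ (1 - P.p) *
                (P.H a * (P.g a * P.p / P.H a) ^ P.p) * |e - h| ^ P.p := by ring
          _ ≤ P.ξ / 2 * (z ^ P.p * P.H a * h ^ P.p) + (P.ξ / 2) ^ (1 - P.p) *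
                ((P.p * (1 + P.ξ)) ^ P.p * P.R a) * |e - h| ^ P.p := by gcongr
          _ = _ := by ring
      have k4 := mul_le_mul_of_nonneg_right hD' (Real.rpow_nonneg hh P.p)
      have k9 : z ^ (P.p - 1) * (P.g a * (h ^ P.p - e ^ P.p)) ≤
          z ^ (P.p - 1) * (P.g a * (P.p * h ^ (P.p - 1) * |e - h|)) := by gcongr
      have k10 : P.cC * (P.R a * |e - h| ^ P.p) =
          (P.ξ / 2) ^ (1 - P.p) * (P.p * (1 + P.ξ)) ^ P.p * (P.R a * |e - h| ^ P.p) +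
          P.ξ / 2 * (P.R a * |e - h| ^ P.p) := by unfold cC; ring
      rw [k10]
      have k11 : z ^ (P.p - 1) * (P.g a * e ^ P.p - P.g b * h ^ P.p) =
          z ^ (P.p - 1) * (P.g a - P.g b) * h ^ P.p - z ^ (P.p - 1) * (P.g a * (h ^ P.p - e ^ P.p)) := by
        ring
      nlinarith

lemma cc_le_one : P.cc ≤ 1 := (min_le_right _ _).trans (by norm_num)

open Classical in
/-- Pointwise Caccioppoli inequality with far-away points separated off. -/
lemma ptwise_full {a b e h : ℝ} (X Y : Prop) (he : 0 ≤ e) (hh : 0 ≤ h)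
    (hX : ¬ X → e = 0) (hY : ¬ Y → h = 0) :
    P.cc * (|P.V a * e - P.V b * h| ^ P.p + max (-b) 0 ^ (P.p - 1) * (P.g a * e ^ P.p)) ≤
      P.J (a - b) * (P.g a * e ^ P.p - P.g b * h ^ P.p) +
      (P.cC + 1) * (((if X then P.R a else 0) + (if Y then P.R b else 0)) * |e - h| ^ P.p +
        ((if X then 0 else max a 0 ^ (P.p - 1)) * (P.g b * h ^ P.p) +
        (if Y then 0 else max b 0 ^ (P.p - 1)) * (P.g a * e ^ P.p))) := by
  have hp := P.p_pos
  have hp1 := P.p1_pos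
  have hC := P.cC_nonneg
  have hc1 := P.cc_le_one
  have hc0 := P.cc_pos
  have hRa := P.R_nonneg a
  have hRb := P.R_nonneg b
  have hga := P.g_nonneg a
  have hgb := P.g_nonneg b
  have hz : 0 ≤ |e - h| ^ P.p := by positivity
  have hea : 0 ≤ P.g a * e ^ P.p := by positivity
  have heb : 0 ≤ P.g b * h ^ P.p := by positivity
  have hma : 0 ≤ max a 0 ^ (P.p - 1) := Real.rpow_nonneg (le_max_right _ _) _
  have hmb : 0 ≤ max b 0 ^ (P.p - 1) := Real.rpow_nonneg (le_max_right _ _) _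
  have hif1 : 0 ≤ (if X then P.R a else 0) := by split_ifs <;> simp [hRa]
  have hif2 : 0 ≤ (if Y then P.R b else 0) := by split_ifs <;> simp [hRb]
  have hif3 : 0 ≤ (if X then 0 else max a 0 ^ (P.p - 1)) * (P.g b * h ^ P.p) := by
    split_ifs
    · simp
    · positivity
  have hif4 : 0 ≤ (if Y then 0 else max b 0 ^ (P.p - 1)) * (P.g a * e ^ P.p) := by
    split_ifs
    · simp
    · positivity
  -- far case: the larger point lies outside
  have far : ∀ {a b h : ℝ}, b ≤ a → 0 ≤ h → P.cc * (P.V b * h) ^ P.p ≤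
      -((a - b) ^ (P.p - 1) * (P.g b * h ^ P.p)) + (P.cC + 1) * (P.R b * h ^ P.p +
        max a 0 ^ (P.p - 1) * (P.g b * h ^ P.p)) := by
    intro a b h hba hh
    have f1 : P.cc * (P.V b * h) ^ P.p ≤ P.R b * h ^ P.p := by
      rw [Real.mul_rpow (P.V_nonneg b) hh]
      have f1 := P.V_rpow_le_R b
      have f2 : 0 ≤ P.V b ^ P.p * h ^ P.p := by have := P.V_nonneg b; positivity
      calc _ ≤ 1 * (P.V b ^ P.p * h ^ P.p) := by gcongr
        _ ≤ _ := by rw [one_mul]; gcongr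
    have f0 : 0 ≤ P.R b * h ^ P.p := by have := P.R_nonneg b; positivity
    have f3 : (a - b) ^ (P.p - 1) * (P.g b * h ^ P.p) ≤
        max a 0 ^ (P.p - 1) * (P.g b * h ^ P.p) := by
      rcases le_total b 0 with hb | hb
      · rw [P.g_of_nonpos hb]; simp
      · have := P.g_nonneg b
        rw [max_eq_left (hb.trans hba)]
        gcongr
        linarith
    have f4 : 0 ≤ max a 0 ^ (P.p - 1) * (P.g b * h ^ P.p) := by
      have := P.g_nonneg b
      have : 0 ≤ max a 0 := le_max_right _ _
      positivity
    nlinarith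
  rcases le_total b a with hba | hba
  · rw [P.J_of_nonneg (sub_nonneg.2 hba)]
    by_cases x : X
    · have := P.ptwise hba he hh
      simp only [x, if_true] at *
      have k1 : 0 ≤ (if Y then P.R b else 0) * |e - h| ^ P.p := mul_nonneg hif2 hz
      have k2 : 0 ≤ P.R a * |e - h| ^ P.p := by positivity
      nlinarith
    · have := hX x
      subst this
      have := far hba hh
      simp only [x, if_false, Real.zero_rpow hp.ne', mul_zero, zero_sub, add_zero, abs_neg,
        abs_of_nonneg hh, zero_add, abs_of_nonneg (mul_nonneg (P.V_nonneg b) hh)] at *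
      by_cases y : Y
      · simp only [y, if_true] at *
        linarith
      · have := hY y
        subst this
        simp [Real.zero_rpow hp.ne']
  · have hJ : P.J (a - b) = -(b - a) ^ (P.p - 1) := by
      rw [← P.J_of_nonneg (sub_nonneg.2 hba), ← J_neg]; ring_nf
    rw [hJ]
    have hcross : max (-b) 0 ^ (P.p - 1) * (P.g a * e ^ P.p) = 0 := by
      rcases le_total b 0 with hb | hb
      · rw [P.g_of_nonpos (hba.trans hb)]; simp
      · rw [max_eq_right (by linarith), Real.zero_rpow hp1.ne', zero_mul]
    rw [hcross, add_zero]
    by_cases y : Y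
    · have := P.ptwise hba hh he
      rw [abs_sub_comm, abs_sub_comm h] at this
      simp only [y, if_true] at *
      have k1 : 0 ≤ (if X then P.R a else 0) * |e - h| ^ P.p := mul_nonneg hif1 hz
      have k2 : 0 ≤ P.R b * |e - h| ^ P.p := by positivity
      have k3 : 0 ≤ max (-a) 0 ^ (P.p - 1) * (P.g b * h ^ P.p) := by
        have : 0 ≤ max (-a) 0 := le_max_right _ _
        positivity
      nlinarith
    · have := hY y
      subst this
      have := far hba he
      simp only [y, if_false, Real.zero_rpow hp.ne', mul_zero, sub_zero, add_zero,
        abs_of_nonneg he, zero_add, abs_of_nonneg (mul_nonneg (P.V_nonneg a) he)] at *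
      by_cases x : X
      · simp only [x, if_true] at *
        linarith
      · have := hX x
        subst this
        simp [Real.zero_rpow hp.ne']

end Prm

instance (P : Prm) : NeZero P.n := ⟨by have := P.hn; omega⟩

namespace Prm

variable (P : Prm)

/-- The model kernel `|z|^{-(n+sp)}`. -/
def ker (z : Rn P.n) : ℝ := (‖z‖ ^ P.N)⁻¹

lemma ker_nonneg (z : Rn P.n) : 0 ≤ P.ker z := by unfold ker; positivity

@[fun_prop] lemma measurable_ker : Measurable P.ker := by unfold ker; fun_prop

lemma ker_neg (z : Rn P.n) : P.ker (-z) = P.ker z := by simp [ker]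

lemma ker_sub_comm (x y : Rn P.n) : P.ker (x - y) = P.ker (y - x) := by
  rw [← ker_neg, neg_sub]

lemma ker_smul {l : ℝ} (hl : 0 < l) (z : Rn P.n) : P.ker (l • z) = (l ^ P.N)⁻¹ * P.ker z := by
  unfold ker
  rw [norm_smul, Real.norm_of_nonneg hl.le, Real.mul_rpow hl.le (norm_nonneg _), mul_inv]

lemma ker_le {z w : Rn P.n} {a : ℝ} (ha : 0 < a) (hw : 0 < ‖w‖) (h : a * ‖w‖ ≤ ‖z‖) :
    P.ker z ≤ (a ^ P.N)⁻¹ * P.ker w := by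
  unfold ker
  rw [← mul_inv, ← Real.mul_rpow ha.le hw.le]
  have := P.N_pos
  gcongr

lemma one_le_ker {z : Rn P.n} (hz : z ≠ 0) (h : ‖z‖ ≤ 1) : 1 ≤ P.ker z := by
  unfold ker
  have : 0 < ‖z‖ := norm_pos_iff.2 hz
  rw [one_le_inv₀ (by positivity)]
  exact Real.rpow_le_one this.le h P.N_pos.le

lemma ker_le_of_le {z : Rn P.n} {a : ℝ} (ha : 0 < a) (h : a ≤ ‖z‖) :
    P.ker z ≤ (a ^ P.N)⁻¹ := by
  unfold ker
  have := P.N_pos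
  gcongr

lemma map_affine (x0 : Rn P.n) {l : ℝ} (hl : 0 < l) :
    Measure.map (fun x : Rn P.n => x0 + l • x) volume =
      ENNReal.ofReal ((l ^ P.n)⁻¹) • (volume : Measure (Rn P.n)) := by
  have h1 : (fun x : Rn P.n => x0 + l • x) = (fun x => x0 + x) ∘ (fun x => l • x) := rfl
  rw [h1, ← Measure.map_map (by fun_prop) (by fun_prop), Measure.map_addHaar_smul _ hl.ne',
    Measure.map_smul, map_add_left_eq_self, finrank_euclideanSpace_fin, abs_of_pos (by positivity)]

lemma measurableEmbedding_affine (x0 : Rn P.n) {l : ℝ} (hl : 0 < l) :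
    MeasurableEmbedding (fun x : Rn P.n => x0 + l • x) :=
  (((Homeomorph.smulOfNeZero l hl.ne').trans (Homeomorph.addLeft x0))).measurableEmbedding

lemma lint_affine (x0 : Rn P.n) {l : ℝ} (hl : 0 < l) (F : Rn P.n → ℝ≥0∞) :
    ∫⁻ x, F (x0 + l • x) = ENNReal.ofReal ((l ^ P.n)⁻¹) * ∫⁻ x, F x := by
  rw [← (P.measurableEmbedding_affine x0 hl).lintegral_map F, P.map_affine x0 hl,
    lintegral_smul_measure, smul_eq_mul]

lemma affine_mem_ball (x0 x : Rn P.n) {l : ℝ} (hl : 0 < l) (r : ℝ) :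
    x0 + l • x ∈ ball x0 (l * r) ↔ x ∈ ball (0 : Rn P.n) r := by
  simp [mem_ball, dist_eq_norm, norm_smul, abs_of_pos hl, hl]

lemma lint_ball_affine (x0 : Rn P.n) {l : ℝ} (hl : 0 < l) (r : ℝ) (F : Rn P.n → ℝ≥0∞) :
    ∫⁻ x in ball 0 r, F (x0 + l • x) =
      ENNReal.ofReal ((l ^ P.n)⁻¹) * ∫⁻ x in ball x0 (l * r), F x := by
  rw [← lintegral_indicator measurableSet_ball, ← lintegral_indicator measurableSet_ball,
    ← P.lint_affine x0 hl]
  congr 1; ext x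
  have := P.affine_mem_ball x0 x hl r
  by_cases hx : x ∈ ball (0 : Rn P.n) r
  · rw [indicator_of_mem hx, indicator_of_mem (this.2 hx)]
  · rw [indicator_of_notMem hx, indicator_of_notMem (fun h => hx (this.1 h))]

lemma lint_tail_affine (x0 : Rn P.n) {l : ℝ} (hl : 0 < l) (r : ℝ) (F : Rn P.n → ℝ≥0∞) :
    ∫⁻ x in (ball 0 r)ᶜ, F (x0 + l • x) * ENNReal.ofReal (P.ker x) =
      ENNReal.ofReal (l ^ (P.s * P.p)) *
        ∫⁻ x in (ball x0 (l * r))ᶜ, F x * ENNReal.ofReal (P.ker (x - x0)) := by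
  rw [← lintegral_indicator measurableSet_ball.compl,
    ← lintegral_indicator measurableSet_ball.compl]
  have h1 : ∀ x : Rn P.n, (ball (0 : Rn P.n) r)ᶜ.indicator
      (fun x => F (x0 + l • x) * ENNReal.ofReal (P.ker x)) x =
      ENNReal.ofReal (l ^ P.N) * (ball x0 (l * r))ᶜ.indicator
        (fun x => F x * ENNReal.ofReal (P.ker (x - x0))) (x0 + l • x) := by
    intro x
    have := P.affine_mem_ball x0 x hl r
    by_cases hx : x ∈ ball (0 : Rn P.n) r
    · rw [indicator_of_notMem (by simpa using hx), indicator_of_notMem (by simpa using this.2 hx),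
        mul_zero]
    · rw [indicator_of_mem (by simpa using hx),
        indicator_of_mem (show x0 + l • x ∈ (ball x0 (l * r))ᶜ from fun h => hx (this.1 h)),
        mul_left_comm, ← ENNReal.ofReal_mul (by positivity), add_sub_cancel_left, P.ker_smul hl,
        ← mul_assoc, mul_inv_cancel₀ (by positivity), one_mul]
  simp_rw [h1]
  rw [lintegral_const_mul' _ _ ENNReal.ofReal_ne_top, P.lint_affine x0 hl, ← mul_assoc,
    ← ENNReal.ofReal_mul (by positivity)]
  congr 2
  rw [← Real.rpow_natCast, ← Real.rpow_neg hl.le, ← Real.rpow_add hl]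
  unfold N; congr 1; ring

lemma integrable_min_ker :
    Integrable (fun z : Rn P.n => min 1 (‖z‖ ^ P.p) * P.ker z) := by
  have := (integrable_fun_norm_addHaar (volume : Measure (Rn P.n))
    (f := fun r : ℝ => min 1 (r ^ P.p) * (r ^ P.N)⁻¹)).2
  refine this ?_
  have hs := P.hs; have hs1 := P.hs1; have hp := P.p_pos; have hsp := P.sp_pos
  rw [← Ioc_union_Ioi_eq_Ioi (zero_le_one' ℝ), integrableOn_union]
  have e1 : ∀ y : ℝ, 0 < y → y ^ (Module.finrank ℝ (Rn P.n) - 1) = y ^ ((P.n : ℝ) - 1) := by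
    intro y hy
    rw [finrank_euclideanSpace_fin, ← Real.rpow_natCast, Nat.cast_sub P.hn, Nat.cast_one]
  constructor
  · have h1 : IntegrableOn (fun y : ℝ => y ^ ((1 - P.s) * P.p - 1)) (Ioc 0 1) := by
      rw [← intervalIntegrable_iff_integrableOn_Ioc_of_le zero_le_one]
      apply intervalIntegral.intervalIntegrable_rpow'
      have : 0 < (1 - P.s) * P.p := mul_pos (by linarith) hp
      linarith
    refine h1.congr_fun (fun y hy => ?_) measurableSet_Ioc
    simp only [smul_eq_mul]
    rw [e1 y hy.1, min_eq_right (Real.rpow_le_one hy.1.le hy.2 hp.le), ← Real.rpow_neg hy.1.le,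
      ← Real.rpow_add hy.1, ← Real.rpow_add hy.1]
    unfold N; congr 1; ring
  · have h1 : IntegrableOn (fun y : ℝ => y ^ (-(P.s * P.p) - 1)) (Ioi 1) :=
      integrableOn_Ioi_rpow_of_lt (by linarith) zero_lt_one
    refine h1.congr_fun (fun y hy => ?_) measurableSet_Ioi
    have hy0 : (0 : ℝ) < y := zero_lt_one.trans hy
    simp only [smul_eq_mul]
    rw [e1 y hy0, min_eq_left (Real.one_le_rpow (le_of_lt hy) hp.le), one_mul,
      ← Real.rpow_neg hy0.le, ← Real.rpow_add hy0]
    unfold N; congr 1; ring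

/-- The total mass of the kernel truncated near the origin. -/
def C0 : ℝ := ∫ z : Rn P.n, min 1 (‖z‖ ^ P.p) * P.ker z

lemma C0_nonneg : 0 ≤ P.C0 :=
  integral_nonneg fun z => by have := P.ker_nonneg z; positivity

lemma lint_min_ker :
    ∫⁻ z : Rn P.n, ENNReal.ofReal (min 1 (‖z‖ ^ P.p) * P.ker z) = ENNReal.ofReal P.C0 := by
  rw [C0, ofReal_integral_eq_lintegral_ofReal P.integrable_min_ker]
  exact Eventually.of_forall fun z => by have := P.ker_nonneg z; positivity

lemma lint_ker_compl {r : ℝ} (hr : 0 < r) :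
    ∫⁻ z in (ball (0 : Rn P.n) r)ᶜ, ENNReal.ofReal (P.ker z) ≤
      ENNReal.ofReal (r ^ (-(P.s * P.p)) * P.C0) := by
  have h := P.lint_tail_affine (0 : Rn P.n) hr 1 (fun _ => 1)
  simp only [one_mul, mul_one, sub_zero] at h
  have h2 : ∫⁻ z in (ball (0 : Rn P.n) 1)ᶜ, ENNReal.ofReal (P.ker z) ≤ ENNReal.ofReal P.C0 := by
    rw [← P.lint_min_ker, ← lintegral_indicator measurableSet_ball.compl]
    refine lintegral_mono fun z => ?_
    simp only [indicator]
    split_ifs with hz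
    · have : 1 ≤ ‖z‖ := by simpa using hz
      rw [min_eq_left (Real.one_le_rpow this P.p_pos.le), one_mul]
    · simp
  rw [h] at h2
  have h3 : (1 : ℝ≥0∞) = ENNReal.ofReal (r ^ (-(P.s * P.p))) * ENNReal.ofReal (r ^ (P.s * P.p)) := by
    rw [← ENNReal.ofReal_mul (by positivity), ← Real.rpow_add hr]; simp
  calc _ = ENNReal.ofReal (r ^ (-(P.s * P.p))) * (ENNReal.ofReal (r ^ (P.s * P.p)) *
        ∫⁻ z in (ball (0 : Rn P.n) r)ᶜ, ENNReal.ofReal (P.ker z)) := by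
          rw [← mul_assoc, ← h3, one_mul]
    _ ≤ _ := by
      rw [ENNReal.ofReal_mul (by positivity)]
      gcongr

lemma lint_cutoff_ker {η : Rn P.n → ℝ} {l : ℝ} (hl : 1 ≤ l)
    (h0 : ∀ x, 0 ≤ η x) (h1 : ∀ x, η x ≤ 1) (hη : ∀ x y, |η x - η y| ≤ l * ‖x - y‖)
    (x : Rn P.n) :
    ∫⁻ y, ENNReal.ofReal (|η x - η y| ^ P.p * P.ker (x - y)) ≤
      ENNReal.ofReal (l ^ P.p * P.C0) := by
  rw [ENNReal.ofReal_mul (by positivity), ← P.lint_min_ker,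
    ← lintegral_const_mul' _ _ ENNReal.ofReal_ne_top, ← lintegral_sub_left_eq_self
      (fun z => ENNReal.ofReal (l ^ P.p) * ENNReal.ofReal (min 1 (‖z‖ ^ P.p) * P.ker z)) x]
  refine lintegral_mono fun y => ?_
  rw [← ENNReal.ofReal_mul (by positivity), ← mul_assoc]
  refine ENNReal.ofReal_le_ofReal (mul_le_mul_of_nonneg_right ?_ (P.ker_nonneg _))
  have hp := P.p_pos
  rcases le_total 1 (‖x - y‖ ^ P.p) with h | h
  · rw [min_eq_left h]
    have : |η x - η y| ≤ 1 := abs_le.2 ⟨by linarith [h0 x, h1 y], by linarith [h1 x, h0 y]⟩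
    calc _ ≤ (1 : ℝ) := Real.rpow_le_one (abs_nonneg _) this hp.le
      _ ≤ l ^ P.p * 1 := by rw [mul_one]; exact Real.one_le_rpow hl hp.le
  · rw [min_eq_right h, ← Real.mul_rpow (by linarith) (norm_nonneg _)]
    gcongr
    exact hη x y

end Prm

namespace Prm

variable (P : Prm)

/-- The volume of the unit ball. -/
def ω : ℝ := (volume (ball (0 : Rn P.n) 1)).toReal

lemma ω_pos : 0 < P.ω :=
  ENNReal.toReal_pos (measure_ball_pos _ _ one_pos).ne' measure_ball_lt_top.ne

lemma vol_ball (x : Rn P.n) {r : ℝ} (hr : 0 ≤ r) :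
    volume (ball x r) = ENNReal.ofReal (r ^ P.n * P.ω) := by
  rw [Measure.addHaar_ball _ _ hr, finrank_euclideanSpace_fin, ENNReal.ofReal_mul (by positivity),
    ω, ENNReal.ofReal_toReal measure_ball_lt_top.ne]

lemma ptw_sobolev (v : Rn P.n → ℝ) (x : Rn P.n) {r : ℝ} (hr : 0 < r) (hv : Measurable v) :
    ENNReal.ofReal (|v x| ^ P.p * (r ^ P.n * P.ω)) ≤
      ENNReal.ofReal (2 ^ P.p) * (ENNReal.ofReal (r ^ P.N) *
        (∫⁻ y, ENNReal.ofReal (|v x - v y| ^ P.p * P.ker (x - y))) +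
          ∫⁻ y, ENNReal.ofReal (|v y| ^ P.p)) := by
  have hp := P.p_pos
  rw [ENNReal.ofReal_mul (by positivity), ← P.vol_ball x hr.le, ← setLIntegral_const,
    ← lintegral_const_mul' _ _ ENNReal.ofReal_ne_top, ← lintegral_add_right _ (by fun_prop),
    ← lintegral_const_mul' _ _ ENNReal.ofReal_ne_top]
  refine le_trans (setLIntegral_mono' (g := fun y => ENNReal.ofReal (2 ^ P.p) *
    (ENNReal.ofReal (r ^ P.N) * ENNReal.ofReal (|v x - v y| ^ P.p * P.ker (x - y)) +
      ENNReal.ofReal (|v y| ^ P.p))) measurableSet_ball fun y hy => ?_)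
    (setLIntegral_le_lintegral _ _)
  rw [← ENNReal.ofReal_mul (by positivity), ← ENNReal.ofReal_add _ (by positivity),
    ← ENNReal.ofReal_mul (by positivity)]
  · refine ENNReal.ofReal_le_ofReal ?_
    have h1 : |v x - v y| ^ P.p ≤ r ^ P.N * (|v x - v y| ^ P.p * P.ker (x - y)) := by
      rcases eq_or_ne x y with h | h
      · subst h; simp [Real.zero_rpow hp.ne']
      · have h2 : 0 < ‖x - y‖ := norm_pos_iff.2 (sub_ne_zero.2 h)
        have h3 : 1 ≤ r ^ P.N * P.ker (x - y) := by
          unfold ker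
          rw [← div_eq_mul_inv, one_le_div (by positivity)]
          have := P.N_pos
          have h4 : ‖x - y‖ ≤ r := by
            rw [mem_ball, dist_comm, dist_eq_norm] at hy; exact hy.le
          gcongr
        have h5 : 0 ≤ |v x - v y| ^ P.p := by positivity
        nlinarith
    calc |v x| ^ P.p ≤ (|v x - v y| + |v y|) ^ P.p := by
          gcongr
          have := abs_add_le (v x - v y) (v y)
          rwa [sub_add_cancel] at this
      _ ≤ 2 ^ P.p * (|v x - v y| ^ P.p + |v y| ^ P.p) := by
          exact add_rpow_le_two (abs_nonneg _) (abs_nonneg _) hp.le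
      _ ≤ _ := by gcongr
  · have := P.ker_nonneg (x - y); positivity

/-- The constant in the fractional Gagliardo–Nirenberg inequality. -/
def CG : ℝ := (2 * (2 ^ P.p / P.ω)) ^ P.κ

lemma CG_pos : 0 < P.CG := by have := P.ω_pos; unfold CG; positivity

lemma opt_radius {A U W : ℝ} (hA : 0 ≤ A) (hU : 0 ≤ U) (hW : 0 < W)
    (h : ∀ r : ℝ, 0 < r → A * (r ^ P.n * P.ω) ≤ 2 ^ P.p * (r ^ P.N * U + W)) :
    A ^ P.κ ≤ P.CG * (U * W ^ (P.κ - 1)) := by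
  have hω := P.ω_pos
  have hn := P.n_pos
  have hN := P.N_pos
  have hκ := P.κ_gt
  have hNκ : P.N = P.n * P.κ := by unfold N κ; field_simp
  rcases hU.eq_or_lt with h0 | hU
  · subst h0
    have h1 : A = 0 := by
      by_contra hne
      have hA' : 0 < A := lt_of_le_of_ne hA (Ne.symm hne)
      have h2 := fun r hr => h r hr
      set T : ℝ := 2 ^ P.p * W / (A * P.ω) + 1 with hT
      have hT1 : 1 ≤ T := by rw [hT]; have : 0 ≤ 2 ^ P.p * W / (A * P.ω) := by positivity
                             linarith
      have h3 := h2 T (by linarith)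
      have h4 : T ≤ T ^ P.n := le_self_pow₀ hT1 (by have := P.hn; omega)
      have h5 : A * P.ω * T = 2 ^ P.p * W + A * P.ω := by rw [hT]; field_simp
      have h6 : A * P.ω * T ≤ A * P.ω * T ^ P.n := by gcongr
      have h7 : 0 < A * P.ω := by positivity
      nlinarith
    subst h1
    rw [Real.zero_rpow (by linarith)]; simp
  · set r := (W / U) ^ (1 / P.N) with hr
    have hr0 : 0 < r := by positivity
    have h1 : r ^ P.N = W / U := by
      rw [hr, ← Real.rpow_mul (by positivity), one_div_mul_cancel hN.ne', Real.rpow_one]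
    have h2 : (r ^ P.n) ^ P.κ = W / U := by
      rw [← Real.rpow_natCast, ← Real.rpow_mul hr0.le, ← hNκ, h1]
    have h3 := h r hr0
    rw [h1, div_mul_cancel₀ _ hU.ne'] at h3
    have h4 : A * r ^ P.n ≤ 2 * (2 ^ P.p / P.ω) * W := by
      have : 2 * (2 ^ P.p / P.ω) * W = (2 ^ P.p * (W + W)) / P.ω := by ring
      rw [this, le_div_iff₀ hω]; linarith
    have h5 : (A * r ^ P.n) ^ P.κ ≤ (2 * (2 ^ P.p / P.ω) * W) ^ P.κ := by gcongr
    rw [Real.mul_rpow hA (by positivity), h2, Real.mul_rpow (by positivity) hW.le] at h5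
    have h6 : W ^ P.κ = W ^ (P.κ - 1) * W := by
      rw [← Real.rpow_add_one hW.ne']; congr 1; ring
    rw [h6] at h5
    have h7 : A ^ P.κ * (W / U) * (U / W) = A ^ P.κ := by field_simp
    have h8 : (2 * (2 ^ P.p / P.ω)) ^ P.κ * (W ^ (P.κ - 1) * W) * (U / W) =
        P.CG * (U * W ^ (P.κ - 1)) := by unfold CG; field_simp
    rw [← h7, ← h8]
    gcongr

lemma gagliardo_nirenberg {v : Rn P.n → ℝ} (hv : Measurable v)
    (hW : ∫⁻ y, ENNReal.ofReal (|v y| ^ P.p) ≠ ⊤) :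
    ∫⁻ x, ENNReal.ofReal (|v x| ^ (P.p * P.κ)) ≤
      ENNReal.ofReal P.CG * ((∫⁻ x, ∫⁻ y, ENNReal.ofReal (|v x - v y| ^ P.p * P.ker (x - y))) *
        (∫⁻ y, ENNReal.ofReal (|v y| ^ P.p)) ^ (P.κ - 1)) := by
  have hp := P.p_pos
  have hκ := P.κ_gt
  set W := ∫⁻ y, ENNReal.ofReal (|v y| ^ P.p) with hWdef
  rcases eq_or_ne W 0 with h0 | h0
  · rw [hWdef, lintegral_eq_zero_iff (by fun_prop)] at h0
    have : ∫⁻ x, ENNReal.ofReal (|v x| ^ (P.p * P.κ)) = 0 := by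
      rw [lintegral_eq_zero_iff (by fun_prop)]
      filter_upwards [h0] with x hx
      simp only [Pi.zero_apply, ENNReal.ofReal_eq_zero] at hx ⊢
      have : |v x| = 0 := by
        by_contra h
        have h1 : 0 < |v x| := lt_of_le_of_ne (abs_nonneg _) (Ne.symm h)
        have : 0 < |v x| ^ P.p := by positivity
        linarith
      rw [this, Real.zero_rpow (by positivity)]
    rw [this]; exact zero_le
  · have hWr : 0 < W.toReal := ENNReal.toReal_pos h0 hW
    have hWk : W ^ (P.κ - 1) ≠ 0 := by
      rw [Ne, ENNReal.rpow_eq_zero_iff]; rintro (h | h)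
      · exact h0 h.1
      · exact hW h.1
    have hWk' : W ^ (P.κ - 1) ≠ ⊤ := ENNReal.rpow_ne_top_of_nonneg (by linarith) hW
    rw [← lintegral_mul_const' _ _ hWk', ← lintegral_const_mul' _ _ ENNReal.ofReal_ne_top]
    refine lintegral_mono fun x => ?_
    set U := ∫⁻ y, ENNReal.ofReal (|v x - v y| ^ P.p * P.ker (x - y)) with hU
    by_cases hUt : U = ⊤
    · rw [hUt, ENNReal.top_mul hWk, ENNReal.mul_top (by simp [P.CG_pos])]
      exact le_top
    have key := P.opt_radius (A := |v x| ^ P.p) (U := U.toReal) (W := W.toReal) (by positivity)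
      ENNReal.toReal_nonneg hWr (fun r hr => by
        have h1 := P.ptw_sobolev v x hr hv
        rw [← hWdef, ← hU, ← ENNReal.ofReal_toReal hUt, ← ENNReal.ofReal_toReal hW,
          ← ENNReal.ofReal_mul (by positivity), ← ENNReal.ofReal_add (by positivity) (by positivity),
          ← ENNReal.ofReal_mul (by positivity)] at h1
        refine (ENNReal.ofReal_le_ofReal_iff (by positivity)).1 h1)
    rw [Real.rpow_mul (abs_nonneg _)]
    refine (ENNReal.ofReal_le_ofReal key).trans ?_
    rw [ENNReal.ofReal_mul P.CG_pos.le, ENNReal.ofReal_mul (by positivity),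
      ENNReal.ofReal_toReal hUt, ← ENNReal.ofReal_rpow_of_pos hWr, ENNReal.ofReal_toReal hW]

end Prm

namespace Prm

variable (P : Prm)

/-- The integrand of the nonlocal form tested with `G(u) ζ`. -/
def form (k : Rn P.n → Rn P.n → ℝ) (u : Rn P.n → ℝ) (G : ℝ → ℝ) (ζ : Rn P.n → ℝ)
    (z : Rn P.n × Rn P.n) : ℝ :=
  k z.1 z.2 * P.J (u z.1 - u z.2) * (G (u z.1) * ζ z.1 - G (u z.2) * ζ z.2) * P.ker (z.1 - z.2)

/-- Functions solving a nonlocal equation in `B_r(x₀)` with a right-hand side of mass at most `M`,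
in the sense of testing with `G(u) ζ` for bounded Lipschitz `G` and Lipschitz cutoffs `ζ`. -/
def InCls (x0 : Rn P.n) (r M : ℝ) (u : Rn P.n → ℝ) : Prop :=
  Measurable u ∧ ∃ k : Rn P.n → Rn P.n → ℝ, (∀ x y, P.L⁻¹ ≤ k x y ∧ k x y ≤ P.L) ∧
    ∀ (G : ℝ → ℝ) (B : ℝ) (ζ : Rn P.n → ℝ), (∃ C, LipschitzWith C G) → (∀ t, |G t| ≤ B) →
      (∃ C, LipschitzWith C ζ) → (∀ x, 0 ≤ ζ x ∧ ζ x ≤ 1) →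
      (∃ ρ < r, ∀ x, x ∉ closedBall x0 ρ → ζ x = 0) →
      Integrable (P.form k u G ζ) ∧ |∫ z, P.form k u G ζ z| ≤ M * B

variable {P}

lemma InCls.mono {x0 : Rn P.n} {r r' M M' : ℝ} {u : Rn P.n → ℝ} (h : P.InCls x0 r M u)
    (hr : r' ≤ r) (hM : M ≤ M') : P.InCls x0 r' M' u := by
  obtain ⟨hu, k, hk, H⟩ := h
  refine ⟨hu, k, hk, fun G B ζ hG hB hζ h01 ⟨ρ, hρ, hs⟩ => ?_⟩
  obtain ⟨h1, h2⟩ := H G B ζ hG hB hζ h01 ⟨ρ, hρ.trans_le hr, hs⟩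
  exact ⟨h1, h2.trans (mul_le_mul_of_nonneg_right hM ((abs_nonneg _).trans (hB 0)))⟩

lemma InCls.zoom {x0 : Rn P.n} {r r' M l m : ℝ} {u : Rn P.n → ℝ} (h : P.InCls x0 r M u)
    (hl : 0 < l) (hm : m ≠ 0) (c : ℝ) (hr : l * r' ≤ r) :
    P.InCls 0 r' (|m| ^ (1 - P.p) * l ^ (P.s * P.p - P.n) * M)
      (fun x => (u (x0 + l • x) - c) / m) := by
  obtain ⟨hu, k, hk, H⟩ := h.mono hr le_rfl
  refine ⟨by fun_prop, fun x y => k (x0 + l • x) (x0 + l • y), fun x y => hk _ _,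
    fun G B ζ ⟨CG, hG⟩ hB ⟨Cζ, hζ⟩ h01 ⟨ρ, hρ, hs⟩ => ?_⟩
  have hGl : ∃ C, LipschitzWith C (fun t => G ((t - c) / m)) := by
    refine ⟨CG * ‖m⁻¹‖₊, hG.comp ?_⟩
    refine LipschitzWith.of_dist_le_mul fun x y => ?_
    simp only [Real.dist_eq, coe_nnnorm, Real.norm_eq_abs]
    rw [← abs_mul]; apply le_of_eq; congr 1; field_simp; ring
  have hζl : ∃ C, LipschitzWith C (fun y => ζ (l⁻¹ • (y - x0))) := by
    refine ⟨Cζ * ‖l⁻¹‖₊, hζ.comp ?_⟩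
    refine LipschitzWith.of_dist_le_mul fun x y => ?_
    simp only [dist_eq_norm, coe_nnnorm]
    rw [← norm_smul, ← smul_sub]; simp
  have hsup : ∃ ρ < l * r', ∀ x, x ∉ closedBall x0 ρ → ζ (l⁻¹ • (x - x0)) = 0 := by
    refine ⟨l * ρ, by gcongr, fun x hx => hs _ fun h => hx ?_⟩
    rw [mem_closedBall, dist_zero_right, norm_smul, Real.norm_of_nonneg (by positivity)] at h
    rw [mem_closedBall, dist_eq_norm]
    rwa [inv_mul_le_iff₀ hl] at h
  obtain ⟨h1, h2⟩ := H (fun t => G ((t - c) / m)) B (fun y => ζ (l⁻¹ • (y - x0))) hGl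
    (fun t => hB _) hζl (fun x => h01 _) hsup
  set F := P.form k u (fun t => G ((t - c) / m)) (fun y => ζ (l⁻¹ • (y - x0))) with hF
  set a : Rn P.n → Rn P.n := fun x => x0 + l • x with ha
  have hme : MeasurableEmbedding (Prod.map a a) :=
    (P.measurableEmbedding_affine x0 hl).prodMap (P.measurableEmbedding_affine x0 hl)
  have hmap : Measure.map (Prod.map a a) (volume : Measure (Rn P.n × Rn P.n)) =
      ENNReal.ofReal ((l ^ P.n)⁻¹ * (l ^ P.n)⁻¹) • (volume : Measure (Rn P.n × Rn P.n)) := by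
    rw [Measure.volume_eq_prod, ← Measure.map_prod_map _ _ (by fun_prop) (by fun_prop),
      P.map_affine x0 hl, Measure.prod_smul_left, Measure.prod_smul_right, smul_smul,
      ENNReal.ofReal_mul (by positivity)]
  have heq : P.form (fun x y => k (x0 + l • x) (x0 + l • y)) (fun x => (u (x0 + l • x) - c) / m)
      G ζ = fun z => (P.J m⁻¹ * l ^ P.N) * F (Prod.map a a z) := by
    ext z
    have e1 : ∀ x : Rn P.n, l⁻¹ • (x0 + l • x - x0) = x := fun x => by
      rw [add_sub_cancel_left, smul_smul, inv_mul_cancel₀ hl.ne', one_smul]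
    have e2 : P.ker (x0 + l • z.1 - (x0 + l • z.2)) = (l ^ P.N)⁻¹ * P.ker (z.1 - z.2) := by
      rw [add_sub_add_left_eq_sub, ← smul_sub, P.ker_smul hl]
    have e3 : P.J ((u (x0 + l • z.1) - c) / m - (u (x0 + l • z.2) - c) / m) =
        P.J m⁻¹ * P.J (u (x0 + l • z.1) - u (x0 + l • z.2)) := by
      rw [← P.J_mul]; congr 1; field_simp; ring
    simp only [hF, form, ha, Prod.map_fst, Prod.map_snd, e1, e2, e3]
    have : l ^ P.N ≠ 0 := by positivity
    field_simp
  have hi : Integrable (fun z => F (Prod.map a a z)) := by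
    have := hme.integrable_map_iff (g := F) (μ := volume)
    rw [hmap] at this
    exact this.1 (h1.smul_measure ENNReal.ofReal_ne_top)
  rw [heq]
  refine ⟨hi.const_mul _, ?_⟩
  rw [integral_const_mul, ← hme.integral_map, hmap, integral_smul_measure,
    ENNReal.toReal_ofReal (by positivity), abs_mul, smul_eq_mul, abs_mul, abs_mul, P.abs_J, abs_inv,
    abs_of_pos (show 0 < l ^ P.N by positivity),
    abs_of_pos (show 0 < (l ^ P.n)⁻¹ * (l ^ P.n)⁻¹ by positivity)]
  have e4 : |m|⁻¹ ^ (P.p - 1) = |m| ^ (1 - P.p) := by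
    rw [← Real.rpow_neg_one, ← Real.rpow_mul (abs_nonneg _)]; congr 1; ring
  have e5 : l ^ P.N * ((l ^ P.n)⁻¹ * (l ^ P.n)⁻¹) = l ^ (P.s * P.p - P.n) := by
    rw [← Real.rpow_natCast, ← Real.rpow_neg hl.le, ← Real.rpow_add hl, ← Real.rpow_add hl]
    unfold N; congr 1; ring
  rw [e4]
  calc _ = |m| ^ (1 - P.p) * (l ^ P.N * ((l ^ P.n)⁻¹ * (l ^ P.n)⁻¹)) * |∫ z, F z| := by ring
    _ ≤ |m| ^ (1 - P.p) * (l ^ P.N * ((l ^ P.n)⁻¹ * (l ^ P.n)⁻¹)) * (M * B) := by gcongr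
    _ = _ := by rw [e5]; ring

end Prm

lemma lintegral_le_of_le_add {α : Type*} [MeasurableSpace α] {μ : Measure α} {F1 F2 F3 : α → ℝ}
    {M : ℝ} (h1 : ∀ x, 0 ≤ F1 x) (h3 : ∀ x, 0 ≤ F3 x) (hle : ∀ x, F1 x ≤ F2 x + F3 x)
    (hF2 : Integrable F2 μ) (hM : |∫ x, F2 x ∂μ| ≤ M) (hF3 : Measurable F3) :
    ∫⁻ x, ENNReal.ofReal (F1 x) ∂μ ≤ ENNReal.ofReal M + ∫⁻ x, ENNReal.ofReal (F3 x) ∂μ := by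
  by_cases ht : ∫⁻ x, ENNReal.ofReal (F3 x) ∂μ = ⊤
  · rw [ht]; simp
  have hi3 : Integrable F3 μ := by
    refine ⟨hF3.aestronglyMeasurable, ?_⟩
    rw [hasFiniteIntegral_iff_ofReal (Eventually.of_forall h3)]
    exact lt_top_iff_ne_top.2 ht
  have h0 : 0 ≤ ∫ x, F3 x ∂μ := integral_nonneg h3
  calc _ ≤ ∫⁻ x, ENNReal.ofReal (F2 x + F3 x) ∂μ :=
        lintegral_mono fun x => ENNReal.ofReal_le_ofReal (hle x)
    _ = ENNReal.ofReal (∫ x, F2 x + F3 x ∂μ) :=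
        (ofReal_integral_eq_lintegral_ofReal (hF2.add hi3)
          (Eventually.of_forall fun x => (h1 x).trans (hle x))).symm
    _ ≤ ENNReal.ofReal (M + ∫ x, F3 x ∂μ) := by
        rw [integral_add hF2 hi3]
        exact ENNReal.ofReal_le_ofReal (by linarith [(abs_le.1 hM).2])
    _ = _ := by
        rw [ENNReal.ofReal_add ((abs_nonneg _).trans hM) h0,
          ofReal_integral_eq_lintegral_ofReal hi3 (Eventually.of_forall h3)]

namespace Prm

variable (P : Prm)

/-- A cutoff function between `B_ρ` and `B_r`. -/
def eta (ρ r : ℝ) (x : Rn P.n) : ℝ := min 1 (max 0 (((ρ + r) / 2 - ‖x‖) * (2 / (r - ρ))))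

@[fun_prop] lemma measurable_eta (ρ r : ℝ) : Measurable (P.eta ρ r) := by unfold eta; fun_prop

lemma eta_nonneg (ρ r : ℝ) (x : Rn P.n) : 0 ≤ P.eta ρ r x := le_min zero_le_one (le_max_left _ _)

lemma eta_le_one (ρ r : ℝ) (x : Rn P.n) : P.eta ρ r x ≤ 1 := min_le_left _ _

lemma eta_eq_one {ρ r : ℝ} (h : ρ < r) {x : Rn P.n} (hx : ‖x‖ ≤ ρ) : P.eta ρ r x = 1 := by
  refine min_eq_left (le_max_of_le_right ?_)
  rw [← mul_div_assoc, le_div_iff₀ (by linarith)]; linarith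

lemma eta_eq_zero {ρ r : ℝ} (h : ρ < r) {x : Rn P.n} (hx : (ρ + r) / 2 ≤ ‖x‖) :
    P.eta ρ r x = 0 := by
  have : ((ρ + r) / 2 - ‖x‖) * (2 / (r - ρ)) ≤ 0 :=
    mul_nonpos_of_nonpos_of_nonneg (by linarith) (div_nonneg (by norm_num) (by linarith))
  simp [eta, max_eq_left this]

lemma eta_lip {ρ r : ℝ} (h : ρ < r) (x y : Rn P.n) :
    |P.eta ρ r x - P.eta ρ r y| ≤ 2 / (r - ρ) * ‖x - y‖ := by
  have h0 : 0 < 2 / (r - ρ) := div_pos (by norm_num) (by linarith)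
  unfold eta
  refine (abs_min_sub_min_le_max _ _ _ _).trans (max_le (by simp; positivity) ?_)
  refine (abs_max_sub_max_le_max _ _ _ _).trans (max_le (by simp; positivity) ?_)
  rw [← sub_mul, abs_mul, abs_of_pos h0, mul_comm, sub_sub_sub_cancel_left]
  gcongr
  rw [abs_sub_comm]
  exact abs_norm_sub_norm_le x y

lemma eta_rpow_lip {ρ r : ℝ} (h : ρ < r) :
    ∃ C, LipschitzWith C (fun x : Rn P.n => P.eta ρ r x ^ P.p) := by
  have h0 : 0 < 2 / (r - ρ) := div_pos (by norm_num) (by linarith)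
  have hp := P.hp
  refine ⟨(P.p * (2 / (r - ρ))).toNNReal, LipschitzWith.of_dist_le_mul fun x y => ?_⟩
  rw [Real.coe_toNNReal _ (by have := P.p_pos; positivity), Real.dist_eq, dist_eq_norm]
  wlog hxy : P.eta ρ r x ≤ P.eta ρ r y generalizing x y
  · rw [abs_sub_comm, norm_sub_rev]; exact this y x (le_of_not_ge hxy)
  have h1 := P.rpow_sub_rpow_le (P.eta_nonneg ρ r x) hxy
  have h2 := P.eta_lip h x y
  have hp0 := P.p_pos
  have e0 := P.eta_nonneg ρ r x
  have e1 := P.eta_nonneg ρ r y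
  have h3 : P.eta ρ r y ^ (P.p - 1) ≤ 1 :=
    Real.rpow_le_one e1 (P.eta_le_one ρ r y) P.p1_pos.le
  rw [abs_sub_comm, abs_of_nonneg (by linarith)] at h2
  rw [abs_sub_comm, abs_of_nonneg (sub_nonneg.2 (by gcongr))]
  refine h1.trans ?_
  have h4 : P.eta ρ r y ^ (P.p - 1) * (P.eta ρ r y - P.eta ρ r x) ≤
      1 * (P.eta ρ r y - P.eta ρ r x) := by gcongr
  nlinarith

/-- The tail integral of `F` outside `B_r`, weighted by the kernel. -/
def tl (r : ℝ) (F : Rn P.n → ℝ) : ℝ≥0∞ :=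
  ∫⁻ x in (ball 0 r)ᶜ, ENNReal.ofReal (F x) * ENNReal.ofReal (P.ker x)

/-- The integral of `F` over `B_r`. -/
def lb (r : ℝ) (F : Rn P.n → ℝ) : ℝ≥0∞ := ∫⁻ x in ball 0 r, ENNReal.ofReal (F x)

variable {P}

lemma lint_bad_near {u : Rn P.n → ℝ} {ρ r : ℝ} (hρr : ρ < r) (ht : r - ρ ≤ 1) :
    ∫⁻ x, ∫⁻ y, ENNReal.ofReal ((ball 0 r).indicator (fun x => P.R (u x)) x *
      (|P.eta ρ r x - P.eta ρ r y| ^ P.p * P.ker (x - y))) ≤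
      ENNReal.ofReal ((2 / (r - ρ)) ^ P.p * P.C0) * P.lb r (fun x => P.R (u x)) := by
  have h0 : 0 < r - ρ := by linarith
  rw [lb, ← lintegral_const_mul' _ _ ENNReal.ofReal_ne_top, ← lintegral_indicator measurableSet_ball]
  refine lintegral_mono fun x => ?_
  by_cases hx : x ∈ ball 0 r
  · rw [indicator_of_mem hx, indicator_of_mem hx]
    have hR := P.R_nonneg (u x)
    simp_rw [ENNReal.ofReal_mul hR]
    rw [lintegral_const_mul' _ _ ENNReal.ofReal_ne_top, mul_comm]
    gcongr
    refine P.lint_cutoff_ker (l := 2 / (r - ρ)) ?_ (P.eta_nonneg ρ r) (P.eta_le_one ρ r)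
      (P.eta_lip hρr) x
    rw [le_div_iff₀ h0]; linarith
  · simp [indicator_of_notMem hx]

lemma lint_bad_far {u : Rn P.n → ℝ} {ρ r : ℝ} (hu : Measurable u) (hρr : ρ < r) (hr : r ≤ 1) (hr0 : 0 < r) :
    ∫⁻ x, ∫⁻ y, ENNReal.ofReal ((ball 0 r)ᶜ.indicator (fun y => max (u y) 0 ^ (P.p - 1)) y *
      (P.g (u x) * P.eta ρ r x ^ P.p) * P.ker (x - y)) ≤
      ENNReal.ofReal ((((r - ρ) / 2) ^ P.N)⁻¹) * (P.lb r (fun x => P.g (u x)) *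
        P.tl r (fun x => max (u x) 0 ^ (P.p - 1))) := by
  have h0 : 0 < r - ρ := by linarith
  have hp := P.p_pos
  rw [lb, ← mul_assoc, ← lintegral_const_mul' _ _ ENNReal.ofReal_ne_top]
  rw [← lintegral_mul_const _ (by fun_prop), ← lintegral_indicator measurableSet_ball]
  refine lintegral_mono fun x => ?_
  by_cases hx : ‖x‖ < (ρ + r) / 2
  · have hxB : x ∈ ball (0 : Rn P.n) r := by simp; linarith
    have hg := P.g_nonneg (u x)
    rw [indicator_of_mem hxB, tl, ← lintegral_const_mul' _ _ (by finiteness),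
      ← lintegral_indicator measurableSet_ball.compl]
    refine lintegral_mono fun y => ?_
    by_cases hy : y ∈ ball (0 : Rn P.n) r
    · simp [hy]
    · have hy' : y ∈ (ball (0 : Rn P.n) r)ᶜ := hy
      have hyr : r ≤ ‖y‖ := by simpa using hy
      have hyp : 0 < ‖y‖ := by linarith
      rw [indicator_of_mem hy', indicator_of_mem hy', ← ENNReal.ofReal_mul (by positivity),
        ← ENNReal.ofReal_mul (by positivity), ← ENNReal.ofReal_mul (by positivity)]
      refine ENNReal.ofReal_le_ofReal ?_
      have k1 : P.ker (x - y) ≤ (((r - ρ) / 2) ^ P.N)⁻¹ * P.ker y := by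
        refine P.ker_le (by linarith) hyp ?_
        have := norm_sub_norm_le y x
        rw [norm_sub_rev] at this
        have h3 : (r - ρ) / 2 * r ≤ (r - ρ) / 2 := by nlinarith
        have h4 : (1 - (r - ρ) / 2) * r ≤ (1 - (r - ρ) / 2) * ‖y‖ := by
          rcases le_total ((r - ρ) / 2) 1 with h | h
          · gcongr
          · exfalso
            have := norm_nonneg x
            linarith
        linarith
      have k2 : P.g (u x) * P.eta ρ r x ^ P.p ≤ P.g (u x) * 1 := by
        gcongr
        exact Real.rpow_le_one (P.eta_nonneg ρ r x) (P.eta_le_one ρ r x) hp.le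
      have k3 := P.ker_nonneg (x - y)
      have k4 := P.eta_nonneg ρ r x
      have k5 : 0 ≤ max (u y) 0 := le_max_right _ _
      calc _ ≤ max (u y) 0 ^ (P.p - 1) * (P.g (u x) * 1) * ((((r - ρ) / 2) ^ P.N)⁻¹ * P.ker y) := by
            gcongr
        _ = _ := by ring
  · simp [P.eta_eq_zero hρr (not_lt.1 hx), Real.zero_rpow hp.ne']

variable (P) in
/-- The constant in the Caccioppoli inequality. -/
def CA : ℝ := P.L / P.cc * (1 + (P.cC + 1) * P.L * 2 * (2 ^ P.p * P.C0 + 2 ^ P.N))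

variable (P) in
lemma CA_pos : 0 < P.CA := by
  have := P.L_pos; have := P.cc_pos; have := P.cC_nonneg; have := P.C0_nonneg
  unfold CA; positivity

lemma cacc {u : Rn P.n → ℝ} {ρ r M : ℝ} (h : P.InCls 0 r M u) (hρr : ρ < r) (hr : r ≤ 1)
    (hr0 : 0 < r) (hρ : 0 ≤ ρ) :
    (∫⁻ x, ∫⁻ y, ENNReal.ofReal (|P.V (u x) * P.eta ρ r x - P.V (u y) * P.eta ρ r y| ^ P.p *
        P.ker (x - y))) +
      (∫⁻ x, ∫⁻ y, ENNReal.ofReal (max (-u y) 0 ^ (P.p - 1) *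
        (P.g (u x) * P.eta ρ r x ^ P.p) * P.ker (x - y))) ≤
      ENNReal.ofReal (P.CA * (r - ρ) ^ (-(P.N + P.p))) * (ENNReal.ofReal M +
        P.lb r (fun x => P.R (u x)) + P.lb r (fun x => P.g (u x)) *
          P.tl r (fun x => max (u x) 0 ^ (P.p - 1))) := by
  classical
  have hp := P.p_pos
  have hL := P.L_pos
  have hcc := P.cc_pos
  have hcC := P.cC_nonneg
  have hC0 := P.C0_nonneg
  have ht0 : 0 < r - ρ := by linarith
  have ht1 : r - ρ ≤ 1 := by linarith
  obtain ⟨hu, k, hk, H⟩ := h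
  obtain ⟨hi, hb⟩ := H P.g 1 (fun x => P.eta ρ r x ^ P.p) ⟨_, P.lipschitz_g⟩
    (fun t => abs_le.2 ⟨by linarith [P.g_nonneg t], P.g_le_one t⟩) (P.eta_rpow_lip hρr)
    (fun x => ⟨Real.rpow_nonneg (P.eta_nonneg ρ r x) _,
      Real.rpow_le_one (P.eta_nonneg ρ r x) (P.eta_le_one ρ r x) hp.le⟩)
    ⟨(ρ + r) / 2, by linarith, fun x hx => by
      rw [P.eta_eq_zero hρr (by simpa using (not_le.1 (by simpa using hx)).le),
        Real.zero_rpow hp.ne']⟩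
  rw [mul_one] at hb
  set B : Set (Rn P.n) := ball 0 r with hB
  set η := P.eta ρ r with hη
  have hηm : Measurable η := P.measurable_eta ρ r
  have hBm : MeasurableSet B := measurableSet_ball
  set A1 : Rn P.n × Rn P.n → ℝ := fun z =>
    |P.V (u z.1) * η z.1 - P.V (u z.2) * η z.2| ^ P.p * P.ker (z.1 - z.2) with hA1
  set A2 : Rn P.n × Rn P.n → ℝ := fun z =>
    max (-u z.2) 0 ^ (P.p - 1) * (P.g (u z.1) * η z.1 ^ P.p) * P.ker (z.1 - z.2) with hA2
  set Q1 : Rn P.n × Rn P.n → ℝ := fun z => B.indicator (fun x => P.R (u x)) z.1 *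
      (|η z.1 - η z.2| ^ P.p * P.ker (z.1 - z.2)) with hQ1
  set Q2 : Rn P.n × Rn P.n → ℝ := fun z => Bᶜ.indicator (fun y => max (u y) 0 ^ (P.p - 1)) z.2 *
      (P.g (u z.1) * η z.1 ^ P.p) * P.ker (z.1 - z.2) with hQ2
  have mA1 : Measurable A1 := by fun_prop
  have mA2 : Measurable A2 := by fun_prop
  have mi1 : Measurable (B.indicator (fun x => P.R (u x))) :=
    (P.measurable_R.comp hu).indicator hBm
  have mi2 : Measurable (Bᶜ.indicator (fun y => max (u y) 0 ^ (P.p - 1))) :=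
    ((hu.max measurable_const).pow_const _).indicator hBm.compl
  have mQ1 : Measurable Q1 := by fun_prop
  have mQ2 : Measurable Q2 := by fun_prop
  have nη : ∀ x, 0 ≤ η x := P.eta_nonneg ρ r
  have nm : ∀ t : ℝ, 0 ≤ max t 0 := fun t => le_max_right _ _
  have nA1 : ∀ z, 0 ≤ A1 z := fun z => by have := P.ker_nonneg (z.1 - z.2); positivity
  have nA2 : ∀ z, 0 ≤ A2 z := fun z => by
    have := P.ker_nonneg (z.1 - z.2); have := nη z.1; have := P.g_nonneg (u z.1)
    have := nm (-u z.2)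
    positivity
  have nQ1 : ∀ z, 0 ≤ Q1 z := fun z =>
    mul_nonneg (indicator_nonneg (fun x _ => P.R_nonneg _) _)
      (by have := P.ker_nonneg (z.1 - z.2); positivity)
  have nQ2 : ∀ z, 0 ≤ Q2 z := fun z => by
    have := P.ker_nonneg (z.1 - z.2); have := nη z.1; have := P.g_nonneg (u z.1)
    have : 0 ≤ Bᶜ.indicator (fun y => max (u y) 0 ^ (P.p - 1)) z.2 :=
      indicator_nonneg (fun y _ => Real.rpow_nonneg (nm _) _) _
    positivity
  have hη0 : ∀ x, ¬ x ∈ B → η x = 0 := fun x hx => P.eta_eq_zero hρr (by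
    have : r ≤ ‖x‖ := by simpa [hB] using hx
    linarith)
  have key : ∀ z : Rn P.n × Rn P.n, P.cc / P.L * (A1 z + A2 z) ≤ P.form k u P.g (fun x => η x ^ P.p) z +
      (P.cC + 1) * P.L * ((Q1 z + Q1 z.swap) + (Q2 z + Q2 z.swap)) := by
    intro z
    have h1 := P.ptwise_full (a := u z.1) (b := u z.2) (e := η z.1) (h := η z.2) (z.1 ∈ B)
      (z.2 ∈ B) (nη _) (nη _) (hη0 _) (hη0 _)
    set kr := P.ker (z.1 - z.2) with hkr
    have hkr0 : 0 ≤ kr := P.ker_nonneg _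
    have e1 : A1 z + A2 z = (|P.V (u z.1) * η z.1 - P.V (u z.2) * η z.2| ^ P.p +
        max (-u z.2) 0 ^ (P.p - 1) * (P.g (u z.1) * η z.1 ^ P.p)) * kr := by
      simp only [hA1, hA2]; ring
    have e2 : (Q1 z + Q1 z.swap) + (Q2 z + Q2 z.swap) =
        (((if z.1 ∈ B then P.R (u z.1) else 0) + (if z.2 ∈ B then P.R (u z.2) else 0)) *
          |η z.1 - η z.2| ^ P.p +
        ((if z.1 ∈ B then 0 else max (u z.1) 0 ^ (P.p - 1)) * (P.g (u z.2) * η z.2 ^ P.p) +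
        (if z.2 ∈ B then 0 else max (u z.2) 0 ^ (P.p - 1)) * (P.g (u z.1) * η z.1 ^ P.p))) * kr := by
      have e3 : |η z.2 - η z.1| = |η z.1 - η z.2| := abs_sub_comm _ _
      have e4 : P.ker (z.2 - z.1) = kr := P.ker_sub_comm _ _
      simp only [hQ1, hQ2, Prod.fst_swap, Prod.snd_swap, indicator, e3, e4, mem_compl_iff, ite_not]
      ring
    have e5 : P.form k u P.g (fun x => η x ^ P.p) z = k z.1 z.2 * (P.J (u z.1 - u z.2) *
        (P.g (u z.1) * η z.1 ^ P.p - P.g (u z.2) * η z.2 ^ P.p)) * kr := by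
      simp only [form]; ring
    have nn : 0 ≤ (Q1 z + Q1 z.swap) + (Q2 z + Q2 z.swap) := by
      have := nQ1 z; have := nQ2 z; have := nQ1 z.swap; have := nQ2 z.swap
      positivity
    have nn2 : 0 ≤ A1 z + A2 z := by have := nA1 z; have := nA2 z; positivity
    rw [e5]
    obtain ⟨k1, k2⟩ := hk z.1 z.2
    have hk0 : 0 < k z.1 z.2 := (by positivity : 0 < P.L⁻¹).trans_le k1
    have h2 := mul_le_mul_of_nonneg_right (mul_le_mul_of_nonneg_left h1 hk0.le) hkr0
    calc _ ≤ k z.1 z.2 * (P.cc * (A1 z + A2 z)) := by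
          rw [div_mul_eq_mul_div, div_eq_inv_mul]
          gcongr
      _ ≤ k z.1 z.2 * (P.J (u z.1 - u z.2) *
        (P.g (u z.1) * η z.1 ^ P.p - P.g (u z.2) * η z.2 ^ P.p)) * kr +
          k z.1 z.2 * (P.cC + 1) * ((Q1 z + Q1 z.swap) + (Q2 z + Q2 z.swap)) := by
          rw [e1, e2]; linarith
      _ ≤ _ := by
        have : k z.1 z.2 * (P.cC + 1) ≤ (P.cC + 1) * P.L := by rw [mul_comm]; gcongr
        gcongr
  have main := lintegral_le_of_le_add (F3 := fun z : Rn P.n × Rn P.n => (P.cC + 1) * P.L *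
    ((Q1 z + Q1 z.swap) + (Q2 z + Q2 z.swap))) (fun z => by have := nA1 z; have := nA2 z; positivity)
    (fun z => by
      have := nQ1 z; have := nQ2 z; have := nQ1 z.swap; have := nQ2 z.swap
      positivity) key hi hb (by fun_prop)
  have s1 : ∀ F : Rn P.n × Rn P.n → ℝ, Measurable F → ∫⁻ z, ENNReal.ofReal (F z) =
      ∫⁻ x, ∫⁻ y, ENNReal.ofReal (F (x, y)) := fun F hF => by
    rw [Measure.volume_eq_prod, lintegral_prod _ (by fun_prop)]
  have s2 : ∀ F : Rn P.n × Rn P.n → ℝ, ∫⁻ z : Rn P.n × Rn P.n, ENNReal.ofReal (F z.swap) =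
      ∫⁻ z, ENNReal.ofReal (F z) := fun F => by
    rw [Measure.volume_eq_prod, lintegral_prod_swap (fun z => ENNReal.ofReal (F z))]
  have m1 : ∫⁻ z, ENNReal.ofReal (P.cc / P.L * (A1 z + A2 z)) = ENNReal.ofReal (P.cc / P.L) *
      ((∫⁻ z, ENNReal.ofReal (A1 z)) + ∫⁻ z, ENNReal.ofReal (A2 z)) := by
    rw [← lintegral_add_left (by fun_prop), ← lintegral_const_mul _ (by fun_prop)]
    refine lintegral_congr fun z => ?_
    rw [ENNReal.ofReal_mul (by positivity), ENNReal.ofReal_add (nA1 z) (nA2 z)]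
  have m2 : ∫⁻ z : Rn P.n × Rn P.n, ENNReal.ofReal ((P.cC + 1) * P.L * ((Q1 z + Q1 z.swap) + (Q2 z + Q2 z.swap))) =
      ENNReal.ofReal ((P.cC + 1) * P.L * 2) *
      ((∫⁻ z, ENNReal.ofReal (Q1 z)) + ∫⁻ z, ENNReal.ofReal (Q2 z)) := by
    have : ∀ z : Rn P.n × Rn P.n, ENNReal.ofReal ((P.cC + 1) * P.L * ((Q1 z + Q1 z.swap) + (Q2 z + Q2 z.swap))) =
      ENNReal.ofReal ((P.cC + 1) * P.L) * ((ENNReal.ofReal (Q1 z) + ENNReal.ofReal (Q1 z.swap)) +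
        (ENNReal.ofReal (Q2 z) + ENNReal.ofReal (Q2 z.swap))) := fun z => by
      have := nQ1 z; have := nQ2 z; have := nQ1 z.swap; have := nQ2 z.swap
      rw [ENNReal.ofReal_mul (by positivity), ENNReal.ofReal_add (by positivity) (by positivity),
        ENNReal.ofReal_add (nQ1 z) (nQ1 z.swap), ENNReal.ofReal_add (nQ2 z) (nQ2 z.swap)]
    simp_rw [this]
    rw [lintegral_const_mul _ (by fun_prop), lintegral_add_left (by fun_prop),
      lintegral_add_left (by fun_prop), lintegral_add_left (by fun_prop), s2 Q1, s2 Q2,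
      ENNReal.ofReal_mul (show 0 ≤ (P.cC + 1) * P.L by positivity), ENNReal.ofReal_ofNat]
    ring
  rw [m1, m2, s1 A1 mA1, s1 A2 mA2, s1 Q1 mQ1, s1 Q2 mQ2] at main
  set LHS := (∫⁻ x, ∫⁻ y, ENNReal.ofReal (A1 (x, y))) + ∫⁻ x, ∫⁻ y, ENNReal.ofReal (A2 (x, y))
    with hLHS
  change LHS ≤ _
  have b1 : ∫⁻ x, ∫⁻ y, ENNReal.ofReal (Q1 (x, y)) ≤ _ := P.lint_bad_near hρr ht1
  have b2 : ∫⁻ x, ∫⁻ y, ENNReal.ofReal (Q2 (x, y)) ≤ _ := P.lint_bad_far hu hρr hr hr0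
  set X := P.lb r (fun x => P.R (u x))
  set Y := P.lb r (fun x => P.g (u x)) * P.tl r (fun x => max (u x) 0 ^ (P.p - 1))
  have c0 : LHS = ENNReal.ofReal (P.L / P.cc) * (ENNReal.ofReal (P.cc / P.L) * LHS) := by
    rw [← mul_assoc, ← ENNReal.ofReal_mul (by positivity)]
    rw [show P.L / P.cc * (P.cc / P.L) = 1 by field_simp]; simp
  have hN := P.N_pos
  have t1 : 1 ≤ (r - ρ) ^ (-(P.N + P.p)) :=
    Real.one_le_rpow_of_pos_of_le_one_of_nonpos ht0 ht1 (by linarith)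
  have t2 : (2 / (r - ρ)) ^ P.p * P.C0 ≤ (r - ρ) ^ (-(P.N + P.p)) * (2 ^ P.p * P.C0 + 2 ^ P.N) := by
    rw [Real.div_rpow (by norm_num) ht0.le, div_eq_mul_inv, ← Real.rpow_neg ht0.le]
    have : (r - ρ) ^ (-P.p) ≤ (r - ρ) ^ (-(P.N + P.p)) :=
      Real.rpow_le_rpow_of_exponent_ge ht0 ht1 (by linarith)
    calc _ ≤ 2 ^ P.p * (r - ρ) ^ (-(P.N + P.p)) * P.C0 := by gcongr
      _ = (r - ρ) ^ (-(P.N + P.p)) * (2 ^ P.p * P.C0) := by ring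
      _ ≤ _ := by gcongr; exact le_add_of_nonneg_right (by positivity)
  have t3 : (((r - ρ) / 2) ^ P.N)⁻¹ ≤ (r - ρ) ^ (-(P.N + P.p)) * (2 ^ P.p * P.C0 + 2 ^ P.N) := by
    rw [Real.div_rpow ht0.le (by norm_num), inv_div, div_eq_mul_inv, ← Real.rpow_neg ht0.le]
    have : (r - ρ) ^ (-P.N) ≤ (r - ρ) ^ (-(P.N + P.p)) :=
      Real.rpow_le_rpow_of_exponent_ge ht0 ht1 (by linarith)
    calc _ ≤ 2 ^ P.N * (r - ρ) ^ (-(P.N + P.p)) := by gcongr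
      _ = (r - ρ) ^ (-(P.N + P.p)) * (2 ^ P.N) := by ring
      _ ≤ _ := by gcongr; exact le_add_of_nonneg_left (by positivity)
  set T := (r - ρ) ^ (-(P.N + P.p))
  set S := 2 ^ P.p * P.C0 + 2 ^ P.N
  have hS : 0 ≤ S := by positivity
  have hD : 0 ≤ (P.cC + 1) * P.L * 2 := by positivity
  have hT : 0 ≤ T := by linarith
  set D := (P.cC + 1) * P.L * 2
  calc LHS = ENNReal.ofReal (P.L / P.cc) * (ENNReal.ofReal (P.cc / P.L) * LHS) := c0
    _ ≤ ENNReal.ofReal (P.L / P.cc) * (ENNReal.ofReal M + ENNReal.ofReal D *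
        (ENNReal.ofReal (T * S) * X + ENNReal.ofReal (T * S) * Y)) := by
      refine mul_le_mul_right (main.trans ?_) _
      gcongr
      · exact b1.trans (by gcongr)
      · exact b2.trans (by gcongr)
    _ ≤ ENNReal.ofReal (P.L / P.cc) * (ENNReal.ofReal (T * (1 + D * S)) * ENNReal.ofReal M +
        (ENNReal.ofReal (T * (1 + D * S)) * X + ENNReal.ofReal (T * (1 + D * S)) * Y)) := by
      rw [mul_add (ENNReal.ofReal D), ← mul_assoc, ← mul_assoc, ← ENNReal.ofReal_mul hD]
      have f1 : 1 ≤ T * (1 + D * S) := by nlinarith [mul_nonneg hD hS]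
      have f2 : D * (T * S) ≤ T * (1 + D * S) := by nlinarith
      gcongr
      exact le_mul_of_one_le_left zero_le (ENNReal.one_le_ofReal.2 f1)
    _ = _ := by
      rw [← mul_add, ← mul_add, ← mul_assoc, ← ENNReal.ofReal_mul (by positivity), CA, add_assoc]
      congr 2; ring

end Prm

namespace Prm

variable {P : Prm}

lemma InCls.sub_const {r M : ℝ} {u : Rn P.n → ℝ} (h : P.InCls 0 r M u) (c : ℝ) :
    P.InCls 0 r M (fun x => u x - c) := by
  have := h.zoom (l := 1) (m := 1) (r' := r) one_pos one_ne_zero c (by simp)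
  simpa using this

lemma InCls.neg {r M : ℝ} {u : Rn P.n → ℝ} (h : P.InCls 0 r M u) :
    P.InCls 0 r M (fun x => - u x) := by
  have := h.zoom (l := 1) (m := -1) (r' := r) one_pos (by norm_num) 0 (by simp)
  simpa [div_neg] using this

lemma InCls.measurable {x0 : Rn P.n} {r M : ℝ} {u : Rn P.n → ℝ} (h : P.InCls x0 r M u) :
    Measurable u := h.1

lemma lb_mono {r : ℝ} {F G : Rn P.n → ℝ} (h : ∀ x, F x ≤ G x) : P.lb r F ≤ P.lb r G :=
  lintegral_mono fun x => ENNReal.ofReal_le_ofReal (h x)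

lemma lb_mono_radius {r r' : ℝ} (hr : r ≤ r') (F : Rn P.n → ℝ) : P.lb r F ≤ P.lb r' F :=
  lintegral_mono_set (ball_subset_ball hr)

lemma lb_const_mul {r c : ℝ} (hc : 0 ≤ c) (F : Rn P.n → ℝ) :
    P.lb r (fun x => c * F x) = ENNReal.ofReal c * P.lb r F := by
  unfold lb
  rw [← lintegral_const_mul' _ _ ENNReal.ofReal_ne_top]
  exact lintegral_congr fun x => ENNReal.ofReal_mul hc

lemma tl_mono {r : ℝ} {F G : Rn P.n → ℝ} (h : ∀ x, F x ≤ G x) : P.tl r F ≤ P.tl r G :=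
  lintegral_mono fun x => mul_le_mul_left (ENNReal.ofReal_le_ofReal (h x)) _

lemma tl_mono_radius {r r' : ℝ} (hr : r' ≤ r) (F : Rn P.n → ℝ) : P.tl r F ≤ P.tl r' F :=
  lintegral_mono_set (compl_subset_compl.2 (ball_subset_ball hr))

lemma tl_const_mul {r c : ℝ} (hc : 0 ≤ c) (F : Rn P.n → ℝ) :
    P.tl r (fun x => c * F x) = ENNReal.ofReal c * P.tl r F := by
  unfold tl
  rw [← lintegral_const_mul' _ _ ENNReal.ofReal_ne_top]
  exact lintegral_congr fun x => by rw [ENNReal.ofReal_mul hc, mul_assoc]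

lemma gain {u : Rn P.n → ℝ} {ρ r M : ℝ} (h : P.InCls 0 r M u) (hρr : ρ < r) (hr : r ≤ 1)
    (hr0 : 0 < r) (hρ : 0 ≤ ρ) (hX : P.lb r (fun x => P.R (u x)) ≠ ⊤) :
    P.lb ρ (fun x => P.V (u x) ^ (P.p * P.κ)) ≤
      ENNReal.ofReal P.CG * ((ENNReal.ofReal (P.CA * (r - ρ) ^ (-(P.N + P.p))) * (ENNReal.ofReal M +
        P.lb r (fun x => P.R (u x)) + P.lb r (fun x => P.g (u x)) *
          P.tl r (fun x => max (u x) 0 ^ (P.p - 1)))) *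
        P.lb r (fun x => P.R (u x)) ^ (P.κ - 1)) := by
  have hp := P.p_pos
  have hκ := P.κ_gt
  have hu := h.1
  have hcac := le_self_add.trans (cacc h hρr hr hr0 hρ)
  set v : Rn P.n → ℝ := fun x => P.V (u x) * P.eta ρ r x with hv
  have hvm : Measurable v := by fun_prop
  have hη0 : ∀ x, ¬ x ∈ ball (0 : Rn P.n) r → P.eta ρ r x = 0 := fun x hx =>
    P.eta_eq_zero hρr (by
      have : r ≤ ‖x‖ := by simpa using hx
      linarith)
  have hW : ∫⁻ y, ENNReal.ofReal (|v y| ^ P.p) ≤ P.lb r (fun x => P.R (u x)) := by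
    rw [lb, ← lintegral_indicator measurableSet_ball]
    refine lintegral_mono fun x => ?_
    by_cases hx : x ∈ ball (0 : Rn P.n) r
    · rw [indicator_of_mem hx]
      refine ENNReal.ofReal_le_ofReal ?_
      simp only [hv]
      have h0 := P.V_nonneg (u x)
      have h1 := P.eta_nonneg ρ r x
      rw [abs_of_nonneg (by positivity), Real.mul_rpow h0 h1]
      calc _ ≤ P.V (u x) ^ P.p * 1 := by
            gcongr
            exact Real.rpow_le_one h1 (P.eta_le_one ρ r x) hp.le
        _ ≤ _ := by rw [mul_one]; exact P.V_rpow_le_R _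
    · simp [hv, hη0 x hx, Real.zero_rpow hp.ne']
  have gn := P.gagliardo_nirenberg hvm (ne_top_of_le_ne_top hX hW)
  refine le_trans ?_ (gn.trans ?_)
  · rw [lb, ← lintegral_indicator measurableSet_ball]
    refine lintegral_mono fun x => ?_
    by_cases hx : x ∈ ball (0 : Rn P.n) ρ
    · rw [indicator_of_mem hx]
      have : P.eta ρ r x = 1 := P.eta_eq_one hρr (by simpa using (mem_ball_zero_iff.1 hx).le)
      simp [hv, this, abs_of_nonneg (P.V_nonneg (u x))]
    · rw [indicator_of_notMem hx]; exact zero_le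
  · gcongr

variable (P) in
/-- The constant in the one-step level set estimate. -/
def CS (T0 : ℝ) : ℝ := 4 ^ (P.p * (P.κ - 1)) * (P.CG * (P.CA * (1 + 4 ^ P.p * T0)))

lemma CS_pos {T0 : ℝ} (hT : 0 ≤ T0) : 0 < P.CS T0 := by
  have := P.CG_pos; have := P.CA_pos; unfold CS; positivity

lemma step_levels {u : Rn P.n → ℝ} {ρ r M T0 : ℝ} (h : P.InCls 0 r M u) (hρ : 1 / 2 ≤ ρ)
    (hρr : ρ < r) (hr : r ≤ 1) (hT0 : 0 ≤ T0)
    (hT : P.tl (1 / 2) (fun x => max (u x) 0 ^ (P.p - 1)) ≤ ENNReal.ofReal T0)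
    (hX : P.lb r (fun x => P.R (u x)) ≠ ⊤) :
    P.lb ρ (fun x => P.R (u x - (r - ρ))) ≤
      ENNReal.ofReal (P.CS T0 * (r - ρ) ^ (-(P.N + P.p + P.p * P.κ))) *
        (ENNReal.ofReal M + P.lb r (fun x => P.R (u x))) ^ P.κ := by
  have hp := P.p_pos
  have hκ := P.κ_gt
  have hN := P.N_pos
  have hCG := P.CG_pos
  have hCA := P.CA_pos
  set t := r - ρ with ht
  have ht0 : 0 < t := by linarith
  have ht1 : t ≤ 1 := by linarith
  set X := P.lb r (fun x => P.R (u x)) with hXdef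
  have hRw : P.lb r (fun x => P.R (u x - t / 2)) ≤ X := lb_mono fun x => P.R_mono (by linarith)
  have hg := gain (h.sub_const (t / 2)) hρr hr (by linarith) (by linarith)
    (ne_top_of_le_ne_top hX hRw)
  rw [← ht] at hg
  have h1 : P.lb ρ (fun x => P.R (u x - t)) ≤ ENNReal.ofReal ((4 / t) ^ (P.p * (P.κ - 1))) *
      P.lb ρ (fun x => P.V (u x - t / 2) ^ (P.p * P.κ)) := by
    rw [← lb_const_mul (by positivity)]
    refine lb_mono fun x => ?_
    have hV := P.V_nonneg (u x - t / 2)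
    rcases le_total (u x) t with hx | hx
    · rw [P.R_of_nonpos (by linarith)]; positivity
    · calc P.R (u x - t) ≤ P.R (u x - t / 2) := P.R_mono (by linarith)
        _ ≤ _ := P.R_le_V (d := t / 2) (by linarith) (by linarith)
        _ ≤ _ := by
          have hq : (1 + t / 2) / (t / 2) ≤ 4 / t := by
            rw [div_le_div_iff₀ (by positivity) ht0]; nlinarith
          exact mul_le_mul_of_nonneg_right (Real.rpow_le_rpow (by positivity) hq
            (mul_nonneg hp.le (by linarith))) (by positivity)
  have h2 : P.lb r (fun x => P.g (u x - t / 2)) ≤ ENNReal.ofReal (4 ^ P.p * t ^ (-P.p)) * X := by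
    rw [hXdef, ← lb_const_mul (by positivity)]
    refine lb_mono fun x => ?_
    have hR := P.R_nonneg (u x)
    rcases le_total (u x) (t / 2) with hx | hx
    · rw [P.g_of_nonpos (by linarith)]; positivity
    · refine (P.g_le_one _).trans ?_
      have e1 := P.R_one_pow (t := t / 2) (by linarith) (by linarith)
      have e2 := P.R_mono hx
      rw [Real.div_rpow ht0.le (by norm_num), div_le_iff₀ (by positivity)] at e1
      rw [Real.rpow_neg ht0.le, show (4 : ℝ) = 2 * 2 by norm_num,
        Real.mul_rpow (by norm_num) (by norm_num), mul_right_comm, ← div_eq_mul_inv,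
        one_le_div (by positivity)]
      calc t ^ P.p ≤ 2 ^ P.p * P.R (t / 2) * 2 ^ P.p := e1
        _ ≤ 2 ^ P.p * P.R (u x) * 2 ^ P.p := by gcongr
        _ = _ := by ring
  have h3 : P.tl r (fun x => max (u x - t / 2) 0 ^ (P.p - 1)) ≤ ENNReal.ofReal T0 := by
    refine ((tl_mono_radius (by linarith) _).trans (tl_mono fun x => ?_)).trans hT
    have := P.p1_pos
    gcongr; linarith
  have h4 : ENNReal.ofReal M + P.lb r (fun x => P.R (u x - t / 2)) +
      P.lb r (fun x => P.g (u x - t / 2)) * P.tl r (fun x => max (u x - t / 2) 0 ^ (P.p - 1)) ≤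
      ENNReal.ofReal ((1 + 4 ^ P.p * T0) * t ^ (-P.p)) * (ENNReal.ofReal M + X) := by
    have e1 : 1 ≤ t ^ (-P.p) := Real.one_le_rpow_of_pos_of_le_one_of_nonpos ht0 ht1 (by linarith)
    calc _ ≤ ENNReal.ofReal M + X + ENNReal.ofReal (4 ^ P.p * t ^ (-P.p)) * X * ENNReal.ofReal T0 := by
          gcongr
      _ ≤ ENNReal.ofReal (t ^ (-P.p)) * (ENNReal.ofReal M + X) +
          ENNReal.ofReal (4 ^ P.p * t ^ (-P.p) * T0) * (ENNReal.ofReal M + X) := by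
          refine add_le_add (le_mul_of_one_le_left zero_le (ENNReal.one_le_ofReal.2 e1)) ?_
          rw [mul_right_comm, ← ENNReal.ofReal_mul (by positivity)]
          gcongr
          exact le_add_self
      _ = _ := by
          rw [← add_mul, ← ENNReal.ofReal_add (by positivity) (by positivity)]
          congr 2; ring
  have h5 : X ^ (P.κ - 1) ≤ (ENNReal.ofReal M + X) ^ (P.κ - 1) := by
    exact ENNReal.rpow_le_rpow le_add_self (by linarith)
  have h6 : (ENNReal.ofReal M + X) ^ P.κ =
      (ENNReal.ofReal M + X) * (ENNReal.ofReal M + X) ^ (P.κ - 1) := by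
    conv_rhs => rw [← ENNReal.rpow_one (ENNReal.ofReal M + X),
      ← ENNReal.rpow_mul, one_mul]
    rw [← ENNReal.rpow_add_of_nonneg _ _ (by norm_num) (by linarith)]
    congr 1; ring
  calc _ ≤ _ := h1
    _ ≤ ENNReal.ofReal ((4 / t) ^ (P.p * (P.κ - 1))) * (ENNReal.ofReal P.CG *
        ((ENNReal.ofReal (P.CA * t ^ (-(P.N + P.p))) *
          (ENNReal.ofReal ((1 + 4 ^ P.p * T0) * t ^ (-P.p)) * (ENNReal.ofReal M + X))) *
        (ENNReal.ofReal M + X) ^ (P.κ - 1))) := by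
      gcongr
      refine hg.trans ?_
      gcongr
      exact hRw.trans le_add_self
    _ = _ := by
      rw [h6]
      simp only [← mul_assoc]
      rw [← ENNReal.ofReal_mul (by positivity), ← ENNReal.ofReal_mul (by positivity),
        ← ENNReal.ofReal_mul (by positivity)]
      congr 3
      rw [CS, Real.div_rpow (by norm_num) ht0.le, div_eq_mul_inv, ← Real.rpow_neg ht0.le,
        show -(P.N + P.p + P.p * P.κ) = -(P.p * (P.κ - 1)) + -(P.N + P.p) + -P.p by ring,
        Real.rpow_add ht0, Real.rpow_add ht0]
      ring

lemma de_giorgi_local {T0 : ℝ} (hT0 : 0 ≤ T0) : ∃ y0 : ℝ, 0 < y0 ∧ ∀ η : ℝ, 0 < η →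
    ∃ δ : ℝ, 0 < δ ∧ ∀ u : Rn P.n → ℝ, P.InCls 0 1 δ u →
      P.tl (1 / 2) (fun x => max (u x) 0 ^ (P.p - 1)) ≤ ENNReal.ofReal T0 →
      P.lb 1 (fun x => P.R (u x)) ≤ ENNReal.ofReal y0 →
      P.lb (1 / 2) (fun x => P.R (u x - 1 / 2)) ≤ ENNReal.ofReal η := by
  have hp := P.p_pos
  have hκ := P.κ_gt
  have hN := P.N_pos
  have hCS := P.CS_pos hT0
  set e := P.N + P.p + P.p * P.κ with he
  have he0 : 0 < e := by positivity
  set b : ℝ := 2 ^ e with hb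
  have hb1 : 1 < b := Real.one_lt_rpow (by norm_num) he0
  have hκ1 : 0 < P.κ - 1 := by linarith
  set τ : ℝ := b ^ (-(1 / (P.κ - 1))) with hτ
  have hτ0 : 0 < τ := by positivity
  have hτ1 : τ < 1 := Real.rpow_lt_one_of_one_lt_of_neg hb1 (by simp; linarith)
  have hτb : b * τ ^ (P.κ - 1) = 1 := by
    rw [hτ, ← Real.rpow_mul (by positivity)]
    rw [show -(1 / (P.κ - 1)) * (P.κ - 1) = -1 by field_simp, Real.rpow_neg_one]
    field_simp
  set A : ℝ := P.CS T0 * 4 ^ e * 2 ^ P.κ with hA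
  have hA0 : 0 < A := by positivity
  set y0 : ℝ := (τ / A) ^ (1 / (P.κ - 1)) with hy
  have hy0 : 0 < y0 := by positivity
  have hyA : A * y0 ^ P.κ = y0 * τ := by
    have e1 : y0 ^ (P.κ - 1) = τ / A := by
      rw [hy, ← Real.rpow_mul (by positivity), one_div_mul_cancel hκ1.ne', Real.rpow_one]
    have e2 : y0 ^ P.κ = y0 ^ (P.κ - 1) * y0 := by
      rw [← Real.rpow_add_one hy0.ne']; congr 1; ring
    rw [e2, e1]; field_simp
  refine ⟨y0, hy0, fun η hη => ?_⟩
  obtain ⟨i0, hi0⟩ := exists_pow_lt_of_lt_one (show 0 < η / y0 by positivity) hτ1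
  refine ⟨y0 * τ ^ i0, by positivity, fun u hu hT hY => ?_⟩
  set δ := y0 * τ ^ i0 with hδ
  have hind : ∀ i : ℕ, i ≤ i0 →
      P.lb (1 / 2 + (1 / 2) ^ i / 2) (fun x => P.R (u x - (1 / 2 - (1 / 2) ^ i / 2))) ≤
        ENNReal.ofReal (y0 * τ ^ i) := by
    intro i
    induction i with
    | zero => intro _; norm_num at hY ⊢; exact hY
    | succ i ih =>
      intro hi
      have ih := ih (by omega)
      have hδi : δ ≤ y0 * τ ^ i := by
        rw [hδ]
        gcongr y0 * ?_
        exact pow_le_pow_of_le_one hτ0.le hτ1.le (by omega)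
      have hz : (0 : ℝ) < (1 / 2) ^ i := by positivity
      have hz1 : (1 / 2 : ℝ) ^ i ≤ 1 := pow_le_one₀ (by norm_num) (by norm_num)
      have hz2 : (1 / 2 : ℝ) ^ (i + 1) = (1 / 2) ^ i / 2 := by rw [pow_succ]; ring
      have st := step_levels (u := fun x => u x - (1 / 2 - (1 / 2) ^ i / 2)) (M := δ) (T0 := T0)
        (r := 1 / 2 + (1 / 2) ^ i / 2) (ρ := 1 / 2 + (1 / 2) ^ (i + 1) / 2)
        ((hu.sub_const _).mono (by linarith) le_rfl) (by rw [hz2]; linarith) (by rw [hz2]; linarith)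
        (by linarith) hT0 ((tl_mono fun x => by
          have := P.p1_pos
          gcongr; linarith).trans hT) (ne_top_of_le_ne_top ENNReal.ofReal_ne_top ih)
      have e1 : (1 / 2 + (1 / 2 : ℝ) ^ i / 2) - (1 / 2 + (1 / 2 : ℝ) ^ (i + 1) / 2) =
          (1 / 2) ^ i / 4 := by rw [hz2]; ring
      rw [e1] at st
      have e2 : (fun x => P.R (u x - (1 / 2 - (1 / 2) ^ i / 2) - (1 / 2) ^ i / 4)) =
          fun x => P.R (u x - (1 / 2 - (1 / 2) ^ (i + 1) / 2)) := by
        ext x; rw [hz2]; congr 1; ring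
      rw [e2, ← he] at st
      refine st.trans ?_
      have e3 : (ENNReal.ofReal δ + P.lb (1 / 2 + (1 / 2) ^ i / 2)
          (fun x => P.R (u x - (1 / 2 - (1 / 2) ^ i / 2)))) ^ P.κ ≤
          ENNReal.ofReal ((2 * (y0 * τ ^ i)) ^ P.κ) := by
        rw [← ENNReal.ofReal_rpow_of_nonneg (by positivity) (by linarith)]
        refine ENNReal.rpow_le_rpow ?_ (by linarith)
        rw [two_mul, ENNReal.ofReal_add (by positivity) (by positivity)]
        gcongr
      refine (mul_le_mul_right e3 _).trans ?_
      rw [← ENNReal.ofReal_mul (by positivity)]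
      refine ENNReal.ofReal_le_ofReal (le_of_eq ?_)
      have e4 : ((1 / 2 : ℝ) ^ i / 4) ^ (-e) = 4 ^ e * b ^ i := by
        rw [Real.rpow_neg (by positivity), Real.div_rpow (by positivity) (by norm_num), inv_div,
          one_div, inv_pow, Real.inv_rpow (by positivity), div_inv_eq_mul, hb,
          ← Real.rpow_natCast (2 ^ e), ← Real.rpow_mul (by norm_num), ← Real.rpow_natCast,
          ← Real.rpow_mul (by norm_num), mul_comm (i : ℝ)]
      have e5 : (τ ^ i) ^ P.κ = τ ^ i * (τ ^ (P.κ - 1)) ^ i := by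
        rw [← Real.rpow_natCast τ i, ← Real.rpow_natCast _ i, ← Real.rpow_mul hτ0.le,
          ← Real.rpow_mul hτ0.le, ← Real.rpow_add hτ0]
        congr 1; ring
      rw [e4, Real.mul_rpow (by norm_num) (by positivity), Real.mul_rpow hy0.le (by positivity), e5]
      calc _ = A * y0 ^ P.κ * τ ^ i * (b * τ ^ (P.κ - 1)) ^ i := by rw [hA, mul_pow]; ring
        _ = _ := by rw [hτb, hyA, pow_succ]; ring
  have hz : (0 : ℝ) < (1 / 2) ^ i0 := by positivity
  refine ((lb_mono_radius (by linarith) _).trans (lb_mono fun x => P.R_mono ?_)).trans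
    ((hind i0 le_rfl).trans (ENNReal.ofReal_le_ofReal ?_))
  · linarith
  · rw [lt_div_iff₀ hy0] at hi0; linarith

end Prm

namespace Prm

variable {P : Prm}

lemma lb_smul {l : ℝ} (hl : 0 < l) (r : ℝ) (F : Rn P.n → ℝ) :
    P.lb r (fun x => F (l • x)) = ENNReal.ofReal ((l ^ P.n)⁻¹) * P.lb (l * r) F := by
  have := P.lint_ball_affine 0 hl r (fun x => ENNReal.ofReal (F x))
  simpa [lb] using this

lemma tl_smul {l : ℝ} (hl : 0 < l) (r : ℝ) (F : Rn P.n → ℝ) :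
    P.tl r (fun x => F (l • x)) = ENNReal.ofReal (l ^ (P.s * P.p)) * P.tl (l * r) F := by
  have := P.lint_tail_affine 0 hl r (fun x => ENNReal.ofReal (F x))
  simpa [tl] using this

lemma lb_const {r c : ℝ} (hr : 0 ≤ r) (hc : 0 ≤ c) :
    P.lb r (fun _ => c) = ENNReal.ofReal (c * (r ^ P.n * P.ω)) := by
  rw [lb, setLIntegral_const, P.vol_ball _ hr, ← ENNReal.ofReal_mul hc]

lemma tl_const {r c : ℝ} (hr : 0 < r) (hc : 0 ≤ c) :
    P.tl r (fun _ => c) ≤ ENNReal.ofReal (c * (r ^ (-(P.s * P.p)) * P.C0)) := by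
  rw [tl, lintegral_const_mul' _ _ ENNReal.ofReal_ne_top, ENNReal.ofReal_mul hc]
  gcongr
  exact P.lint_ker_compl hr

lemma lb_add {r : ℝ} {F G : Rn P.n → ℝ} (hF : ∀ x, 0 ≤ F x) (hG : ∀ x, 0 ≤ G x)
    (hFm : Measurable F) : P.lb r (fun x => F x + G x) = P.lb r F + P.lb r G := by
  simp only [lb]
  rw [← lintegral_add_left (by fun_prop)]
  exact lintegral_congr fun x => ENNReal.ofReal_add (hF x) (hG x)

lemma tl_add {r : ℝ} {F G : Rn P.n → ℝ} (hF : ∀ x, 0 ≤ F x) (hG : ∀ x, 0 ≤ G x)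
    (hFm : Measurable F) : P.tl r (fun x => F x + G x) = P.tl r F + P.tl r G := by
  simp only [tl]
  have := P.measurable_ker
  rw [← lintegral_add_left (by fun_prop)]
  exact lintegral_congr fun x => by rw [ENNReal.ofReal_add (hF x) (hG x), add_mul]

lemma tl_split {r : ℝ} (hr : 0 < r) (F : Rn P.n → ℝ) :
    P.tl r F ≤ ENNReal.ofReal ((r ^ P.N)⁻¹) * P.lb 1 F + P.tl 1 F := by
  simp only [tl, lb]
  have hsub : (ball (0 : Rn P.n) r)ᶜ ⊆ (ball 0 1 \ ball 0 r) ∪ (ball 0 1)ᶜ := by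
    intro x hx
    by_cases h : x ∈ ball (0 : Rn P.n) 1
    · exact Or.inl ⟨h, hx⟩
    · exact Or.inr h
  refine (lintegral_mono_set hsub).trans ((lintegral_union_le _ _ _).trans ?_)
  gcongr
  rw [← lintegral_const_mul' _ _ ENNReal.ofReal_ne_top]
  calc _ ≤ ∫⁻ x in ball (0 : Rn P.n) 1 \ ball 0 r,
        ENNReal.ofReal ((r ^ P.N)⁻¹) * ENNReal.ofReal (F x) := by
        refine setLIntegral_mono' (measurableSet_ball.diff measurableSet_ball) fun x hx => ?_
        rw [mul_comm]
        gcongr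
        exact P.ker_le_of_le hr (by simpa using hx.2)
    _ ≤ _ := lintegral_mono_set sdiff_subset

lemma rpow_p1_le (t : ℝ) : max t 0 ^ (P.p - 1) ≤ 1 + 2 ^ (P.p - P.q) * P.R t := by
  have hR := P.R_nonneg t
  have h1 := P.p1_pos
  rcases le_total t 1 with h | h
  · have : max t 0 ^ (P.p - 1) ≤ 1 :=
      Real.rpow_le_one (le_max_right _ _) (max_le h zero_le_one) h1.le
    have : 0 ≤ (2 : ℝ) ^ (P.p - P.q) * P.R t := by positivity
    linarith
  · rw [max_eq_left (by linarith)]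
    have e1 := P.rpow_le_R one_pos h
    norm_num at e1
    have e2 := Real.rpow_le_rpow_of_exponent_le h P.p1_le_q
    linarith

lemma R_le_g {t : ℝ} (ht : t ≤ 2) :
    P.R t ≤ 2 ^ (P.p - 1) * 3 ^ (1 + P.ξ) / P.ξ * P.g t := by
  have hξ := P.hξ
  rcases le_total t 0 with h | h
  · rw [P.R_of_nonpos h, P.g_of_nonpos h, mul_zero]
  · have e1 := P.g_lower le_rfl h
    rw [P.g_of_nonpos le_rfl, sub_zero, sub_zero] at e1
    have e2 : (3 : ℝ) ^ (-(1 + P.ξ)) ≤ P.H t :=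
      Real.rpow_le_rpow_of_nonpos (by positivity) (by linarith) (by linarith)
    have e3 : P.R t ≤ 2 ^ (P.p - 1) * t := by
      unfold R
      rw [max_eq_left h]
      calc t ^ P.p * (1 + t) ^ (P.q - P.p) ≤ t ^ P.p * 1 := by
            gcongr
            exact Real.rpow_le_one_of_one_le_of_nonpos (by linarith) (by linarith [P.q_le])
        _ = t ^ (P.p - 1) * t := by
            rw [mul_one]
            rcases h.eq_or_lt with h | h
            · subst h; simp [Real.zero_rpow P.p_pos.ne']
            · rw [← Real.rpow_add_one h.ne']; ring_nf
        _ ≤ _ := by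
            gcongr
            exact P.p1_pos.le
    have e4 : t ≤ 3 ^ (1 + P.ξ) / P.ξ * P.g t := by
      rw [div_mul_eq_mul_div, le_div_iff₀ hξ]
      calc t * P.ξ = 3 ^ (1 + P.ξ) * (P.ξ * 3 ^ (-(1 + P.ξ)) * t) := by
            rw [Real.rpow_neg (by norm_num)]; field_simp
        _ ≤ 3 ^ (1 + P.ξ) * (P.ξ * P.H t * t) := by gcongr
        _ ≤ _ := by gcongr
    calc P.R t ≤ 2 ^ (P.p - 1) * t := e3
      _ ≤ 2 ^ (P.p - 1) * (3 ^ (1 + P.ξ) / P.ξ * P.g t) := by gcongr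
      _ = _ := by ring

lemma cross_lower {u : Rn P.n → ℝ} {a b : ℝ} (ha : 0 ≤ a) (hb : 0 ≤ b) (hu : Measurable u)
    (hS : ENNReal.ofReal a ≤ volume ({x | u x ≤ -b} ∩ ball (0 : Rn P.n) (1 / 2))) :
    ENNReal.ofReal (b ^ (P.p - 1) * a) * P.lb (1 / 2) (fun x => P.g (u x)) ≤
      ∫⁻ x, ∫⁻ y, ENNReal.ofReal (max (-u y) 0 ^ (P.p - 1) *
        (P.g (u x) * P.eta (1 / 2) 1 x ^ P.p) * P.ker (x - y)) := by
  have h1 := P.p1_pos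
  rw [lb, ← lintegral_const_mul' _ _ ENNReal.ofReal_ne_top]
  refine le_trans (lintegral_mono_ae ?_) (setLIntegral_le_lintegral (ball (0 : Rn P.n) (1 / 2)) _)
  filter_upwards [ae_restrict_mem measurableSet_ball] with x hx
  have hx' : ‖x‖ < 1 / 2 := by simpa using hx
  have hη : P.eta (1 / 2) 1 x = 1 := P.eta_eq_one (by norm_num) hx'.le
  rw [hη, Real.one_rpow, mul_one]
  set S := {x | u x ≤ -b} ∩ ball (0 : Rn P.n) (1 / 2) with hSd
  have hSm : MeasurableSet S := (measurableSet_le hu measurable_const).inter measurableSet_ball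
  have hg := P.g_nonneg (u x)
  calc _ = ENNReal.ofReal (b ^ (P.p - 1) * P.g (u x)) * ENNReal.ofReal a := by
        rw [← ENNReal.ofReal_mul (by positivity), ← ENNReal.ofReal_mul (by positivity)]
        congr 1; ring
    _ ≤ ENNReal.ofReal (b ^ (P.p - 1) * P.g (u x)) * volume S := by gcongr
    _ = ∫⁻ y in S, ENNReal.ofReal (b ^ (P.p - 1) * P.g (u x)) := by rw [setLIntegral_const]
    _ ≤ ∫⁻ y in S, ENNReal.ofReal (max (-u y) 0 ^ (P.p - 1) * P.g (u x) * P.ker (x - y)) := by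
        refine lintegral_mono_ae ?_
        have hne : ∀ᵐ y ∂(volume.restrict S), y ≠ x :=
          ae_restrict_of_ae (Measure.ae_ne volume x)
        filter_upwards [ae_restrict_mem hSm, hne] with y hy hyx
        have hy1 : u y ≤ -b := hy.1
        have hy2 : ‖y‖ < 1 / 2 := by simpa using hy.2
        have hk : 1 ≤ P.ker (x - y) :=
          P.one_le_ker (sub_ne_zero.2 hyx.symm) ((norm_sub_le _ _).trans (by linarith))
        refine ENNReal.ofReal_le_ofReal ?_
        calc b ^ (P.p - 1) * P.g (u x) = b ^ (P.p - 1) * P.g (u x) * 1 := by ring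
          _ ≤ _ := by
            gcongr
            exact le_max_of_le_left (by linarith)
    _ ≤ _ := setLIntegral_le_lintegral _ _

variable (P) in
/-- Bound for the local energy of the rescaled function in the density lemma. -/
def A1 : ℝ := 2 ^ P.p * (P.R 1 * P.ω + 1)

variable (P) in
/-- Bound for the tail of the rescaled function in the density lemma. -/
def A2 : ℝ := 2 ^ (P.p - 1) * (P.C0 + 1)

variable (P) in
/-- Half the measure of the ball of radius one half. -/
def halfVol : ℝ := (1 / 2) ^ P.n * P.ω / 2

lemma A1_pos : 0 < P.A1 := by
  have := P.ω_pos; have := P.R_nonneg 1; unfold A1; positivity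

lemma A2_pos : 0 < P.A2 := by
  have := P.C0_nonneg; unfold A2; positivity

lemma halfVol_pos : 0 < P.halfVol := by
  have := P.ω_pos; unfold halfVol; positivity

section density

variable {u : Rn P.n → ℝ} {η l : ℝ}

lemma lb_R_stretch (hl : 0 < l) (hl1 : l ≤ 1) (hη : η ≤ l ^ P.p)
    (hX : P.lb 1 (fun x => P.R (u x - 1)) ≤ ENNReal.ofReal η) :
    P.lb 1 (fun x => P.R (1 + (u x - 1) / l)) ≤ ENNReal.ofReal P.A1 := by
  have hR1 := P.R_nonneg 1
  have hω := P.ω_pos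
  calc _ ≤ P.lb 1 (fun x => 2 ^ P.p * P.R 1 + 2 ^ P.p * (1 / l) ^ P.p * P.R (u x - 1)) := by
        refine lb_mono fun x => (P.R_add_le _ _).trans ?_
        have := P.R_div_le hl hl1 (u x - 1)
        calc _ ≤ 2 ^ P.p * (P.R 1 + (1 / l) ^ P.p * P.R (u x - 1)) := by gcongr
          _ = _ := by ring
    _ = ENNReal.ofReal (2 ^ P.p * P.R 1 * (1 ^ P.n * P.ω)) +
        ENNReal.ofReal (2 ^ P.p * (1 / l) ^ P.p) * P.lb 1 (fun x => P.R (u x - 1)) := by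
        rw [lb_add (fun _ => by positivity) (fun x => by have := P.R_nonneg (u x - 1); positivity)
          measurable_const, lb_const (by norm_num) (by positivity), lb_const_mul (by positivity)]
    _ ≤ ENNReal.ofReal (2 ^ P.p * P.R 1 * (1 ^ P.n * P.ω)) +
        ENNReal.ofReal (2 ^ P.p * (1 / l) ^ P.p) * ENNReal.ofReal (l ^ P.p) := by
        gcongr; exact hX.trans (ENNReal.ofReal_le_ofReal hη)
    _ = _ := by
        rw [← ENNReal.ofReal_mul (by positivity), ← ENNReal.ofReal_add (by positivity)
          (by positivity), A1, Real.div_rpow (by norm_num) hl.le, Real.one_rpow, one_pow]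
        congr 1
        have : l ^ P.p ≠ 0 := by positivity
        field_simp

lemma tl_stretch (hl : 0 < l)
    (hT : P.tl 1 (fun x => max (u x - 1) 0 ^ (P.p - 1)) ≤ ENNReal.ofReal (l ^ (P.p - 1))) :
    P.tl 1 (fun x => max (1 + (u x - 1) / l) 0 ^ (P.p - 1)) ≤ ENNReal.ofReal P.A2 := by
  have h1 := P.p1_pos
  have hC := P.C0_nonneg
  calc _ ≤ P.tl 1 (fun x => 2 ^ (P.p - 1) + 2 ^ (P.p - 1) * (1 / l) ^ (P.p - 1) *
        max (u x - 1) 0 ^ (P.p - 1)) := by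
        refine tl_mono fun x => ?_
        calc _ ≤ (1 + 1 / l * max (u x - 1) 0) ^ (P.p - 1) := by
              gcongr
              refine max_le ?_ (by positivity)
              rw [div_eq_mul_inv, mul_comm, one_div]
              gcongr
              exact le_max_left _ _
          _ ≤ 2 ^ (P.p - 1) * (1 ^ (P.p - 1) + (1 / l * max (u x - 1) 0) ^ (P.p - 1)) :=
              add_rpow_le_two (by norm_num) (by positivity) h1.le
          _ = _ := by
              rw [Real.mul_rpow (by positivity) (by positivity), Real.one_rpow]; ring
    _ = P.tl 1 (fun _ => 2 ^ (P.p - 1)) + ENNReal.ofReal (2 ^ (P.p - 1) * (1 / l) ^ (P.p - 1)) *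
        P.tl 1 (fun x => max (u x - 1) 0 ^ (P.p - 1)) := by
        rw [tl_add (fun _ => by positivity) (fun x => by positivity) measurable_const,
          tl_const_mul (by positivity)]
    _ ≤ ENNReal.ofReal (2 ^ (P.p - 1) * (1 ^ (-(P.s * P.p)) * P.C0)) +
        ENNReal.ofReal (2 ^ (P.p - 1) * (1 / l) ^ (P.p - 1)) * ENNReal.ofReal (l ^ (P.p - 1)) := by
        gcongr
        exact tl_const one_pos (by positivity)
    _ = _ := by
        rw [← ENNReal.ofReal_mul (by positivity), ← ENNReal.ofReal_add (by positivity)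
          (by positivity), A2, Real.div_rpow (by norm_num) hl.le, Real.one_rpow, Real.one_rpow]
        congr 1
        have : l ^ (P.p - 1) ≠ 0 := by positivity
        field_simp

variable (P) in
/-- Constant in the bound of the measure of the superlevel set. -/
def A3 : ℝ := P.CA * (1 / 2) ^ (-(P.N + P.p)) * (1 + P.A1 + P.ω * P.A2) * 2 ^ (P.p - 1) / P.halfVol

lemma A3_pos : 0 < P.A3 := by
  have := P.CA_pos; have := P.A1_pos; have := P.A2_pos; have := P.ω_pos; have := P.halfVol_pos
  unfold A3; positivity

lemma InCls.stretch (h : P.InCls 0 1 η u) (hl : 0 < l) :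
    P.InCls 0 1 (l ^ (1 - P.p) * η) (fun x => 1 + (u x - 1) / l) := by
  have := h.zoom (l := 1) (m := l) (r' := 1) one_pos hl.ne' (1 - l) (by simp)
  rw [abs_of_pos hl, Real.one_rpow, mul_one] at this
  convert this using 2 with x
  rw [one_smul, zero_add]; field_simp; ring

lemma lb_g_stretch (h : P.InCls 0 1 η u) (hl : 0 < l) (hl1 : l ≤ 1 / 2) (hη : η ≤ l ^ P.p)
    (hX : P.lb 1 (fun x => P.R (u x - 1)) ≤ ENNReal.ofReal η)
    (hT : P.tl 1 (fun x => max (u x - 1) 0 ^ (P.p - 1)) ≤ ENNReal.ofReal (l ^ (P.p - 1)))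
    (hS : ENNReal.ofReal P.halfVol ≤ volume ({x | u x ≤ 0} ∩ ball (0 : Rn P.n) (1 / 2))) :
    P.lb (1 / 2) (fun x => P.g (1 + (u x - 1) / l)) ≤ ENNReal.ofReal (P.A3 * l ^ (P.p - 1)) := by
  have hA1 := P.A1_pos
  have hA2 := P.A2_pos
  have hω := P.ω_pos
  have hCA := P.CA_pos
  have hv := P.halfVol_pos
  have hu := h.1
  set b : ℝ := 1 / (2 * l) with hb
  have hb0 : 0 < b := by positivity
  have hbl : b ≤ 1 / l - 1 := by
    rw [hb, div_sub_one hl.ne', div_le_div_iff₀ (by positivity) hl]; nlinarith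
  have hS' : ENNReal.ofReal P.halfVol ≤
      volume ({x | 1 + (u x - 1) / l ≤ -b} ∩ ball (0 : Rn P.n) (1 / 2)) := by
    refine hS.trans (measure_mono (inter_subset_inter_left _ fun x hx => ?_))
    have hx : u x ≤ 0 := hx
    have : (u x - 1) / l ≤ - (1 / l) := by
      rw [← neg_div]; gcongr; linarith
    simp only [mem_ofPred_eq]; linarith
  have h1 := cross_lower hv.le hb0.le (by fun_prop) hS'
  have h2 := le_add_self.trans (cacc (h.stretch hl) (ρ := 1 / 2) (by norm_num) le_rfl one_pos
    (by norm_num))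
  have hM : l ^ (1 - P.p) * η ≤ 1 := by
    calc l ^ (1 - P.p) * η ≤ l ^ (1 - P.p) * l ^ P.p := by gcongr
      _ = l := by rw [← Real.rpow_add hl]; simp
      _ ≤ 1 := by linarith
  have hg : P.lb 1 (fun x => P.g (1 + (u x - 1) / l)) ≤ ENNReal.ofReal P.ω := by
    refine (lb_mono fun x => P.g_le_one _).trans ?_
    rw [lb_const (by norm_num) (by norm_num), one_pow, one_mul, one_mul]
  have h3 := h1.trans (h2.trans (mul_le_mul_right (add_le_add (add_le_add
    (ENNReal.ofReal_le_ofReal hM) (lb_R_stretch hl (by linarith) hη hX))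
    (mul_le_mul' hg (tl_stretch hl hT))) _))
  rw [← ENNReal.ofReal_mul hω.le, ← ENNReal.ofReal_add (by norm_num) hA1.le,
    ← ENNReal.ofReal_add (by positivity) (by positivity), ← ENNReal.ofReal_mul (by positivity),
    show (1 : ℝ) - 1 / 2 = 1 / 2 by norm_num] at h3
  have hc : 0 < b ^ (P.p - 1) * P.halfVol := by positivity
  rw [mul_comm, ← ENNReal.le_div_iff_mul_le (by left; simpa using hc) (by simp),
    ← ENNReal.ofReal_div_of_pos hc] at h3
  refine h3.trans (ENNReal.ofReal_le_ofReal (le_of_eq ?_))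
  have hbp : b ^ (P.p - 1) = (2 ^ (P.p - 1) * l ^ (P.p - 1))⁻¹ := by
    rw [hb, one_div, Real.inv_rpow (by positivity), Real.mul_rpow (by norm_num) hl.le]
  rw [hbp, A3]
  have : l ^ (P.p - 1) ≠ 0 := by positivity
  field_simp

lemma R_le_g_add (hl : 0 < l) (hl1 : l ≤ 1) (t : ℝ) :
    P.R (1 + (t - 1) / l) ≤ 2 ^ (P.p - 1) * 3 ^ (1 + P.ξ) / P.ξ * P.g (1 + (t - 1) / l) +
      (2 / l) ^ P.p * P.R (t - 1) := by
  have hξ := P.hξ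
  have h1 := P.R_nonneg (t - 1)
  have h2 := P.g_nonneg (1 + (t - 1) / l)
  rcases le_total (1 + (t - 1) / l) 2 with h | h
  · refine (R_le_g h).trans ?_
    have : 0 ≤ (2 / l) ^ P.p * P.R (t - 1) := by positivity
    linarith
  · have : P.R (1 + (t - 1) / l) ≤ (2 / l) ^ P.p * P.R (t - 1) := by
      calc _ ≤ P.R (2 / l * (t - 1)) := P.R_mono (by
            rw [div_mul_eq_mul_div, mul_div_assoc]; linarith)
        _ ≤ _ := P.R_mul_le (by rw [le_div_iff₀ hl]; linarith) _
    have : 0 ≤ 2 ^ (P.p - 1) * 3 ^ (1 + P.ξ) / P.ξ * P.g (1 + (t - 1) / l) := by positivity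
    linarith

end density

variable (P) in
/-- Bound for the tail of the rescaled function at a fixed smaller scale. -/
def A5 : ℝ := ((1 / 4 : ℝ) ^ P.N)⁻¹ * (P.ω + 2 ^ (P.p - P.q) * P.A1) + P.A2

lemma A5_pos : 0 < P.A5 := by
  have := P.A1_pos; have := P.A2_pos; have := P.ω_pos
  unfold A5; positivity

lemma density_lemma : ∃ l : ℝ, 0 < l ∧ l ≤ 1 / 2 ∧ ∀ η' : ℝ, 0 < η' → ∃ η : ℝ, 0 < η ∧
    ∀ u : Rn P.n → ℝ, P.InCls 0 1 η u →
      P.lb 1 (fun x => P.R (u x - 1)) ≤ ENNReal.ofReal η →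
      P.tl 1 (fun x => max (u x - 1) 0 ^ (P.p - 1)) ≤ ENNReal.ofReal (l ^ (P.p - 1)) →
      ENNReal.ofReal P.halfVol ≤ volume ({x | u x ≤ 0} ∩ ball (0 : Rn P.n) (1 / 2)) →
      P.lb (1 / 4) (fun x => P.R (u x - 1 + l / 2)) ≤ ENNReal.ofReal η' := by
  have hp := P.p_pos
  have h1 := P.p1_pos
  have hξ := P.hξ
  have hA1 := P.A1_pos
  have hA2 := P.A2_pos
  have hA3 := P.A3_pos
  have hω := P.ω_pos
  obtain ⟨y0, hy0, hD⟩ := P.de_giorgi_local (T0 := P.A5) P.A5_pos.le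
  set C3 : ℝ := 2 ^ (P.p - 1) * 3 ^ (1 + P.ξ) / P.ξ with hC3
  have hC30 : 0 < C3 := by positivity
  have hlim : Tendsto (fun l : ℝ => 2 ^ P.n * (C3 * (P.A3 * l ^ (P.p - 1)))) (𝓝[>] 0) (𝓝 0) := by
    have : ContinuousAt (fun l : ℝ => 2 ^ P.n * (C3 * (P.A3 * l ^ (P.p - 1)))) 0 := by
      have := Real.continuousAt_rpow_const 0 (P.p - 1) (Or.inr h1.le)
      fun_prop
    have := this.tendsto
    simp only [Real.zero_rpow h1.ne', mul_zero] at this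
    exact this.mono_left nhdsWithin_le_nhds
  obtain ⟨l, hly, hl0, hl1⟩ := ((hlim.eventually (gt_mem_nhds (half_pos hy0))).and
    (Ioc_mem_nhdsGT (show (0 : ℝ) < 1 / 2 by norm_num))).exists
  refine ⟨l, hl0, hl1, fun η' hη' => ?_⟩
  obtain ⟨δ, hδ, hD⟩ := hD (2 ^ P.n * η') (by positivity)
  set cM : ℝ := l ^ (1 - P.p) * (1 / 2) ^ (P.s * P.p - P.n) with hcM
  have hcM0 : 0 < cM := by positivity
  set η := min (min (l ^ P.p) (δ / cM)) (y0 / 2 / (2 ^ P.n * (2 / l) ^ P.p)) with hη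
  have e1 : η ≤ l ^ P.p := (min_le_left _ _).trans (min_le_left _ _)
  have e2 : η ≤ δ / cM := (min_le_left _ _).trans (min_le_right _ _)
  have e3 : η ≤ y0 / 2 / (2 ^ P.n * (2 / l) ^ P.p) := min_le_right _ _
  have hη0 : 0 < η := by
    rw [hη]; refine lt_min (lt_min ?_ ?_) ?_ <;> positivity
  clear_value η
  refine ⟨η, hη0, fun u hu hX hT hS => ?_⟩
  have hum := hu.1
  set v : Rn P.n → ℝ := fun x => 1 + (u x - 1) / l with hv
  have hvm : Measurable v := by fun_prop
  have hvg := lb_g_stretch hu hl0 hl1 e1 hX hT hS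
  have hvR := lb_R_stretch hl0 (by linarith) e1 hX
  have hvT := tl_stretch hl0 hT
  have hw : P.InCls 0 1 δ (fun x => v ((1 / 2 : ℝ) • x)) := by
    have := (hu.stretch hl0).zoom (l := 1 / 2) (m := 1) (r' := 1) (by norm_num) one_ne_zero 0
      (by norm_num)
    simp only [abs_one, Real.one_rpow, one_mul, zero_add, sub_zero, div_one] at this
    refine this.mono le_rfl ?_
    rw [le_div_iff₀ hcM0, hcM] at e2
    linarith
  have hwT : P.tl (1 / 2) (fun x => max (v ((1 / 2 : ℝ) • x)) 0 ^ (P.p - 1)) ≤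
      ENNReal.ofReal P.A5 := by
    rw [tl_smul (by norm_num) (1 / 2) (fun x => max (v x) 0 ^ (P.p - 1))]
    have hsm : ENNReal.ofReal ((1 / 2 : ℝ) ^ (P.s * P.p)) ≤ 1 := by
      rw [ENNReal.ofReal_le_one]
      exact Real.rpow_le_one (by norm_num) (by norm_num) P.sp_pos.le
    refine (mul_le_mul' hsm le_rfl).trans ?_
    rw [one_mul, show (1 / 2 * (1 / 2) : ℝ) = 1 / 4 by norm_num]
    refine (tl_split (by norm_num) _).trans ?_
    have : P.lb 1 (fun x => max (v x) 0 ^ (P.p - 1)) ≤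
        ENNReal.ofReal (P.ω + 2 ^ (P.p - P.q) * P.A1) := by
      refine (lb_mono fun x => rpow_p1_le (v x)).trans ?_
      rw [lb_add (fun _ => by norm_num) (fun x => by have := P.R_nonneg (v x); positivity)
        measurable_const, lb_const (by norm_num) (by norm_num), lb_const_mul (by positivity),
        ENNReal.ofReal_add (by positivity) (by positivity), ENNReal.ofReal_mul (q := P.A1)
        (by positivity)]
      gcongr
      simp
    rw [A5, ENNReal.ofReal_add (by positivity) (by positivity), ENNReal.ofReal_mul (by positivity)]
    gcongr
  have hwX : P.lb 1 (fun x => P.R (v ((1 / 2 : ℝ) • x))) ≤ ENNReal.ofReal y0 := by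
    rw [lb_smul (by norm_num) 1 (fun x => P.R (v x)), mul_one]
    calc _ ≤ ENNReal.ofReal (((1 / 2 : ℝ) ^ P.n)⁻¹) * P.lb (1 / 2) (fun x => C3 * P.g (v x) +
          (2 / l) ^ P.p * P.R (u x - 1)) := by
          gcongr
          exact lb_mono fun x => R_le_g_add hl0 (by linarith) (u x)
      _ = ENNReal.ofReal (((1 / 2 : ℝ) ^ P.n)⁻¹) * (ENNReal.ofReal C3 *
          P.lb (1 / 2) (fun x => P.g (v x)) + ENNReal.ofReal ((2 / l) ^ P.p) *
            P.lb (1 / 2) (fun x => P.R (u x - 1))) := by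
          rw [lb_add (fun x => by have := P.g_nonneg (v x); positivity)
            (fun x => by have := P.R_nonneg (u x - 1); positivity) (by fun_prop),
            lb_const_mul hC30.le, lb_const_mul (by positivity)]
      _ ≤ ENNReal.ofReal (((1 / 2 : ℝ) ^ P.n)⁻¹) * (ENNReal.ofReal C3 *
          ENNReal.ofReal (P.A3 * l ^ (P.p - 1)) + ENNReal.ofReal ((2 / l) ^ P.p) *
            ENNReal.ofReal (y0 / 2 / (2 ^ P.n * (2 / l) ^ P.p))) := by
          gcongr
          exact (lb_mono_radius (by norm_num) _).trans (hX.trans (ENNReal.ofReal_le_ofReal e3))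
      _ ≤ _ := by
          rw [← ENNReal.ofReal_mul (by positivity), ← ENNReal.ofReal_mul (by positivity),
            ← ENNReal.ofReal_add (by positivity) (by positivity),
            ← ENNReal.ofReal_mul (by positivity)]
          refine ENNReal.ofReal_le_ofReal ?_
          have e : ((1 / 2 : ℝ) ^ P.n)⁻¹ * (C3 * (P.A3 * l ^ (P.p - 1)) +
              (2 / l) ^ P.p * (y0 / 2 / (2 ^ P.n * (2 / l) ^ P.p))) =
              2 ^ P.n * (C3 * (P.A3 * l ^ (P.p - 1))) + y0 / 2 := by
            have : (2 / l) ^ P.p ≠ 0 := by positivity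
            rw [one_div, inv_pow, inv_inv]
            field_simp
          rw [e]; linarith
  have hfin := hD _ hw hwT hwX
  rw [lb_smul (by norm_num) (1 / 2) (fun x => P.R (v x - 1 / 2)), one_div, inv_pow, inv_inv,
    ENNReal.ofReal_mul (by positivity)] at hfin
  have h2 : ENNReal.ofReal (2 ^ P.n) ≠ 0 := by simp
  rw [ENNReal.mul_le_mul_iff_right h2 ENNReal.ofReal_ne_top] at hfin
  refine (lb_mono (G := fun x => P.R (v x - 2⁻¹)) fun x => ?_).trans
    (le_trans (le_of_eq ?_) hfin)
  · have hlt : u x - 1 + l / 2 = l * (v x - 2⁻¹) := by simp only [hv]; field_simp; ring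
    rw [hlt]
    rcases le_total (v x - 2⁻¹) 0 with h | h
    · rw [P.R_of_nonpos (mul_nonpos_of_nonneg_of_nonpos hl0.le h)]; exact P.R_nonneg _
    · exact P.R_mono (by nlinarith)
  · norm_num

end Prm

namespace Prm

variable {P : Prm}

variable (P) in
/-- Almost solutions that are almost bounded by one in the unit ball with controlled tail. -/
def State (τ η : ℝ) (u : Rn P.n → ℝ) : Prop :=
  P.InCls 0 1 η u ∧ P.lb 1 (fun x => P.R (|u x| - 1)) ≤ ENNReal.ofReal η ∧
    P.tl 1 (fun x => max (|u x| - 1) 0 ^ (P.p - 1)) ≤ ENNReal.ofReal τ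

lemma State.neg {τ η : ℝ} {u : Rn P.n → ℝ} (h : P.State τ η u) : P.State τ η (fun x => - u x) := by
  obtain ⟨h1, h2, h3⟩ := h
  exact ⟨h1.neg, by simpa using h2, by simpa using h3⟩

lemma half_density (u : Rn P.n → ℝ) :
    ENNReal.ofReal P.halfVol ≤ volume ({x | u x ≤ 0} ∩ ball (0 : Rn P.n) (1 / 2)) ∨
      ENNReal.ofReal P.halfVol ≤ volume ({x | -u x ≤ 0} ∩ ball (0 : Rn P.n) (1 / 2)) := by
  have hv := P.halfVol_pos
  by_contra! hc
  have h1 := ENNReal.add_lt_add hc.1 hc.2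
  rw [← ENNReal.ofReal_add hv.le hv.le] at h1
  have h2 : volume (ball (0 : Rn P.n) (1 / 2)) ≤ _ := measure_mono (μ := volume) (t :=
    ({x | u x ≤ 0} ∩ ball (0 : Rn P.n) (1 / 2)) ∪ ({x | -u x ≤ 0} ∩ ball (0 : Rn P.n) (1 / 2)))
    fun x hx => by
      rcases le_total (u x) 0 with h | h
      · exact Or.inl ⟨h, hx⟩
      · exact Or.inr ⟨neg_nonpos.2 h, hx⟩
  have h3 := (h2.trans (measure_union_le _ _)).trans_lt h1
  rw [P.vol_ball _ (by norm_num)] at h3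
  exact absurd h3 (by rw [halfVol, add_halves]; exact lt_irrefl _)

variable (P) in
/-- Constant for absorbing the truncated power in the tail. -/
def A6 (θ : ℝ) : ℝ := 2 ^ (P.p - 1) * ((1 / (2 * θ)) ^ (P.q - (P.p - 1)) *
  ((1 + 2 * θ) / (2 * θ)) ^ (P.p - P.q))

lemma A6_nonneg {θ : ℝ} (hθ : 0 < θ) : 0 ≤ P.A6 θ := by unfold A6; positivity

lemma p1_le_A6 {θ t : ℝ} (hθ : 0 < θ) (ht : 2 * θ ≤ t) : (2 * t) ^ (P.p - 1) ≤ P.A6 θ * P.R t := by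
  have ht0 : 0 < t := by linarith
  have h1 := P.rpow_le_R (d := 2 * θ) (by positivity) ht
  have h2 : t ^ (P.p - 1) ≤ (1 / (2 * θ)) ^ (P.q - (P.p - 1)) * t ^ P.q := by
    have e : t ^ (P.p - 1) = (1 / t) ^ (P.q - (P.p - 1)) * t ^ P.q := by
      rw [one_div, Real.inv_rpow ht0.le, ← Real.rpow_neg ht0.le, ← Real.rpow_add ht0]
      congr 1; ring
    rw [e]
    have := P.p1_le_q
    gcongr
  rw [Real.mul_rpow (by norm_num) ht0.le, A6]
  calc _ ≤ 2 ^ (P.p - 1) * ((1 / (2 * θ)) ^ (P.q - (P.p - 1)) *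
        (((1 + 2 * θ) / (2 * θ)) ^ (P.p - P.q) * P.R t)) := by
        refine mul_le_mul_of_nonneg_left (h2.trans ?_) (by positivity)
        gcongr
    _ = _ := by ring

lemma tl_rescale_le {w : Rn P.n → ℝ} {θ lam η τ : ℝ} (hθ : 0 < θ) (hlam : 0 < lam)
    (hX : P.lb 1 (fun x => P.R (w x)) ≤ ENNReal.ofReal η) (hη : 0 ≤ η) (hτ : 0 ≤ τ)
    (hT : P.tl 1 (fun x => max (w x) 0 ^ (P.p - 1)) ≤ ENNReal.ofReal τ) :
    P.tl 1 (fun x => (2 * (max (w (lam • x)) 0 + 2 * θ)) ^ (P.p - 1)) ≤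
      ENNReal.ofReal ((8 * θ) ^ (P.p - 1) * P.C0 +
        lam ^ (P.s * P.p) * (2 ^ (P.p - 1) * (lam ^ P.N)⁻¹ * P.A6 θ) * η +
        lam ^ (P.s * P.p) * 4 ^ (P.p - 1) * τ) := by
  have h1 := P.p1_pos
  have hC := P.C0_nonneg
  have hA6 := P.A6_nonneg hθ
  rw [tl_smul hlam 1 (fun x => (2 * (max (w x) 0 + 2 * θ)) ^ (P.p - 1)), mul_one]
  set F : Rn P.n → ℝ := fun x => if 2 * θ ≤ w x then (2 * w x) ^ (P.p - 1) else 0 with hF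
  have hF0 : ∀ x, 0 ≤ F x := fun x => by
    simp only [hF]; split_ifs with h
    · exact Real.rpow_nonneg (by linarith) _
    · exact le_rfl
  have hF1 : ∀ x, F x ≤ P.A6 θ * P.R (w x) := fun x => by
    simp only [hF]; split_ifs with h
    · exact P.p1_le_A6 hθ h
    · have := P.R_nonneg (w x); positivity
  have hF2 : ∀ x, F x ≤ 2 ^ (P.p - 1) * max (w x) 0 ^ (P.p - 1) := fun x => by
    simp only [hF]; split_ifs with h
    · rw [max_eq_left (by linarith), Real.mul_rpow (by norm_num) (by linarith)]
    · positivity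
  have hsplit : ∀ x, (2 * (max (w x) 0 + 2 * θ)) ^ (P.p - 1) ≤
      (8 * θ) ^ (P.p - 1) + 2 ^ (P.p - 1) * F x := fun x => by
    by_cases h : 2 * θ ≤ w x
    · have e : F x = (2 * w x) ^ (P.p - 1) := by simp [hF, h]
      have e1 : (2 * (max (w x) 0 + 2 * θ)) ^ (P.p - 1) ≤ (2 * (2 * w x)) ^ (P.p - 1) := by
        rw [max_eq_left (by linarith)]
        refine Real.rpow_le_rpow (by linarith) (by linarith) h1.le
      rw [e, ← Real.mul_rpow (by norm_num) (by linarith)]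
      exact e1.trans (le_add_of_nonneg_left (by positivity))
    · have e1 : (2 * (max (w x) 0 + 2 * θ)) ^ (P.p - 1) ≤ (8 * θ) ^ (P.p - 1) := by
        refine Real.rpow_le_rpow (by positivity) ?_ h1.le
        have : max (w x) 0 ≤ 2 * θ := max_le (by linarith) (by linarith)
        linarith
      have := hF0 x
      exact e1.trans (le_add_of_nonneg_right (by positivity))
  have hTF : P.tl lam F ≤ ENNReal.ofReal ((lam ^ P.N)⁻¹ * P.A6 θ * η + 2 ^ (P.p - 1) * τ) := by
    refine (tl_split hlam F).trans ?_
    rw [ENNReal.ofReal_add (by positivity) (by positivity), mul_assoc,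
      ENNReal.ofReal_mul (by positivity), ENNReal.ofReal_mul (q := τ) (by positivity),
      ENNReal.ofReal_mul (q := η) (by positivity)]
    gcongr
    · refine (lb_mono hF1).trans ?_
      rw [lb_const_mul hA6]; gcongr
    · refine (tl_mono hF2).trans ?_
      rw [tl_const_mul (by positivity)]; gcongr
  calc _ ≤ ENNReal.ofReal (lam ^ (P.s * P.p)) * (P.tl lam (fun _ => (8 * θ) ^ (P.p - 1)) +
        ENNReal.ofReal (2 ^ (P.p - 1)) * P.tl lam F) := by
        gcongr
        refine (tl_mono hsplit).trans ?_
        rw [tl_add (fun _ => by positivity) (fun x => by have := hF0 x; positivity)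
          measurable_const, tl_const_mul (by positivity)]
    _ ≤ ENNReal.ofReal (lam ^ (P.s * P.p)) * (ENNReal.ofReal ((8 * θ) ^ (P.p - 1) *
          (lam ^ (-(P.s * P.p)) * P.C0)) + ENNReal.ofReal (2 ^ (P.p - 1)) *
            ENNReal.ofReal ((lam ^ P.N)⁻¹ * P.A6 θ * η + 2 ^ (P.p - 1) * τ)) := by
        gcongr
        exact tl_const hlam (by positivity)
    _ = _ := by
        rw [← ENNReal.ofReal_mul (by positivity), ← ENNReal.ofReal_add (by positivity)
          (by positivity), ← ENNReal.ofReal_mul (by positivity)]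
        congr 1
        have e4 : (4 : ℝ) ^ (P.p - 1) = 2 ^ (P.p - 1) * 2 ^ (P.p - 1) := by
          rw [← Real.mul_rpow (by norm_num) (by norm_num)]; norm_num
        rw [Real.rpow_neg hlam.le, e4]
        have : 0 ≤ θ := hθ.le
        have : lam ^ (P.s * P.p) ≠ 0 := by positivity
        field_simp
        ring

lemma exists_osc_decay (P : Prm) : ∃ τ θ lam : ℝ, 0 < τ ∧ 0 < θ ∧ θ ≤ 1 / 2 ∧ 0 < lam ∧ lam ≤ 1 / 4 ∧
    ∀ η' : ℝ, 0 < η' → ∃ η : ℝ, 0 < η ∧ ∀ u : Rn P.n → ℝ, P.State τ η u →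
      ∃ c : ℝ, |c| ≤ 1 ∧ P.State τ η' (fun x => (u (lam • x) - c) / (1 - θ)) := by
  have hp := P.p_pos
  have h1 := P.p1_pos
  have hC := P.C0_nonneg
  obtain ⟨l, hl0, hl1, hG⟩ := P.density_lemma
  set τ := l ^ (P.p - 1) with hτ
  have hτ0 : 0 < τ := by positivity
  have hlimθ : Tendsto (fun θ : ℝ => (8 * θ) ^ (P.p - 1) * P.C0) (𝓝[>] 0) (𝓝 0) := by
    have : ContinuousAt (fun θ : ℝ => (8 * θ) ^ (P.p - 1) * P.C0) 0 := by
      have : ContinuousAt (fun θ : ℝ => (8 * θ) ^ (P.p - 1)) 0 :=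
        (by fun_prop : ContinuousAt (fun θ : ℝ => 8 * θ) 0).rpow_const (Or.inr h1.le)
      fun_prop
    have := this.tendsto
    simp only [mul_zero, Real.zero_rpow h1.ne', zero_mul] at this
    exact this.mono_left nhdsWithin_le_nhds
  obtain ⟨θ, hθτ, hθ0, hθl⟩ := ((hlimθ.eventually (gt_mem_nhds (show 0 < τ / 3 by positivity))).and
    (Ioc_mem_nhdsGT (show (0 : ℝ) < l / 4 by positivity))).exists
  have hliml : Tendsto (fun lam : ℝ => lam ^ (P.s * P.p) * 4 ^ (P.p - 1)) (𝓝[>] 0) (𝓝 0) := by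
    have : ContinuousAt (fun lam : ℝ => lam ^ (P.s * P.p) * 4 ^ (P.p - 1)) 0 := by
      have := Real.continuousAt_rpow_const 0 (P.s * P.p) (Or.inr P.sp_pos.le)
      fun_prop
    have := this.tendsto
    simp only [Real.zero_rpow P.sp_pos.ne', zero_mul] at this
    exact this.mono_left nhdsWithin_le_nhds
  obtain ⟨lam, hlτ, hlam0, hlam1⟩ := ((hliml.eventually (gt_mem_nhds
    (show (0 : ℝ) < 1 / 3 by norm_num))).and
    (Ioc_mem_nhdsGT (show (0 : ℝ) < 1 / 4 by norm_num))).exists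
  refine ⟨τ, θ, lam, hτ0, hθ0, by linarith, hlam0, hlam1, fun η' hη' => ?_⟩
  have hA6 := P.A6_nonneg hθ0
  set cX : ℝ := 2 ^ P.p * (lam ^ P.n)⁻¹ with hcX
  have hcX0 : 0 < cX := by positivity
  obtain ⟨η1, hη1, hG⟩ := hG (η' / 2 / cX) (by positivity)
  set cM : ℝ := (1 - θ) ^ (1 - P.p) * lam ^ (P.s * P.p - P.n) with hcM
  have h1θ : 0 < 1 - θ := by linarith
  have hcM0 : 0 < cM := by positivity
  set cT : ℝ := lam ^ (P.s * P.p) * (2 ^ (P.p - 1) * (lam ^ P.N)⁻¹ * P.A6 θ) + 1 with hcT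
  have hcT0 : 0 < cT := by positivity
  obtain ⟨η, hη0, hηl⟩ : ∃ η : ℝ, 0 < η ∧ η ≤ η1 ∧ η ≤ η' / 2 / cX ∧ η ≤ η' / cM ∧
      η ≤ τ / 3 / cT := by
    refine ⟨min (min η1 (η' / 2 / cX)) (min (η' / cM) (τ / 3 / cT)), ?_, ?_, ?_, ?_, ?_⟩
    · refine lt_min (lt_min ?_ ?_) (lt_min ?_ ?_) <;> positivity
    · exact (min_le_left _ _).trans (min_le_left _ _)
    · exact (min_le_left _ _).trans (min_le_right _ _)
    · exact (min_le_right _ _).trans (min_le_left _ _)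
    · exact (min_le_right _ _).trans (min_le_right _ _)
  obtain ⟨e1, e2, e3, e4⟩ := hηl
  rw [le_div_iff₀ hcM0] at e3
  rw [le_div_iff₀ hcT0] at e4
  have abs_form : ∀ t : ℝ, |(t - (-θ)) / (1 - θ)| - 1 = (t - 1 + 2 * θ) / (1 - θ) ∨
      |(t - (-θ)) / (1 - θ)| - 1 = (-t - 1) / (1 - θ) := by
    intro t
    rw [abs_div, abs_of_pos h1θ]
    rcases abs_cases (t - -θ) with ⟨ha, -⟩ | ⟨ha, -⟩
    · exact Or.inl (by rw [ha]; field_simp; ring)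
    · exact Or.inr (by rw [ha]; field_simp; ring)
  have main : ∀ u : Rn P.n → ℝ, P.State τ η u →
      ENNReal.ofReal P.halfVol ≤ volume ({x | u x ≤ 0} ∩ ball (0 : Rn P.n) (1 / 2)) →
      P.State τ η' (fun x => (u (lam • x) - (-θ)) / (1 - θ)) := by
    intro u ⟨hu, hX, hT⟩ hS
    have hum := hu.1
    refine ⟨?_, ?_, ?_⟩
    · have := hu.zoom hlam0 h1θ.ne' (-θ) (r' := 1) (by linarith)
      simp only [zero_add, abs_of_pos h1θ] at this
      exact this.mono le_rfl (by linarith)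
    · have hg := hG u (hu.mono le_rfl e1)
        ((lb_mono fun x => P.R_mono (by linarith [le_abs_self (u x)])).trans
          (hX.trans (ENNReal.ofReal_le_ofReal e1)))
        ((tl_mono fun x => by gcongr; exact le_abs_self (u x)).trans hT) hS
      have hpt : ∀ t : ℝ, P.R (|(t - (-θ)) / (1 - θ)| - 1) ≤
          2 ^ P.p * P.R (t - 1 + l / 2) + 2 ^ P.p * P.R (|t| - 1) := by
        intro t
        have hdiv : ∀ a, P.R (a / (1 - θ)) ≤ 2 ^ P.p * P.R a := fun a => by
          have ha := P.R_nonneg a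
          refine (P.R_div_le h1θ (by linarith) a).trans ?_
          gcongr
          rw [div_le_iff₀ h1θ]; linarith
        have hR1 := P.R_nonneg (t - 1 + l / 2)
        have hR2 := P.R_nonneg (|t| - 1)
        rcases abs_form t with e | e
        · rw [e]
          calc _ ≤ 2 ^ P.p * P.R (t - 1 + 2 * θ) := hdiv _
            _ ≤ 2 ^ P.p * P.R (t - 1 + l / 2) := by gcongr; exact P.R_mono (by linarith)
            _ ≤ _ := le_add_of_nonneg_right (by positivity)
        · rw [e]
          calc _ ≤ 2 ^ P.p * P.R (-t - 1) := hdiv _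
            _ ≤ 2 ^ P.p * P.R (|t| - 1) := by
                gcongr; exact P.R_mono (by linarith [neg_le_abs t])
            _ ≤ _ := le_add_of_nonneg_left (by positivity)
      refine (lb_mono fun x => hpt (u (lam • x))).trans ?_
      rw [lb_smul hlam0 1 (fun x => 2 ^ P.p * P.R (u x - 1 + l / 2) + 2 ^ P.p * P.R (|u x| - 1)),
        lb_add (fun x => by have := P.R_nonneg (u x - 1 + l / 2); positivity)
          (fun x => by have := P.R_nonneg (|u x| - 1); positivity) (by fun_prop),
        lb_const_mul (by positivity), lb_const_mul (by positivity), mul_one]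
      have g1 := (lb_mono_radius hlam1 _).trans hg
      have g2 := (lb_mono_radius (show lam ≤ 1 by linarith) _).trans
        (hX.trans (ENNReal.ofReal_le_ofReal e2))
      calc _ ≤ ENNReal.ofReal ((lam ^ P.n)⁻¹) * (ENNReal.ofReal (2 ^ P.p) *
            ENNReal.ofReal (η' / 2 / cX) + ENNReal.ofReal (2 ^ P.p) *
              ENNReal.ofReal (η' / 2 / cX)) := by gcongr
        _ = _ := by
          rw [← ENNReal.ofReal_mul (by positivity), ← ENNReal.ofReal_add (by positivity)
            (by positivity), ← ENNReal.ofReal_mul (by positivity)]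
          congr 1
          rw [hcX]
          field_simp; ring
    · have hpt : ∀ t : ℝ, max (|(t - (-θ)) / (1 - θ)| - 1) 0 ≤
          2 * (max (|t| - 1) 0 + 2 * θ) := by
        intro t
        have m0 : 0 ≤ max (|t| - 1) 0 := le_max_right _ _
        have m1 : |t| - 1 ≤ max (|t| - 1) 0 := le_max_left _ _
        refine max_le ?_ (by positivity)
        rcases abs_form t with e | e
        · rw [e, div_le_iff₀ h1θ]
          have := le_abs_self t
          nlinarith
        · rw [e, div_le_iff₀ h1θ]
          have := neg_le_abs t
          nlinarith
      have ht := tl_rescale_le (w := fun x => |u x| - 1) hθ0 hlam0 hX hη0.le hτ0.le hT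
      refine (tl_mono fun x => Real.rpow_le_rpow (le_max_right _ _) (hpt _) h1.le).trans
        (ht.trans (ENNReal.ofReal_le_ofReal ?_))
      have a1 : lam ^ (P.s * P.p) * (2 ^ (P.p - 1) * (lam ^ P.N)⁻¹ * P.A6 θ) * η ≤ τ / 3 := by
        rw [hcT] at e4; nlinarith
      have a2 : lam ^ (P.s * P.p) * 4 ^ (P.p - 1) * τ ≤ 1 / 3 * τ := by gcongr
      linarith
  refine ⟨η, hη0, fun u hu => ?_⟩
  rcases half_density u with h | h
  · exact ⟨-θ, by rw [abs_neg, abs_of_pos hθ0]; linarith, main u hu h⟩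
  · refine ⟨θ, by rw [abs_of_pos hθ0]; linarith, ?_⟩
    have := (main _ hu.neg h).neg
    convert this using 2 with x
    field_simp; ring

end Prm

namespace Prm

variable {P : Prm}

lemma iterate_osc {τ θ lam : ℝ} (hθ : 0 < θ) (hθ1 : θ ≤ 1 / 2)
    (H : ∀ η' : ℝ, 0 < η' → ∃ η : ℝ, 0 < η ∧ ∀ u : Rn P.n → ℝ, P.State τ η u →
      ∃ c : ℝ, |c| ≤ 1 ∧ P.State τ η' (fun x => (u (lam • x) - c) / (1 - θ))) (m : ℕ) :
    ∃ η : ℝ, 0 < η ∧ ∀ u : Rn P.n → ℝ, P.State τ η u → ∃ c : ℝ, |c| ≤ m ∧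
      P.State τ 1 (fun x => (u (lam ^ m • x) - c) / (1 - θ) ^ m) := by
  induction m with
  | zero => exact ⟨1, one_pos, fun u hu => ⟨0, by simp, by simpa using hu⟩⟩
  | succ m ih =>
    obtain ⟨η1, hη1, h1⟩ := ih
    obtain ⟨η, hη, h2⟩ := H η1 hη1
    refine ⟨η, hη, fun u hu => ?_⟩
    obtain ⟨c0, hc0, hs⟩ := h2 u hu
    obtain ⟨c, hc, hs⟩ := h1 _ hs
    refine ⟨c0 + (1 - θ) * c, ?_, ?_⟩
    · refine (abs_add_le _ _).trans ?_
      rw [abs_mul, abs_of_pos (by linarith : 0 < 1 - θ)]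
      push_cast
      nlinarith [abs_nonneg c]
    · convert hs using 2 with x
      have : (1 - θ) ≠ 0 := by linarith
      rw [smul_smul, ← pow_succ', pow_succ (1 - θ)]
      field_simp
      ring

lemma rpow_q_le (t : ℝ) : |t| ^ P.q ≤ 2 ^ P.q + 2 ^ P.q * 2 ^ (P.p - P.q) * P.R (|t| - 1) := by
  have hR := P.R_nonneg (|t| - 1)
  have hq := P.q_pos
  rcases le_total |t| 2 with h | h
  · have : |t| ^ P.q ≤ 2 ^ P.q := Real.rpow_le_rpow (abs_nonneg _) h hq.le
    exact this.trans (le_add_of_nonneg_right (by positivity))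
  · have h1 := P.rpow_le_R one_pos (show 1 ≤ |t| - 1 by linarith)
    norm_num at h1
    have h2 : |t| ^ P.q ≤ 2 ^ P.q * (|t| - 1) ^ P.q := by
      rw [← Real.mul_rpow (by norm_num) (by linarith)]
      exact Real.rpow_le_rpow (abs_nonneg _) (by linarith) hq.le
    have h3 : 2 ^ P.q * (|t| - 1) ^ P.q ≤ 2 ^ P.q * (2 ^ (P.p - P.q) * P.R (|t| - 1)) := by
      gcongr
    have : (0 : ℝ) ≤ 2 ^ P.q := by positivity
    linarith

lemma rpow_p1_le_tail (t : ℝ) :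
    |t| ^ (P.p - 1) ≤ 2 ^ (P.p - 1) + 2 ^ (P.p - 1) * max (|t| - 1) 0 ^ (P.p - 1) := by
  have h1 := P.p1_pos
  calc |t| ^ (P.p - 1) ≤ (1 + max (|t| - 1) 0) ^ (P.p - 1) := by
        gcongr
        linarith [le_max_left (|t| - 1) 0]
    _ ≤ 2 ^ (P.p - 1) * (1 ^ (P.p - 1) + max (|t| - 1) 0 ^ (P.p - 1)) :=
        add_rpow_le_two (by norm_num) (by positivity) h1.le
    _ = _ := by rw [Real.one_rpow]; ring

lemma rpow_p1_le_q (t : ℝ) : |t| ^ (P.p - 1) ≤ 1 + |t| ^ P.q := by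
  have h := Real.rpow_nonneg (abs_nonneg t) P.q
  rcases le_total |t| 1 with h1 | h1
  · linarith [Real.rpow_le_one (abs_nonneg t) h1 P.p1_pos.le]
  · linarith [Real.rpow_le_rpow_of_exponent_le h1 P.p1_le_q]

variable (P) in
/-- Bound for the tail at half scale in terms of normalized quantities. -/
def A7 : ℝ := ((1 / 2 : ℝ) ^ P.N)⁻¹ * (P.ω + 1) + 1

lemma A7_pos : 0 < P.A7 := by have := P.ω_pos; unfold A7; positivity

lemma tl_half {u : Rn P.n → ℝ} (hX : P.lb 1 (fun x => |u x| ^ P.q) ≤ 1)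
    (hT : P.tl 1 (fun x => |u x| ^ (P.p - 1)) ≤ 1) :
    P.tl (1 / 2) (fun x => |u x| ^ (P.p - 1)) ≤ ENNReal.ofReal P.A7 := by
  have hω := P.ω_pos
  refine (tl_split (by norm_num) _).trans ?_
  have : P.lb 1 (fun x => |u x| ^ (P.p - 1)) ≤ ENNReal.ofReal (P.ω + 1) := by
    refine (lb_mono fun x => rpow_p1_le_q (u x)).trans ?_
    rw [lb_add (fun _ => by norm_num) (fun x => by positivity) measurable_const,
      lb_const (by norm_num) (by norm_num), ENNReal.ofReal_add hω.le (by norm_num)]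
    gcongr
    · simp
    · simpa using hX
  rw [A7, ENNReal.ofReal_add (by positivity) (by norm_num), ENNReal.ofReal_mul (by positivity)]
  gcongr
  simpa using hT

/-- Decay of the oscillation of almost solutions at a small scale. -/
theorem key_decay (P : Prm) {ε : ℝ} (hε : 0 < ε) : ∃ σ δ C : ℝ, 0 < σ ∧ σ ≤ 1 / 2 ∧ 0 < δ ∧ 0 < C ∧
    ∀ u : Rn P.n → ℝ, P.InCls 0 1 δ u → P.lb 1 (fun x => |u x| ^ P.q) ≤ 1 →
      P.tl 1 (fun x => |u x| ^ (P.p - 1)) ≤ 1 →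
      ∃ c : ℝ, |c| ≤ C ∧ P.lb 1 (fun x => |u (σ • x) - c| ^ P.q) ≤ ENNReal.ofReal ε ∧
        P.tl 1 (fun x => |u (σ • x) - c| ^ (P.p - 1)) ≤ ENNReal.ofReal ε := by
  have hq := P.q_pos
  have hp := P.p_pos
  have h1 := P.p1_pos
  have hω := P.ω_pos
  have hC0 := P.C0_nonneg
  have hA7 := P.A7_pos
  obtain ⟨τ, θ, lam, hτ, hθ, hθ1, hlam, hlam1, H⟩ := P.exists_osc_decay
  obtain ⟨y0, hy0, hD⟩ := P.de_giorgi_local (T0 := 1) zero_le_one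
  have lim1 : Tendsto (fun A : ℝ => A ^ (-P.q)) atTop (𝓝 0) := tendsto_rpow_neg_atTop hq
  have lim2 : Tendsto (fun A : ℝ => A ^ (-(P.p - 1)) * P.A7) atTop (𝓝 0) := by
    simpa using (tendsto_rpow_neg_atTop h1).mul_const P.A7
  obtain ⟨A, hA1, hAy, hA7'⟩ := ((eventually_ge_atTop (1 : ℝ)).and
    ((lim1.eventually (ge_mem_nhds hy0)).and
      (lim2.eventually (ge_mem_nhds (lt_min hτ one_pos))))).exists
  have hA0 : 0 < A := by linarith
  set C4 : ℝ := 2 ^ P.q * P.ω + 2 ^ P.q * 2 ^ (P.p - P.q) with hC4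
  set C5 : ℝ := 2 ^ (P.p - 1) * P.C0 + 2 ^ (P.p - 1) * τ with hC5
  have h1θ : 0 < 1 - θ := by linarith
  have hlimm : Tendsto (fun m : ℕ => A * (1 - θ) ^ m) atTop (𝓝 0) := by
    simpa using (tendsto_pow_atTop_nhds_zero_of_lt_one h1θ.le (by linarith)).const_mul A
  have lim4 : Tendsto (fun t : ℝ => t ^ P.q * C4) (𝓝 0) (𝓝 0) := by
    have := ((Real.continuousAt_rpow_const 0 P.q (Or.inr hq.le)).mul_const C4).tendsto
    simpa [Real.zero_rpow hq.ne'] using this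
  have lim5 : Tendsto (fun t : ℝ => t ^ (P.p - 1) * C5) (𝓝 0) (𝓝 0) := by
    have := ((Real.continuousAt_rpow_const 0 (P.p - 1) (Or.inr h1.le)).mul_const C5).tendsto
    simpa [Real.zero_rpow h1.ne'] using this
  obtain ⟨m, hm4, hm5⟩ := (((lim4.comp hlimm).eventually (ge_mem_nhds hε)).and
    ((lim5.comp hlimm).eventually (ge_mem_nhds hε))).exists
  simp only [Function.comp] at hm4 hm5
  set b : ℝ := A * (1 - θ) ^ m with hb
  have hb0 : 0 < b := by positivity
  obtain ⟨η, hη, hI⟩ := iterate_osc hθ hθ1 H m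
  obtain ⟨δ1, hδ1, hD⟩ := hD (η / 2 / 2 ^ P.n) (by positivity)
  set cM : ℝ := A ^ (1 - P.p) * (1 / 2) ^ (P.s * P.p - P.n) with hcM
  have hcM0 : 0 < cM := by positivity
  refine ⟨lam ^ m * (1 / 2), min (δ1 * A ^ (P.p - 1)) (η / cM), A * (m + 1), by positivity, ?_,
    by positivity, by positivity, fun u hu hX hT => ?_⟩
  · have : lam ^ m ≤ 1 := pow_le_one₀ hlam.le (by linarith)
    linarith
  have hum := hu.1
  have hAp : A ^ (1 - P.p) * A ^ (P.p - 1) = 1 := by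
    rw [← Real.rpow_add hA0]; simp
  have hAn : A ^ (1 - P.p) = A ^ (-(P.p - 1)) := by congr 1; ring
  set v : Rn P.n → ℝ := fun x => u x / A with hv
  have hvm : Measurable v := by fun_prop
  have hvI : P.InCls 0 1 δ1 v := by
    have := hu.zoom (l := 1) (m := A) (r' := 1) one_pos hA0.ne' 0 (by norm_num)
    simp only [one_smul, zero_add, sub_zero, Real.one_rpow, mul_one, abs_of_pos hA0] at this
    refine this.mono le_rfl ?_
    calc _ ≤ A ^ (1 - P.p) * (δ1 * A ^ (P.p - 1)) := by gcongr; exact min_le_left _ _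
      _ = δ1 * (A ^ (1 - P.p) * A ^ (P.p - 1)) := by ring
      _ = δ1 := by rw [hAp, mul_one]
  have hwI : P.InCls 0 1 η (fun x => v ((1 / 2 : ℝ) • x)) := by
    have := hu.zoom (l := 1 / 2) (m := A) (r' := 1) (by norm_num) hA0.ne' 0 (by norm_num)
    simp only [zero_add, sub_zero, abs_of_pos hA0] at this
    refine this.mono le_rfl ?_
    calc _ ≤ cM * (η / cM) := by rw [← hcM]; gcongr; exact min_le_right _ _
      _ = η := by field_simp
  have hvX : P.lb 1 (fun x => |v x| ^ P.q) ≤ ENNReal.ofReal y0 := by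
    calc _ = P.lb 1 (fun x => A ^ (-P.q) * |u x| ^ P.q) := by
          congr 1; ext x
          rw [hv, abs_div, abs_of_pos hA0, Real.div_rpow (abs_nonneg _) hA0.le,
            Real.rpow_neg hA0.le, div_eq_inv_mul]
      _ ≤ ENNReal.ofReal (A ^ (-P.q)) * 1 := by rw [lb_const_mul (by positivity)]; gcongr
      _ ≤ _ := by rw [mul_one]; exact ENNReal.ofReal_le_ofReal hAy
  have hvT : P.tl (1 / 2) (fun x => |v x| ^ (P.p - 1)) ≤ ENNReal.ofReal (min τ 1) := by
    calc _ = P.tl (1 / 2) (fun x => A ^ (-(P.p - 1)) * |u x| ^ (P.p - 1)) := by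
          congr 1; ext x
          rw [hv, abs_div, abs_of_pos hA0, Real.div_rpow (abs_nonneg _) hA0.le,
            Real.rpow_neg hA0.le, div_eq_inv_mul]
      _ ≤ ENNReal.ofReal (A ^ (-(P.p - 1))) * ENNReal.ofReal P.A7 := by
          rw [tl_const_mul (by positivity)]; gcongr; exact tl_half hX hT
      _ ≤ _ := by
          rw [← ENNReal.ofReal_mul (by positivity)]
          exact ENNReal.ofReal_le_ofReal hA7'
  have sideR : ∀ w : Rn P.n → ℝ, (∀ x, |w x| = |v x|) → P.InCls 0 1 δ1 w →
      P.lb (1 / 2) (fun x => P.R (w x - 1 / 2)) ≤ ENNReal.ofReal (η / 2 / 2 ^ P.n) := by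
    intro w hw hwI
    refine hD w hwI ?_ ?_
    · refine (tl_mono fun x => ?_).trans (hvT.trans (ENNReal.ofReal_le_ofReal (min_le_right _ _)))
      rw [← hw]
      exact Real.rpow_le_rpow (le_max_right _ _) (max_le (le_abs_self _) (abs_nonneg _)) h1.le
    · refine (lb_mono fun x => ?_).trans hvX
      rw [← hw]
      exact (P.R_mono (le_abs_self _)).trans (P.R_le_rpow (abs_nonneg _))
  have hS : P.State τ η (fun x => v ((1 / 2 : ℝ) • x)) := by
    refine ⟨hwI, ?_, ?_⟩
    · rw [lb_smul (by norm_num) 1 (fun x => P.R (|v x| - 1)), mul_one, one_div, inv_pow, inv_inv,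
        ← one_div]
      have hpt : ∀ x, P.R (|v x| - 1) ≤ P.R (v x - 1 / 2) + P.R (-v x - 1 / 2) := fun x => by
        have r1 := P.R_nonneg (v x - 1 / 2)
        have r2 := P.R_nonneg (-v x - 1 / 2)
        rcases abs_cases (v x) with ⟨e, -⟩ | ⟨e, -⟩
        · have := P.R_mono (show |v x| - 1 ≤ v x - 1 / 2 by rw [e]; linarith)
          linarith
        · have := P.R_mono (show |v x| - 1 ≤ -v x - 1 / 2 by rw [e]; linarith)
          linarith
      calc _ ≤ ENNReal.ofReal (2 ^ P.n) * (ENNReal.ofReal (η / 2 / 2 ^ P.n) +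
            ENNReal.ofReal (η / 2 / 2 ^ P.n)) := by
            gcongr
            refine (lb_mono hpt).trans ?_
            rw [lb_add (fun x => P.R_nonneg _) (fun x => P.R_nonneg _) (by fun_prop)]
            exact add_le_add (sideR v (fun _ => rfl) hvI) (sideR _ (fun _ => abs_neg _) hvI.neg)
        _ = _ := by
            rw [← ENNReal.ofReal_add (by positivity) (by positivity),
              ← ENNReal.ofReal_mul (by positivity)]
            congr 1; field_simp; ring
    · rw [tl_smul (by norm_num) 1 (fun x => max (|v x| - 1) 0 ^ (P.p - 1)), mul_one]
      have hsm : ENNReal.ofReal ((1 / 2 : ℝ) ^ (P.s * P.p)) ≤ 1 := by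
        rw [ENNReal.ofReal_le_one]
        exact Real.rpow_le_one (by norm_num) (by norm_num) P.sp_pos.le
      refine (mul_le_mul' hsm (tl_mono fun x => ?_)).trans (le_of_eq_of_le (one_mul _)
        (hvT.trans (ENNReal.ofReal_le_ofReal (min_le_left _ _))))
      exact Real.rpow_le_rpow (le_max_right _ _) (max_le (by linarith) (abs_nonneg _)) h1.le
  obtain ⟨c, hc, -, hzX, hzT⟩ := hI _ hS
  set z : Rn P.n → ℝ := fun x => (v ((1 / 2 : ℝ) • lam ^ m • x) - c) / (1 - θ) ^ m with hz
  have hzm : Measurable z := by fun_prop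
  have huz : ∀ x, |u ((lam ^ m * (1 / 2)) • x) - A * c| = b * |z x| := fun x => by
    rw [show b * |z x| = |b * z x| by rw [abs_mul, abs_of_pos hb0]]
    congr 1
    rw [hz, hb, hv]
    simp only
    rw [smul_smul, mul_comm (1 / 2) (lam ^ m)]
    have : (1 - θ) ^ m ≠ 0 := by positivity
    field_simp
  refine ⟨A * c, ?_, ?_, ?_⟩
  · rw [abs_mul, abs_of_pos hA0]
    gcongr; linarith
  · have hX4 : P.lb 1 (fun x => |z x| ^ P.q) ≤ ENNReal.ofReal C4 := by
      refine (lb_mono fun x => rpow_q_le (z x)).trans ?_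
      rw [lb_add (fun _ => by positivity) (fun x => by have := P.R_nonneg (|z x| - 1); positivity)
        measurable_const, lb_const (by norm_num) (by positivity), lb_const_mul (by positivity), hC4,
        ENNReal.ofReal_add (by positivity) (by positivity), one_pow, one_mul]
      gcongr
      refine (mul_le_mul_right hzX _).trans ?_
      simp
    calc _ = P.lb 1 (fun x => b ^ P.q * |z x| ^ P.q) := by
          congr 1; ext x
          rw [huz, Real.mul_rpow hb0.le (abs_nonneg _)]
      _ ≤ ENNReal.ofReal (b ^ P.q) * ENNReal.ofReal C4 := by
          rw [lb_const_mul (by positivity)]; gcongr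
      _ ≤ _ := by
          rw [← ENNReal.ofReal_mul (by positivity)]
          exact ENNReal.ofReal_le_ofReal hm4
  · have hT5 : P.tl 1 (fun x => |z x| ^ (P.p - 1)) ≤ ENNReal.ofReal C5 := by
      refine (tl_mono fun x => rpow_p1_le_tail (z x)).trans ?_
      rw [tl_add (fun _ => by positivity) (fun x => by positivity) measurable_const,
        tl_const_mul (by positivity), hC5, ENNReal.ofReal_add (by positivity) (by positivity),
        ENNReal.ofReal_mul (q := τ) (by positivity)]
      gcongr
      simpa using tl_const (P := P) one_pos (show (0 : ℝ) ≤ 2 ^ (P.p - 1) by positivity)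
    calc _ = P.tl 1 (fun x => b ^ (P.p - 1) * |z x| ^ (P.p - 1)) := by
          congr 1; ext x
          rw [huz, Real.mul_rpow hb0.le (abs_nonneg _)]
      _ ≤ ENNReal.ofReal (b ^ (P.p - 1)) * ENNReal.ofReal C5 := by
          rw [tl_const_mul (by positivity)]; gcongr
      _ ≤ _ := by
          rw [← ENNReal.ofReal_mul (by positivity)]
          exact ENNReal.ofReal_le_ofReal hm5

end Prm

section Mollification

variable {n : ℕ}

lemma measurePreserving_add_diag (z : Rn n) :
    MeasurePreserving (fun w : Rn n × Rn n => w + (z, z)) volume volume :=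
  (measurePreserving_add_right (volume : Measure (Rn n)) z).prod
    (measurePreserving_add_right (volume : Measure (Rn n)) z)

lemma continuous_translation_pairing {a b : ℝ≥0∞} [ENNReal.HolderConjugate a b]
    [Fact (1 ≤ a)] [Fact (1 ≤ b)] (hb : b ≠ ∞) {A B : Rn n × Rn n → ℝ}
    (hA : MemLp A a) (hB : MemLp B b) :
    Continuous fun z : Rn n => ∫ w, A w * B (w + (z, z)) := by
  let f : Rn n → C(Rn n × Rn n, Rn n × Rn n) := fun z => ⟨fun w => w + (z, z), by fun_prop⟩
  have hf : Continuous f := ContinuousMap.continuous_of_continuous_uncurry _ (by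
    change Continuous fun q : Rn n × (Rn n × Rn n) => q.2 + (q.1, q.1)
    fun_prop)
  have hc : Continuous fun z => Lp.compMeasurePreserving (f z) (measurePreserving_add_diag z)
      hB.toLp :=
    continuous_const.compMeasurePreservingLp hf measurePreserving_add_diag hb
  have h2 := ((ContinuousLinearMap.mul ℝ ℝ).lpPairing (volume : Measure (Rn n × Rn n)) a b
    hA.toLp).continuous.comp hc
  refine h2.congr fun z => ?_
  simp only [Function.comp_apply]
  rw [ContinuousLinearMap.lpPairing_eq_integral]
  refine integral_congr_ae ?_
  rw [Lp.toLp_compMeasurePreserving]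
  filter_upwards [hA.coeFn_toLp, (hB.comp_measurePreserving
    (measurePreserving_add_diag z)).coeFn_toLp] with w h3 h4
  simp only [ContinuousLinearMap.mul_apply']
  rw [h3]
  congr 1

lemma integrable_mollified_pairing {a b : ℝ≥0∞} [ENNReal.HolderConjugate a b]
    [Fact (1 ≤ a)] [Fact (1 ≤ b)] (hb : b ≠ ∞) {A B : Rn n × Rn n → ℝ}
    (hAm : Measurable A) (hBm : Measurable B)
    (hA : MemLp A a) (hB : MemLp B b) {ρ : Rn n → ℝ} (hρ : Continuous ρ)
    (hρc : HasCompactSupport ρ) :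
    Integrable (fun w => A w * ∫ z, ρ z * B (w - (z, z))) ∧
      ∫ w, A w * ∫ z, ρ z * B (w - (z, z)) = ∫ z, ρ z * ∫ w, A w * B (w + (-z, -z)) := by
  set F : (Rn n × Rn n) × Rn n → ℝ := fun q => A q.1 * (ρ q.2 * B (q.1 - (q.2, q.2))) with hF
  have hFi : Integrable F := by
    have hFm : AEStronglyMeasurable F := by
      refine Measurable.aestronglyMeasurable ?_
      have := hρ.measurable
      fun_prop
    refine (integrable_prod_iff' hFm).2 ⟨Eventually.of_forall fun z => ?_, ?_⟩
    · have h1 : MemLp (fun w => B (w - (z, z))) b := by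
        have := hB.comp_measurePreserving (measurePreserving_add_diag (-z))
        refine this.ae_eq (Eventually.of_forall fun w => ?_)
        simp only [Function.comp_apply]
        congr 1
      have h2 := (hA.integrable_mul h1).const_mul (ρ z)
      refine h2.congr (Eventually.of_forall fun w => ?_)
      simp only [hF, Pi.mul_apply]; ring
    · have hc := continuous_translation_pairing hb hA.norm hB.norm
      have hc2 : Continuous fun z : Rn n => ‖ρ z‖ * ∫ w, ‖A w‖ * ‖B (w + (-z, -z))‖ :=
        hρ.norm.mul (hc.comp continuous_neg)
      refine (hc2.integrable_of_hasCompactSupport (hρc.norm.mul_right)).congr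
        (Eventually.of_forall fun z => ?_)
      simp only [hF]
      rw [← integral_const_mul]
      congr 1; ext w
      have : w + (-z, -z) = w - (z, z) := by rw [sub_eq_add_neg]; rfl
      rw [norm_mul, norm_mul, this]; ring
  have h1 : (fun w => A w * ∫ z, ρ z * B (w - (z, z))) = fun w => ∫ z, F (w, z) := by
    ext w
    rw [← integral_const_mul]
  rw [h1]
  refine ⟨hFi.integral_prod_left, ?_⟩
  rw [integral_integral_swap hFi]
  congr 1; ext z
  rw [← integral_const_mul]
  congr 1; ext w
  have : w + (-z, -z) = w - (z, z) := by rw [sub_eq_add_neg]; rfl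
  simp only [hF, this]; ring

end Mollification

namespace Prm

variable (P : Prm)

lemma exists_coefficient {Λ : ℝ} {Φ : ℝ → ℝ} {K : Rn P.n → Rn P.n → ℝ} (hΛ : 1 ≤ Λ)
    (hL : Λ ^ 2 ≤ P.L) (hK : KernelBounds P.n Λ P.s P.p K) (hΦ : PhiBounds Λ P.p Φ)
    (u : Rn P.n → ℝ) :
    ∃ k : Rn P.n → Rn P.n → ℝ, (∀ x y, P.L⁻¹ ≤ k x y ∧ k x y ≤ P.L) ∧
      ∀ x y, Φ (u x - u y) * K x y = k x y * P.J (u x - u y) * P.ker (x - y) := by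
  have key : ∀ x y, ∃ k, (P.L⁻¹ ≤ k ∧ k ≤ P.L) ∧
      Φ (u x - u y) * K x y = k * P.J (u x - u y) * P.ker (x - y) := fun x y => by
    have hΛ0 : 0 < Λ := by linarith
    rcases eq_or_ne (u x - u y) 0 with h | h
    · refine ⟨1, ⟨inv_le_one_of_one_le₀ P.hL, P.hL⟩, ?_⟩
      rw [h, hΦ.2.1]
      simp [J]
    · have hxy : x ≠ y := fun e => h (by rw [e, sub_self])
      obtain ⟨hK1, hK2⟩ := hK.2 x y hxy
      obtain ⟨hΦ1, hΦ2⟩ := hΦ.2.2 (u x - u y)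
      set a := u x - u y with ha
      have hnorm : 0 < ‖x - y‖ := norm_pos_iff.2 (sub_ne_zero.2 hxy)
      set b := ‖x - y‖ ^ ((P.n : ℝ) + P.s * P.p) with hb
      have hb0 : 0 < b := by positivity
      have hker : P.ker (x - y) = b⁻¹ := rfl
      have hap : 0 < |a| ^ P.p := by positivity
      have hJa : P.J a * a = |a| ^ P.p := by
        have h1 : |P.J a * a| = |a| ^ P.p := by
          rw [abs_mul, P.abs_J, ← Real.rpow_add_one (abs_ne_zero.2 h), sub_add_cancel]
        have h2 : 0 ≤ P.J a * a := by
          unfold J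
          rcases lt_or_gt_of_ne h with h' | h'
          · rw [sign_neg h', SignType.coe_neg_one]
            have : 0 ≤ |a| ^ (P.p - 1) := by positivity
            nlinarith
          · rw [sign_pos h', SignType.coe_one]
            positivity
        rw [← h1, abs_of_nonneg h2]
      refine ⟨(Φ a * a / |a| ^ P.p) * (K x y * b), ⟨?_, ?_⟩, ?_⟩
      · have e1 : Λ⁻¹ ≤ Φ a * a / |a| ^ P.p := by
          rw [le_div_iff₀ hap]; linarith [hΦ1, div_eq_inv_mul (|a| ^ P.p) Λ]
        have e2 : Λ⁻¹ ≤ K x y * b := by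
          rw [← div_le_iff₀ hb0]
          refine le_trans (le_of_eq ?_) hK1
          field_simp
        calc P.L⁻¹ ≤ (Λ ^ 2)⁻¹ := by gcongr
          _ = Λ⁻¹ * Λ⁻¹ := by field_simp
          _ ≤ _ := by gcongr; exact (inv_nonneg.2 hΛ0.le).trans e1
      · have e1 : Φ a * a / |a| ^ P.p ≤ Λ := by
          rwa [div_le_iff₀ hap]
        have e2 : K x y * b ≤ Λ := by
          rwa [← le_div_iff₀ hb0]
        have e3 : 0 ≤ K x y * b :=
          mul_nonneg (le_trans (by positivity) hK1) hb0.le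
        calc _ ≤ Λ * Λ := by gcongr
          _ ≤ P.L := by linarith [sq Λ]
      · rw [hker, ← hJa]
        have hJ0 : P.J a ≠ 0 := fun e => by rw [e, zero_mul] at hJa; exact hap.ne hJa
        field_simp
  choose k hk using key
  exact ⟨k, fun x y => (hk x y).1, fun x y => (hk x y).2⟩

lemma integrable_seminorm_of_memWsp {u v : Rn P.n → ℝ} (hu : Measurable u) (huv : v =ᵐ[volume] u)
    (hv : memWsp P.n P.s P.p univ v) :
    Integrable fun w : Rn P.n × Rn P.n => |u w.1 - u w.2| ^ P.p * P.ker (w.1 - w.2) := by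
  have hm : Measurable fun w : Rn P.n × Rn P.n =>
      |u w.1 - u w.2| ^ P.p * P.ker (w.1 - w.2) := by fun_prop
  refine ⟨hm.aestronglyMeasurable, ?_⟩
  rw [hasFiniteIntegral_iff_ofReal (Eventually.of_forall fun w => by
    have := P.ker_nonneg (w.1 - w.2); positivity)]
  refine lt_of_eq_of_lt ?_ hv.2.2
  rw [gagliardo, Measure.volume_eq_prod, lintegral_prod _ (by fun_prop)]
  simp only [Measure.restrict_univ]
  refine lintegral_congr_ae (huv.mono fun x hx => lintegral_congr_ae (huv.mono fun y hy => ?_))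
  simp only [hx, hy, div_eq_mul_inv]
  rfl

lemma integrable_cutoff_seminorm {ζ : Rn P.n → ℝ} {C : ℝ≥0} (hζ : LipschitzWith C ζ)
    (h01 : ∀ x, 0 ≤ ζ x ∧ ζ x ≤ 1) {x0 : Rn P.n} {ρ : ℝ} (hs : ∀ x, x ∉ closedBall x0 ρ → ζ x = 0) :
    Integrable fun w : Rn P.n × Rn P.n => |ζ w.1 - ζ w.2| ^ P.p * P.ker (w.1 - w.2) := by
  have hζm := hζ.continuous.measurable
  have hm : Measurable fun w : Rn P.n × Rn P.n =>
      |ζ w.1 - ζ w.2| ^ P.p * P.ker (w.1 - w.2) := by fun_prop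
  refine ⟨hm.aestronglyMeasurable, ?_⟩
  rw [hasFiniteIntegral_iff_ofReal (Eventually.of_forall fun w => by
    have := P.ker_nonneg (w.1 - w.2); positivity)]
  set l : ℝ := max 1 C with hl
  have hcut := P.lint_cutoff_ker (η := ζ) (l := l) (le_max_left _ _) (fun x => (h01 x).1)
    (fun x => (h01 x).2) (fun x y => by
      have := hζ.dist_le_mul x y
      rw [Real.dist_eq, dist_eq_norm] at this
      exact this.trans (by gcongr; exact le_max_right _ _))
  set S := closedBall x0 ρ with hS
  have hSm : MeasurableSet S := measurableSet_closedBall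
  set F : Rn P.n × Rn P.n → ℝ≥0∞ := fun w =>
    ENNReal.ofReal (|ζ w.1 - ζ w.2| ^ P.p * P.ker (w.1 - w.2)) with hF
  have hFm : Measurable F := by fun_prop
  have hpt : ∀ w, F w ≤ (S ×ˢ univ).indicator F w + (univ ×ˢ S).indicator F w := fun w => by
    by_cases h1 : w.1 ∈ S
    · have : (S ×ˢ (univ : Set (Rn P.n))).indicator F w = F w :=
        indicator_of_mem (by simp [h1]) _
      rw [this]; exact le_self_add
    · by_cases h2 : w.2 ∈ S
      · have : ((univ : Set (Rn P.n)) ×ˢ S).indicator F w = F w :=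
          indicator_of_mem (by simp [h2]) _
        rw [this]; exact le_add_self
      · simp [hF, hs _ h1, hs _ h2, Real.zero_rpow P.p_pos.ne']
  have hfin : ENNReal.ofReal (l ^ P.p * P.C0) * volume S < ⊤ :=
    ENNReal.mul_lt_top ENNReal.ofReal_lt_top measure_closedBall_lt_top
  calc ∫⁻ w, F w ≤ ∫⁻ w, (S ×ˢ univ).indicator F w + (univ ×ˢ S).indicator F w :=
        lintegral_mono hpt
    _ = (∫⁻ w in S ×ˢ univ, F w) + ∫⁻ w in univ ×ˢ S, F w := by
        rw [lintegral_add_left (hFm.indicator (hSm.prod .univ)),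
          lintegral_indicator (hSm.prod .univ), lintegral_indicator (MeasurableSet.univ.prod hSm)]
    _ ≤ ENNReal.ofReal (l ^ P.p * P.C0) * volume S + ENNReal.ofReal (l ^ P.p * P.C0) * volume S := by
        rw [Measure.volume_eq_prod]
        gcongr
        · rw [← Measure.prod_restrict, lintegral_prod _ (by fun_prop), Measure.restrict_univ]
          refine (lintegral_mono fun x => hcut x).trans ?_
          simp
        · rw [← Measure.prod_restrict, lintegral_prod_symm _ (by fun_prop), Measure.restrict_univ]
          refine (lintegral_mono fun y => ?_).trans (b := ∫⁻ y in S, ENNReal.ofReal (l ^ P.p * P.C0)) ?_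
          · refine le_trans (le_of_eq ?_) (hcut y)
            congr 1; ext x
            simp only [hF]
            rw [abs_sub_comm, ker_sub_comm]
          · simp
    _ < ⊤ := ENNReal.add_lt_top.2 ⟨hfin, hfin⟩

end Prm

namespace Prm

variable (P : Prm)

lemma integrable_test_seminorm {u : Rn P.n → ℝ} (hu : Measurable u)
    (hui : Integrable fun w : Rn P.n × Rn P.n => |u w.1 - u w.2| ^ P.p * P.ker (w.1 - w.2))
    {G : ℝ → ℝ} {CG : ℝ≥0} {B : ℝ} (hG : LipschitzWith CG G) (hB : ∀ t, |G t| ≤ B)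
    {ζ : Rn P.n → ℝ} {C : ℝ≥0} (hζ : LipschitzWith C ζ)
    (h01 : ∀ x, 0 ≤ ζ x ∧ ζ x ≤ 1) {x0 : Rn P.n} {ρ : ℝ} (hs : ∀ x, x ∉ closedBall x0 ρ → ζ x = 0) :
    Integrable fun w : Rn P.n × Rn P.n =>
      |G (u w.1) * ζ w.1 - G (u w.2) * ζ w.2| ^ P.p * P.ker (w.1 - w.2) := by
  have hζm := hζ.continuous.measurable
  have hGm := hG.continuous.measurable
  have hp := P.p_pos
  have hB0 : 0 ≤ B := (abs_nonneg _).trans (hB 0)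
  have hint := ((hui.const_mul ((CG : ℝ) ^ P.p)).add
    ((P.integrable_cutoff_seminorm hζ h01 hs).const_mul (B ^ P.p))).const_mul (2 ^ P.p)
  refine hint.mono' (by fun_prop) (Eventually.of_forall fun w => ?_)
  have hk := P.ker_nonneg (w.1 - w.2)
  rw [Real.norm_of_nonneg (by positivity)]
  simp only [Pi.add_apply]
  have h1 : |G (u w.1) * ζ w.1 - G (u w.2) * ζ w.2| ≤
      CG * |u w.1 - u w.2| + B * |ζ w.1 - ζ w.2| := by
    have e : G (u w.1) * ζ w.1 - G (u w.2) * ζ w.2 =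
        (G (u w.1) - G (u w.2)) * ζ w.1 + G (u w.2) * (ζ w.1 - ζ w.2) := by ring
    rw [e]
    refine (abs_add_le _ _).trans ?_
    rw [abs_mul, abs_mul]
    have h2 : |G (u w.1) - G (u w.2)| ≤ CG * |u w.1 - u w.2| := by
      simpa [Real.dist_eq] using hG.dist_le_mul (u w.1) (u w.2)
    have h3 : |ζ w.1| ≤ 1 := by rw [abs_of_nonneg (h01 _).1]; exact (h01 _).2
    refine add_le_add ?_ (mul_le_mul_of_nonneg_right (hB _) (abs_nonneg _))
    exact (mul_le_mul_of_nonneg_left h3 (abs_nonneg _)).trans (by rw [mul_one]; exact h2)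
  calc _ ≤ (CG * |u w.1 - u w.2| + B * |ζ w.1 - ζ w.2|) ^ P.p * P.ker (w.1 - w.2) := by gcongr
    _ ≤ (2 ^ P.p * ((CG * |u w.1 - u w.2|) ^ P.p + (B * |ζ w.1 - ζ w.2|) ^ P.p)) *
        P.ker (w.1 - w.2) := by
        gcongr
        exact add_rpow_le_two (by positivity) (by positivity) hp.le
    _ = _ := by
        rw [Real.mul_rpow (by positivity) (by positivity), Real.mul_rpow (by positivity)
          (by positivity)]
        ring

lemma memLp_flux {u : Rn P.n → ℝ} 
    (hui : Integrable fun w : Rn P.n × Rn P.n => |u w.1 - u w.2| ^ P.p * P.ker (w.1 - w.2))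
    {k : Rn P.n → Rn P.n → ℝ} (hk : ∀ x y, P.L⁻¹ ≤ k x y ∧ k x y ≤ P.L)
    {A : Rn P.n × Rn P.n → ℝ} (hAm : Measurable A)
    (hA : ∀ w, A w = k w.1 w.2 * P.J (u w.1 - u w.2) * P.ker (w.1 - w.2) *
      ‖w.1 - w.2‖ ^ (P.N / P.p)) :
    MemLp A (ENNReal.ofReal (P.p / (P.p - 1))) := by
  have hp := P.p_pos
  have h1 := P.p1_pos
  have hq : 0 < P.p / (P.p - 1) := by positivity
  rw [← integrable_norm_rpow_iff hAm.aestronglyMeasurable (by simpa using hq)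
    ENNReal.ofReal_ne_top, ENNReal.toReal_ofReal hq.le]
  refine (hui.const_mul (P.L ^ (P.p / (P.p - 1)))).mono'
    (hAm.norm.pow_const _).aestronglyMeasurable (Eventually.of_forall fun w => ?_)
  rw [Real.norm_of_nonneg (by positivity)]
  rcases eq_or_ne (w.1 - w.2) 0 with h | h
  · rw [hA, h, norm_zero, Real.zero_rpow (by have := P.N_pos; positivity), mul_zero, norm_zero,
      Real.zero_rpow hq.ne']
    have := P.ker_nonneg 0
    have := P.L_pos
    positivity
  · have hn : 0 < ‖w.1 - w.2‖ := norm_pos_iff.2 h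
    have hker : P.ker (w.1 - w.2) = ‖w.1 - w.2‖ ^ (-P.N) := by
      rw [ker, Real.rpow_neg hn.le]
    have hk0 : |k w.1 w.2| ≤ P.L := by
      rw [abs_of_nonneg ((inv_nonneg.2 P.L_pos.le).trans (hk _ _).1)]
      exact (hk _ _).2
    have e : ‖A w‖ = |k w.1 w.2| * (|u w.1 - u w.2| ^ (P.p - 1) *
        ‖w.1 - w.2‖ ^ (-P.N + P.N / P.p)) := by
      rw [hA, hker, Real.norm_eq_abs, mul_assoc, ← Real.rpow_add hn, abs_mul, abs_mul, P.abs_J,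
        abs_of_nonneg (by positivity : 0 ≤ ‖w.1 - w.2‖ ^ (-P.N + P.N / P.p)), mul_assoc]
    rw [e, Real.mul_rpow (abs_nonneg _) (by positivity), Real.mul_rpow (by positivity)
      (by positivity), ← Real.rpow_mul (abs_nonneg _), ← Real.rpow_mul hn.le]
    have e1 : (P.p - 1) * (P.p / (P.p - 1)) = P.p := by field_simp
    have e2 : (-P.N + P.N / P.p) * (P.p / (P.p - 1)) = -P.N := by field_simp; ring
    rw [e1, e2, hker]
    gcongr

end Prm

lemma isTestFun_mollified {n : ℕ} {Ω : Set (Rn n)} {x0 : Rn n} {r ρ : ℝ} (hΩ : ball x0 r ⊆ Ω)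
    {φ : Rn n → ℝ} (hφl : LocallyIntegrable φ) (hs : ∀ x, x ∉ closedBall x0 ρ → φ x = 0)
    (f : ContDiffBump (0 : Rn n)) (hf : ρ + f.rOut < r) :
    IsTestFun n Ω (fun x => ∫ z, f.normed volume z * φ (x - z)) ∧
      ∀ x, x ∉ ball x0 r → ∫ z, f.normed volume z * φ (x - z) = 0 := by
  have hz : ∀ x, x ∉ closedBall x0 (ρ + f.rOut) → ∫ z, f.normed volume z * φ (x - z) = 0 :=
    fun x hx => by
      refine integral_eq_zero_of_ae (Eventually.of_forall fun z => ?_)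
      simp only [Pi.zero_apply, mul_eq_zero]
      by_cases h : z ∈ ball (0 : Rn n) f.rOut
      · right
        refine hs _ fun h2 => hx ?_
        rw [mem_closedBall, dist_eq_norm] at h2 ⊢
        rw [mem_ball, dist_zero_right] at h
        calc ‖x - x0‖ = ‖(x - z - x0) + z‖ := by congr 1; abel
          _ ≤ _ := (norm_add_le _ _).trans (add_le_add h2 h.le)
      · left
        rw [← f.support_normed_eq (μ := volume)] at h
        simpa using h
  have hts : tsupport (fun x => ∫ z, f.normed volume z * φ (x - z)) ⊆
      closedBall x0 (ρ + f.rOut) :=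
    closure_minimal (fun x hx => by_contra fun h => hx (hz x h)) isClosed_closedBall
  refine ⟨⟨?_, ?_, ?_⟩, fun x hx => hz x fun h => hx (closedBall_subset_ball hf h)⟩
  · exact HasCompactSupport.contDiff_convolution_left (ContinuousLinearMap.lsmul ℝ ℝ)
      (n := ⊤) (μ := (volume : Measure (Rn n))) (f.hasCompactSupport_normed (μ := volume))
      (f.contDiff_normed (μ := volume)) hφl
  · exact (isCompact_closedBall _ _).of_isClosed_subset (isClosed_tsupport _) hts
  · exact hts.trans ((closedBall_subset_ball hf).trans hΩ)

namespace Prm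

variable (P : Prm)

lemma exists_inCls_of_weakSol {Λ : ℝ} {Φ : ℝ → ℝ} {K : Rn P.n → Rn P.n → ℝ} (hΛ : 1 ≤ Λ)
    (hL : Λ ^ 2 ≤ P.L) (hK : KernelBounds P.n Λ P.s P.p K) (hΦ : PhiBounds Λ P.p Φ)
    {Ω : Set (Rn P.n)} {f gb v : Rn P.n → ℝ} (hv : WeakSol P.n Φ K P.s P.p Ω f gb v) :
    ∃ u, Measurable u ∧ v =ᵐ[volume] u ∧ ∀ (x0 : Rn P.n) (r M : ℝ), ball x0 r ⊆ Ω → 0 ≤ M → 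
      ∫⁻ x in ball x0 r, ENNReal.ofReal |f x| ≤ ENNReal.ofReal M → P.InCls x0 r M u := by
  obtain ⟨hW, -, hweak⟩ := hv
  have hvm : AEMeasurable v := by simpa using hW.1
  obtain ⟨u, hu, huv⟩ : ∃ u, Measurable u ∧ v =ᵐ[volume] u := ⟨hvm.mk v, hvm.measurable_mk, hvm.ae_eq_mk⟩
  refine ⟨u, hu, huv, fun x0 r M hball hM0 hM => ?_⟩
  obtain ⟨k, hk, hkeq⟩ := P.exists_coefficient hΛ hL hK hΦ u
  refine ⟨hu, k, hk, fun G B ζ ⟨CG, hG⟩ hB ⟨Cζ, hζ⟩ h01 ⟨ρ, hρ, hs⟩ => ?_⟩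
  have hp := P.p_pos
  have h1 := P.p1_pos
  have hB0 : 0 ≤ B := (abs_nonneg _).trans (hB 0)
  have hui := P.integrable_seminorm_of_memWsp hu huv hW
  have hζm := hζ.continuous.measurable
  have hGm := hG.continuous.measurable
  have hKm : Measurable fun w : Rn P.n × Rn P.n => K w.1 w.2 := hK.1
  have hΦm := hΦ.1.measurable
  set φ : Rn P.n → ℝ := fun x => G (u x) * ζ x with hφ
  have hφm : Measurable φ := by fun_prop
  have hφB : ∀ x, |φ x| ≤ B := fun x => by
    rw [hφ, abs_mul, abs_of_nonneg (h01 x).1]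
    calc _ ≤ B * 1 := mul_le_mul (hB _) (h01 x).2 (h01 x).1 hB0
      _ = B := mul_one B
  have hφs : ∀ x, x ∉ closedBall x0 ρ → φ x = 0 := fun x hx => by simp [hφ, hs x hx]
  have hφl : LocallyIntegrable φ := by
    refine (locallyIntegrable_const B).mono hφm.aestronglyMeasurable
      (Eventually.of_forall fun x => ?_)
    rw [Real.norm_eq_abs, Real.norm_of_nonneg hB0]; exact hφB x
  set A : Rn P.n × Rn P.n → ℝ := fun w =>
    Φ (u w.1 - u w.2) * K w.1 w.2 * ‖w.1 - w.2‖ ^ (P.N / P.p) with hA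
  have hNp : 0 < P.N / P.p := by have := P.N_pos; positivity
  have hAm : Measurable A := by
    have : Measurable fun w : Rn P.n × Rn P.n => ‖w.1 - w.2‖ ^ (P.N / P.p) :=
      (by fun_prop : Measurable fun w : Rn P.n × Rn P.n => ‖w.1 - w.2‖).pow_const _
    fun_prop
  have hAL := P.memLp_flux hui hk hAm (fun w => by rw [hA, ← hkeq])
  set D : (Rn P.n → ℝ) → Rn P.n × Rn P.n → ℝ := fun ψ w =>
    (ψ w.1 - ψ w.2) * ‖w.1 - w.2‖ ^ (-(P.N / P.p)) with hD
  have hDm : Measurable (D φ) := by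
    have : Measurable fun w : Rn P.n × Rn P.n => ‖w.1 - w.2‖ ^ (-(P.N / P.p)) :=
      (by fun_prop : Measurable fun w : Rn P.n × Rn P.n => ‖w.1 - w.2‖).pow_const _
    fun_prop
  have hDL : MemLp (D φ) (ENNReal.ofReal P.p) := by
    rw [← integrable_norm_rpow_iff hDm.aestronglyMeasurable (by simpa using hp)
      ENNReal.ofReal_ne_top, ENNReal.toReal_ofReal hp.le]
    refine (P.integrable_test_seminorm hu hui hG hB hζ h01 hs).mono'
      (hDm.norm.pow_const _).aestronglyMeasurable (Eventually.of_forall fun w => ?_)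
    rw [Real.norm_of_nonneg (by positivity), hD, Real.norm_eq_abs, abs_mul,
      abs_of_nonneg (by positivity : 0 ≤ ‖w.1 - w.2‖ ^ (-(P.N / P.p))),
      Real.mul_rpow (abs_nonneg _) (by positivity), ← Real.rpow_mul (norm_nonneg _),
      neg_mul, div_mul_cancel₀ _ hp.ne', Real.rpow_neg (norm_nonneg _)]
    rfl
  have hAD : ∀ (ψ : Rn P.n → ℝ) w, A w * D ψ w =
      Φ (u w.1 - u w.2) * (ψ w.1 - ψ w.2) * K w.1 w.2 := fun ψ w => by
    rcases eq_or_ne (w.1 - w.2) 0 with h | h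
    · have : w.1 = w.2 := sub_eq_zero.1 h
      simp [hD, this]
    · have hn : 0 < ‖w.1 - w.2‖ := norm_pos_iff.2 h
      have : ‖w.1 - w.2‖ ^ (P.N / P.p) ≠ 0 := by positivity
      simp only [hA, hD]
      rw [Real.rpow_neg hn.le]
      field_simp
  have hform : P.form k u G ζ = fun w => A w * D φ w := by
    ext w
    rw [hAD, mul_right_comm, hkeq]
    simp only [form, hφ]; ring
  have hconj : ENNReal.HolderConjugate (ENNReal.ofReal (P.p / (P.p - 1))) (ENNReal.ofReal P.p) := by
    have : (P.p / (P.p - 1)).HolderConjugate P.p := (Real.HolderConjugate.conjExponent P.hp).symm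
    exact this.ennrealOfReal
  have : Fact (1 ≤ ENNReal.ofReal (P.p / (P.p - 1))) := ⟨by
    rw [ENNReal.one_le_ofReal, one_le_div h1]; linarith⟩
  have : Fact (1 ≤ ENNReal.ofReal P.p) := ⟨by rw [ENNReal.one_le_ofReal]; exact P.hp.le⟩
  rw [hform]
  refine ⟨hAL.integrable_mul hDL, le_of_forall_pos_le_add fun ε hε => ?_⟩
  have hTc := continuous_translation_pairing ENNReal.ofReal_ne_top hAL hDL
  set T : Rn P.n → ℝ := fun z => ∫ w, A w * D φ (w + (z, z)) with hT
  have hT0 : T 0 = ∫ w, A w * D φ w := by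
    simp only [hT]
    congr 1; ext w
    rw [show ((0 : Rn P.n), (0 : Rn P.n)) = 0 from rfl, add_zero]
  obtain ⟨δ, hδ, hTδ⟩ := Metric.continuousAt_iff.1 hTc.continuousAt ε hε
  have hr0 : 0 < min δ ((r - ρ) / 2) := lt_min hδ (by linarith)
  let b : ContDiffBump (0 : Rn P.n) := ⟨min δ ((r - ρ) / 2) / 2, min δ ((r - ρ) / 2), by linarith,
    by linarith⟩
  have hbr : ρ + b.rOut < r := by
    have : b.rOut ≤ (r - ρ) / 2 := min_le_right _ _
    linarith
  obtain ⟨htest, hzero⟩ := isTestFun_mollified hball hφl hφs b hbr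
  set φb : Rn P.n → ℝ := fun x => ∫ z, b.normed volume z * φ (x - z) with hφb
  have hbc : Continuous (b.normed (volume : Measure (Rn P.n))) := b.continuous_normed
  have hbcs : HasCompactSupport (b.normed (volume : Measure (Rn P.n))) := b.hasCompactSupport_normed
  have hbi : Integrable (b.normed (volume : Measure (Rn P.n))) := b.integrable_normed
  have hbφi : ∀ x, Integrable fun z => b.normed volume z * φ (x - z) := fun x =>
    hbi.mul_bdd (c := B) (hφm.comp (by fun_prop)).aestronglyMeasurable (Eventually.of_forall fun z => hφB _)
  have hφbB : ∀ x, |φb x| ≤ B := fun x => by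
    calc |φb x| ≤ ∫ z, b.normed volume z * B := by
          rw [← Real.norm_eq_abs]
          refine norm_integral_le_of_norm_le (hbi.mul_const B) (Eventually.of_forall fun z => ?_)
          rw [norm_mul, Real.norm_of_nonneg (b.nonneg_normed z)]
          exact mul_le_mul_of_nonneg_left (hφB _) (b.nonneg_normed z)
      _ = B := by rw [integral_mul_const, b.integral_normed, one_mul]
  have hDb : ∀ w, D φb w = ∫ z, b.normed volume z * D φ (w - (z, z)) := fun w => by
    simp only [hD, hφb]
    rw [← integral_sub (hbφi _) (hbφi _), ← integral_mul_const]
    congr 1; ext z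
    simp only [Prod.fst_sub, Prod.snd_sub, sub_sub_sub_cancel_right]
    ring
  obtain ⟨hmi, hme⟩ := integrable_mollified_pairing ENNReal.ofReal_ne_top hAm hDm hAL hDL hbc hbcs
  simp only [← hDb] at hmi hme
  have hnl : nonlocalForm P.n Φ K v φb = ∫ w, A w * D φb w := by
    rw [Measure.volume_eq_prod] at hmi ⊢
    rw [nonlocalForm, integral_prod _ hmi]
    refine integral_congr_ae (huv.mono fun x hx => integral_congr_ae (huv.mono fun y hy => ?_))
    simp only [hAD, hx, hy]
  have hle : |∫ w, A w * D φb w| ≤ M * B := by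
    rw [← hnl, hweak φb htest]
    have e : ∫ x, φb x * f x = ∫ x in ball x0 r, φb x * f x := by
      rw [setIntegral_eq_integral_of_forall_compl_eq_zero fun x hx => ?_]
      rw [hφb]; simp only; rw [hzero x hx, zero_mul]
    rw [e, ← Real.norm_eq_abs]
    refine (ENNReal.ofReal_le_ofReal_iff (by positivity)).1 ?_
    rw [ofReal_norm]
    refine (enorm_integral_le_lintegral_enorm _).trans ?_
    calc _ ≤ ∫⁻ x in ball x0 r, ENNReal.ofReal B * ENNReal.ofReal |f x| := by
          refine lintegral_mono fun x => ?_
          rw [← ofReal_norm, norm_mul, ENNReal.ofReal_mul (norm_nonneg _)]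
          gcongr
          · exact hφbB x
          · exact le_rfl
      _ ≤ _ := by
          rw [lintegral_const_mul' _ _ ENNReal.ofReal_ne_top, mul_comm, ENNReal.ofReal_mul hM0]
          gcongr
  have hconv : |(∫ w, A w * D φb w) - T 0| ≤ ε := by
    have := b.dist_normed_convolution_le (μ := volume) (g := T) (x₀ := 0) (ε := ε)
      hTc.aestronglyMeasurable (fun x hx => (hTδ (lt_of_lt_of_le hx (min_le_left _ _))).le)
    rw [Real.dist_eq] at this
    refine le_trans (le_of_eq ?_) this
    congr 2
    rw [hme, convolution]
    congr 1; ext z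
    simp [hT]
  rw [← hT0]
  have := abs_sub_abs_le_abs_sub (T 0) (∫ w, A w * D φb w)
  rw [abs_sub_comm] at this
  linarith

end Prm

lemma tendsto_lintegral_rpow_of_le {n : ℕ} {S : Set (Rn n)} (hS : volume S ≠ ⊤)
    {f : ℕ → Rn n → ℝ} {a Q : ℝ} (ha : 0 < a) (haQ : a ≤ Q)
    (h : Tendsto (fun j => ∫⁻ x in S, ENNReal.ofReal (|f j x| ^ Q)) atTop (𝓝 0)) :
    Tendsto (fun j => ∫⁻ x in S, ENNReal.ofReal (|f j x| ^ a)) atTop (𝓝 0) := by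
  rw [ENNReal.tendsto_nhds_zero]
  intro ε hε
  obtain ⟨e, he, heε⟩ : ∃ e : ℝ, 0 < e ∧ ENNReal.ofReal e ≤ ε := by
    rcases eq_or_ne ε ⊤ with h | h
    · exact ⟨1, one_pos, h ▸ le_top⟩
    · exact ⟨ε.toReal, ENNReal.toReal_pos hε.ne' h, (ENNReal.ofReal_toReal h).le⟩
  set V := (volume S).toReal with hV
  have hV0 : 0 ≤ V := ENNReal.toReal_nonneg
  set η : ℝ := (e / (2 * (V + 1))) ^ a⁻¹ with hη
  have hη0 : 0 < η := by positivity
  have hηa : η ^ a = e / (2 * (V + 1)) := by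
    rw [hη, ← Real.rpow_mul (by positivity), inv_mul_cancel₀ ha.ne', Real.rpow_one]
  have hpt : ∀ t : ℝ, |t| ^ a ≤ η ^ a + η ^ (a - Q) * |t| ^ Q := fun t => by
    rcases le_total |t| η with ht | ht
    · have : |t| ^ a ≤ η ^ a := Real.rpow_le_rpow (abs_nonneg _) ht ha.le
      have : 0 ≤ η ^ (a - Q) * |t| ^ Q := by positivity
      linarith
    · have ht0 : 0 < |t| := hη0.trans_le ht
      have h1 : |t| ^ a = |t| ^ (a - Q) * |t| ^ Q := by
        rw [← Real.rpow_add ht0, sub_add_cancel]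
      have h2 : |t| ^ (a - Q) ≤ η ^ (a - Q) :=
        Real.rpow_le_rpow_of_nonpos hη0 ht (by linarith)
      have h3 : |t| ^ (a - Q) * |t| ^ Q ≤ η ^ (a - Q) * |t| ^ Q := by gcongr
      have : 0 ≤ η ^ a := by positivity
      linarith
  have hlim := ENNReal.Tendsto.const_mul (a := ENNReal.ofReal (η ^ (a - Q))) h
    (Or.inr ENNReal.ofReal_ne_top)
  rw [mul_zero] at hlim
  have hev := (tendsto_order.1 hlim).2 (ENNReal.ofReal (e / 2)) (by simpa using he)
  filter_upwards [hev] with j hj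
  calc ∫⁻ x in S, ENNReal.ofReal (|f j x| ^ a)
      ≤ ∫⁻ x in S, (ENNReal.ofReal (η ^ a) +
          ENNReal.ofReal (η ^ (a - Q)) * ENNReal.ofReal (|f j x| ^ Q)) := by
        refine lintegral_mono fun x => ?_
        rw [← ENNReal.ofReal_mul (by positivity), ← ENNReal.ofReal_add (by positivity)
          (by positivity)]
        exact ENNReal.ofReal_le_ofReal (hpt _)
    _ = ENNReal.ofReal (η ^ a * V) +
          ENNReal.ofReal (η ^ (a - Q)) * ∫⁻ x in S, ENNReal.ofReal (|f j x| ^ Q) := by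
        rw [lintegral_add_left measurable_const, lintegral_const_mul' _ _ ENNReal.ofReal_ne_top,
          setLIntegral_const, ENNReal.ofReal_mul (by positivity), hV, ENNReal.ofReal_toReal hS]
    _ ≤ ENNReal.ofReal (e / 2) + ENNReal.ofReal (e / 2) := by
        gcongr
        rw [hηa, div_mul_eq_mul_div, div_le_div_iff₀ (by positivity) (by positivity)]
        nlinarith
    _ = ENNReal.ofReal e := by rw [← ENNReal.ofReal_add (by positivity) (by positivity)]; simp
    _ ≤ ε := heε

namespace Prm

variable (P : Prm)

/-- `u` can be approximated, at every ball inside `Ω`, by solutions of nonlocal equations whose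
right-hand side has mass controlled by the measure `ν`. -/
def Approx (Ω : Set (Rn P.n)) (ν : Measure (Rn P.n)) (u : Rn P.n → ℝ) : Prop :=
  ∀ (x0 : Rn P.n) (r M ε : ℝ), 0 < r → closedBall x0 r ⊆ Ω →
    ν (closedBall x0 r) < ENNReal.ofReal M → 0 < ε → ∃ w, P.InCls x0 r M w ∧
      (P.lb 1 (fun y => |w (x0 + r • y)| ^ P.q) < ⊤ ∧
        P.lb 1 (fun y => |w (x0 + r • y)| ^ (P.p - 1)) < ⊤ ∧
        P.tl 1 (fun y => |w (x0 + r • y)| ^ (P.p - 1)) < ⊤) ∧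
      P.lb 1 (fun y => |w (x0 + r • y) - u (x0 + r • y)| ^ P.q) ≤ ENNReal.ofReal ε ∧
      P.lb 1 (fun y => |w (x0 + r • y) - u (x0 + r • y)| ^ (P.p - 1)) ≤ ENNReal.ofReal ε ∧
      P.tl 1 (fun y => |w (x0 + r • y) - u (x0 + r • y)| ^ (P.p - 1)) ≤ ENNReal.ofReal ε

variable {P}

lemma lb_affine (x0 : Rn P.n) {r : ℝ} (hr : 0 < r) (F : Rn P.n → ℝ) :
    P.lb 1 (fun y => F (x0 + r • y)) =
      ENNReal.ofReal ((r ^ P.n)⁻¹) * ∫⁻ x in ball x0 r, ENNReal.ofReal (F x) := by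
  have := P.lint_ball_affine x0 hr 1 (fun x => ENNReal.ofReal (F x))
  rwa [mul_one] at this

lemma tl_affine (x0 : Rn P.n) {r : ℝ} (hr : 0 < r) (F : Rn P.n → ℝ) :
    P.tl 1 (fun y => F (x0 + r • y)) = ENNReal.ofReal (r ^ (P.s * P.p)) *
      ∫⁻ x in (ball x0 r)ᶜ, ENNReal.ofReal (F x) * ENNReal.ofReal (P.ker (x - x0)) := by
  have := P.lint_tail_affine x0 hr 1 (fun x => ENNReal.ofReal (F x))
  rwa [mul_one] at this

lemma lint_ker_compl_affine (x0 : Rn P.n) {r : ℝ} (hr : 0 < r) :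
    ∫⁻ x in (ball x0 r)ᶜ, ENNReal.ofReal (P.ker (x - x0)) < ⊤ := by
  have h1 := P.lint_tail_affine x0 one_pos r (fun _ => 1)
  simp only [one_mul, Real.one_rpow, ENNReal.ofReal_one] at h1
  rw [← h1]
  exact (P.lint_ker_compl hr).trans_lt ENNReal.ofReal_lt_top

/-- Splitting a tail integral at a larger radius. -/
lemma lint_tail_le (x0 : Rn P.n) {r R : ℝ} (hr : 0 < r) (F : Rn P.n → ℝ≥0∞) :
    ∫⁻ x in (ball x0 r)ᶜ, F x * ENNReal.ofReal (P.ker (x - x0)) ≤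
      ENNReal.ofReal ((r ^ P.N)⁻¹) * (∫⁻ x in ball x0 R, F x) +
        ∫⁻ x in (ball x0 R)ᶜ, F x * ENNReal.ofReal (P.ker (x - x0)) := by
  have hsub : (ball x0 r)ᶜ ⊆ (ball x0 R ∩ (ball x0 r)ᶜ) ∪ (ball x0 R)ᶜ := fun x hx => by
    by_cases h : x ∈ ball x0 R
    · exact Or.inl ⟨h, hx⟩
    · exact Or.inr h
  refine (lintegral_mono_set hsub).trans ((lintegral_union_le _ _ _).trans ?_)
  gcongr
  rw [← lintegral_const_mul' _ _ ENNReal.ofReal_ne_top]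
  refine le_trans (setLIntegral_mono' (measurableSet_ball.inter measurableSet_ball.compl)
    fun x hx => ?_) (lintegral_mono_set inter_subset_left)
  rw [mul_comm]
  gcongr
  refine P.ker_le_of_le hr ?_
  have := hx.2
  rwa [mem_compl_iff, mem_ball, not_lt, dist_eq_norm] at this

lemma lint_rpow_lt_top {v : Rn P.n → ℝ} (hv : ∫⁻ x, ENNReal.ofReal (|v x| ^ P.p) < ⊤)
    {S : Set (Rn P.n)} (hS : volume S ≠ ⊤) {a : ℝ} (ha : 0 ≤ a) (hap : a ≤ P.p) :
    ∫⁻ x in S, ENNReal.ofReal (|v x| ^ a) < ⊤ := by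
  calc _ ≤ ∫⁻ x in S, (1 + ENNReal.ofReal (|v x| ^ P.p)) := by
        refine lintegral_mono fun x => ?_
        rw [← ENNReal.ofReal_one, ← ENNReal.ofReal_add zero_le_one (by positivity)]
        refine ENNReal.ofReal_le_ofReal ?_
        rcases le_total |v x| 1 with h | h
        · have := Real.rpow_le_one (abs_nonneg _) h ha
          have : 0 ≤ |v x| ^ P.p := by positivity
          linarith
        · have := Real.rpow_le_rpow_of_exponent_le h hap
          linarith
    _ = volume S + ∫⁻ x in S, ENNReal.ofReal (|v x| ^ P.p) := by
        rw [lintegral_add_left measurable_const]; simp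
    _ < ⊤ := ENNReal.add_lt_top.2 ⟨hS.lt_top, (setLIntegral_le_lintegral _ _).trans_lt hv⟩

lemma lint_tail_rpow_lt_top {v : Rn P.n → ℝ} (hv : ∫⁻ x, ENNReal.ofReal (|v x| ^ P.p) < ⊤)
    (x0 : Rn P.n) {r : ℝ} (hr : 0 < r) :
    ∫⁻ x in (ball x0 r)ᶜ, ENNReal.ofReal (|v x| ^ (P.p - 1)) *
      ENNReal.ofReal (P.ker (x - x0)) < ⊤ := by
  have h1 := P.p1_pos
  calc _ ≤ ∫⁻ x in (ball x0 r)ᶜ, (ENNReal.ofReal (P.ker (x - x0)) +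
          ENNReal.ofReal ((r ^ P.N)⁻¹) * ENNReal.ofReal (|v x| ^ P.p)) := by
        refine setLIntegral_mono' measurableSet_ball.compl fun x hx => ?_
        rw [mem_compl_iff, mem_ball, not_lt, dist_eq_norm] at hx
        have hk := P.ker_nonneg (x - x0)
        have hk2 := P.ker_le_of_le hr hx
        rw [← ENNReal.ofReal_mul (by positivity), ← ENNReal.ofReal_mul (by positivity),
          ← ENNReal.ofReal_add hk (by positivity)]
        refine ENNReal.ofReal_le_ofReal ?_
        have h2 : 0 ≤ |v x| ^ P.p := by positivity
        rcases le_total |v x| 1 with h | h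
        · have h3 := Real.rpow_le_one (abs_nonneg _) h h1.le
          have h4 : 0 ≤ (r ^ P.N)⁻¹ * |v x| ^ P.p := by positivity
          nlinarith
        · have h3 : |v x| ^ (P.p - 1) ≤ |v x| ^ P.p :=
            Real.rpow_le_rpow_of_exponent_le h (by linarith)
          calc _ ≤ |v x| ^ P.p * (r ^ P.N)⁻¹ := by gcongr
            _ ≤ _ := by linarith
    _ = (∫⁻ x in (ball x0 r)ᶜ, ENNReal.ofReal (P.ker (x - x0))) +
          ENNReal.ofReal ((r ^ P.N)⁻¹) * ∫⁻ x in (ball x0 r)ᶜ, ENNReal.ofReal (|v x| ^ P.p) := by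
        rw [lintegral_add_left (by have := P.measurable_ker; fun_prop),
          lintegral_const_mul' _ _ ENNReal.ofReal_ne_top]
    _ < ⊤ := ENNReal.add_lt_top.2 ⟨lint_ker_compl_affine x0 hr, ENNReal.mul_lt_top
        ENNReal.ofReal_lt_top ((setLIntegral_le_lintegral _ _).trans_lt hv)⟩

lemma tendsto_tail_integral {f : ℕ → Rn P.n → ℝ} {x0 : Rn P.n} {R : ℝ} (hR : 0 < R)
    (h : Tendsto (fun j => tailFn P.n P.s P.p (f j) x0 R) atTop (𝓝 0)) :
    Tendsto (fun j => ∫⁻ x in (ball x0 R)ᶜ, ENNReal.ofReal (|f j x| ^ (P.p - 1)) *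
      ENNReal.ofReal (P.ker (x - x0))) atTop (𝓝 0) := by
  have h1 := P.p1_pos
  have h2 := ENNReal.Tendsto.const_mul (a := ENNReal.ofReal (R ^ (-(P.s * P.p))))
    (h.ennrpow_const (P.p - 1)) (Or.inr ENNReal.ofReal_ne_top)
  rw [ENNReal.zero_rpow_of_pos h1, mul_zero] at h2
  refine h2.congr fun j => ?_
  rw [tailFn, ← ENNReal.rpow_mul, one_div, inv_mul_cancel₀ h1.ne', ENNReal.rpow_one, ← mul_assoc,
    ← ENNReal.ofReal_mul (by positivity), ← Real.rpow_add hR, neg_add_cancel, Real.rpow_zero,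
    ENNReal.ofReal_one, one_mul]
  refine lintegral_congr fun x => ?_
  rw [← ENNReal.ofReal_mul (by positivity), div_eq_mul_inv]
  rfl

end Prm

namespace Prm

variable {P : Prm}

lemma exists_approx_of_sola {Λ : ℝ} {Φ : ℝ → ℝ} {K : Rn P.n → Rn P.n → ℝ} (hΛ : 1 ≤ Λ)
    (hL : Λ ^ 2 ≤ P.L) (hK : KernelBounds P.n Λ P.s P.p K) (hΦ : PhiBounds Λ P.p Φ)
    {Ω : Set (Rn P.n)} (hΩb : Bornology.IsBounded Ω) {μ : SignedMeasure (Rn P.n)}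
    {g u : Rn P.n → ℝ} {uj μj gj : ℕ → Rn P.n → ℝ}
    (h : SOLAApprox P.n Φ K P.s P.p Ω μ g u uj μj gj) (hout : ∀ᵐ x, x ∉ Ω → u x = g x)
    (hq : P.q < qBar P.n P.s P.p) (hqs : qStar P.p < qBar P.n P.s P.p) :
    ∃ v, Measurable v ∧ u =ᵐ[volume] v ∧ P.Approx Ω μ.totalVariation v := by
  obtain ⟨-, -, hweak, hae, hloc, -, hmass, hgj⟩ := h
  have h1 := P.p1_pos
  have hum : AEMeasurable u := aemeasurable_of_tendsto_metrizable_ae atTop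
    (fun j => by simpa using (hweak j).1.1) hae
  obtain ⟨v, hv, huv⟩ : ∃ v, Measurable v ∧ u =ᵐ[volume] v :=
    ⟨hum.mk u, hum.measurable_mk, hum.ae_eq_mk⟩
  refine ⟨v, hv, huv, fun x0 r M ε hr hball hM hε => ?_⟩
  have hM0 : 0 < M := by
    by_contra hneg
    rw [ENNReal.ofReal_of_nonpos (not_lt.1 hneg)] at hM
    exact not_lt_bot hM
  have hεE : 0 < ENNReal.ofReal ε := by simpa using hε
  have hlocal : ∀ a, 0 < a → a ≤ max P.q (qStar P.p) → ∀ R, 0 < R → Tendsto (fun j =>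
      ∫⁻ x in ball x0 R, ENNReal.ofReal (|uj j x - u x| ^ a)) atTop (𝓝 0) :=
    fun a ha haQ R hR => tendsto_lintegral_rpow_of_le measure_ball_lt_top.ne ha haQ
      (hloc _ (le_max_right _ _) (max_lt hq hqs) x0 R hR)
  have hp1Q : P.p - 1 ≤ max P.q (qStar P.p) := (le_max_right _ _).trans (le_max_right _ _)
  have hscale : ∀ a, 0 < a → a ≤ max P.q (qStar P.p) → ∀ᶠ j in atTop,
      ENNReal.ofReal ((r ^ P.n)⁻¹) * ∫⁻ x in ball x0 r, ENNReal.ofReal (|uj j x - u x| ^ a) <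
        ENNReal.ofReal ε := fun a ha haQ => by
    have := ENNReal.Tendsto.const_mul (a := ENNReal.ofReal ((r ^ P.n)⁻¹)) (hlocal a ha haQ r hr)
      (Or.inr ENNReal.ofReal_ne_top)
    rw [mul_zero] at this
    exact (tendsto_order.1 this).2 _ hεE
  obtain ⟨R, hR0, hΩR⟩ := hΩb.subset_ball_lt 0 x0
  have htail : ∀ᶠ j in atTop, ENNReal.ofReal (r ^ (P.s * P.p)) *
      ∫⁻ x in (ball x0 r)ᶜ, ENNReal.ofReal (|uj j x - u x| ^ (P.p - 1)) *
        ENNReal.ofReal (P.ker (x - x0)) < ENNReal.ofReal ε := by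
    have e1 := ENNReal.Tendsto.const_mul (a := ENNReal.ofReal ((r ^ P.N)⁻¹))
      (hlocal _ h1 hp1Q R hR0) (Or.inr ENNReal.ofReal_ne_top)
    have e2 := ENNReal.Tendsto.const_mul (a := ENNReal.ofReal (r ^ (P.s * P.p)))
      (e1.add (tendsto_tail_integral hR0 (hgj x0 R hR0).2)) (Or.inr ENNReal.ofReal_ne_top)
    rw [mul_zero, add_zero, mul_zero] at e2
    filter_upwards [(tendsto_order.1 e2).2 _ hεE] with j hj
    refine lt_of_le_of_lt ?_ hj
    gcongr
    refine (P.lint_tail_le x0 hr (R := R) _).trans (le_of_eq ?_)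
    congr 1
    refine setLIntegral_congr_fun_ae measurableSet_ball.compl ?_
    filter_upwards [hout, (hweak j).2.1] with x h3 h4 hx
    have hxΩ : x ∉ Ω := fun h => hx (hΩR h)
    rw [h3 hxΩ, h4 hxΩ]
  have hmass' : ∀ᶠ j in atTop, ∫⁻ x in ball x0 r, ENNReal.ofReal |μj j x| < ENNReal.ofReal M :=
    eventually_lt_of_limsup_lt ((hmass x0 r hr).trans_lt hM)
  obtain ⟨j, hj1, hj2, hj3, hj4⟩ := (hmass'.and ((hscale _ P.q_pos (le_max_left _ _)).and
    ((hscale _ h1 hp1Q).and htail))).exists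
  obtain ⟨w, hw, hjw, hcls⟩ := P.exists_inCls_of_weakSol hΛ hL hK hΦ (hweak j)
  have hLp : ∫⁻ x, ENNReal.ofReal (|w x| ^ P.p) < ⊤ := by
    have := (hweak j).1.2.1
    rw [Measure.restrict_univ] at this
    refine lt_of_eq_of_lt (lintegral_congr_ae ?_) this
    filter_upwards [hjw] with x hx
    rw [hx]
  have hdiff : ∀ a : ℝ, (fun x => ENNReal.ofReal (|w x - v x| ^ a)) =ᵐ[volume]
      fun x => ENNReal.ofReal (|uj j x - u x| ^ a) := fun a => by
    filter_upwards [hjw, huv] with x h2 h3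
    rw [h2, h3]
  refine ⟨w, hcls x0 r M (ball_subset_closedBall.trans hball) hM0.le hj1.le, ⟨?_, ?_, ?_⟩, ?_, ?_, ?_⟩
  · rw [lb_affine x0 hr (fun x => |w x| ^ P.q)]
    exact ENNReal.mul_lt_top ENNReal.ofReal_lt_top
      (lint_rpow_lt_top hLp measure_ball_lt_top.ne P.q_pos.le P.q_le)
  · rw [lb_affine x0 hr (fun x => |w x| ^ (P.p - 1))]
    exact ENNReal.mul_lt_top ENNReal.ofReal_lt_top
      (lint_rpow_lt_top hLp measure_ball_lt_top.ne h1.le (by linarith))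
  · rw [tl_affine x0 hr (fun x => |w x| ^ (P.p - 1))]
    exact ENNReal.mul_lt_top ENNReal.ofReal_lt_top (lint_tail_rpow_lt_top hLp x0 hr)
  · rw [lb_affine x0 hr (fun x => |w x - v x| ^ P.q)]
    exact (mul_le_mul_right (lintegral_congr_ae (ae_restrict_of_ae (hdiff P.q))).le _).trans hj2.le
  · rw [lb_affine x0 hr (fun x => |w x - v x| ^ (P.p - 1))]
    exact (mul_le_mul_right (lintegral_congr_ae
      (ae_restrict_of_ae (hdiff (P.p - 1)))).le _).trans hj3.le
  · rw [tl_affine x0 hr (fun x => |w x - v x| ^ (P.p - 1))]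
    exact (mul_le_mul_right (lintegral_congr_ae (ae_restrict_of_ae
      ((hdiff (P.p - 1)).mul (ae_eq_refl fun x => ENNReal.ofReal (P.ker (x - x0)))))).le _).trans
        hj4.le

end Prm

namespace Prm

variable {P : Prm}

/-- Monotone additive functionals such as `P.lb r` and `P.tl r`. -/
structure IsMass (T : (Rn P.n → ℝ) → ℝ≥0∞) : Prop where
  mono : ∀ {F G : Rn P.n → ℝ}, (∀ x, F x ≤ G x) → T F ≤ T G
  add : ∀ {F G : Rn P.n → ℝ}, (∀ x, 0 ≤ F x) → (∀ x, 0 ≤ G x) → Measurable F →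
    T (fun x => F x + G x) = T F + T G
  const_mul : ∀ {c : ℝ}, 0 ≤ c → ∀ F : Rn P.n → ℝ, T (fun x => c * F x) = ENNReal.ofReal c * T F

lemma isMass_lb (r : ℝ) : IsMass (P := P) (P.lb r) := ⟨lb_mono, lb_add, lb_const_mul⟩

lemma isMass_tl (r : ℝ) : IsMass (P := P) (P.tl r) := ⟨tl_mono, tl_add, tl_const_mul⟩

lemma IsMass.triangle {T : (Rn P.n → ℝ) → ℝ≥0∞} (hT : IsMass T) {f g : Rn P.n → ℝ} {a : ℝ}
    (ha : 0 ≤ a) (hf : Measurable f) :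
    T (fun x => |f x + g x| ^ a) ≤
      ENNReal.ofReal (2 ^ a) * (T (fun x => |f x| ^ a) + T (fun x => |g x| ^ a)) := by
  rw [← hT.add (fun x => by positivity) (fun x => by positivity) (by fun_prop),
    ← hT.const_mul (by positivity)]
  exact hT.mono fun x => (Real.rpow_le_rpow (abs_nonneg _) (abs_add_le _ _) ha).trans
    (add_rpow_le_two (abs_nonneg _) (abs_nonneg _) ha)

lemma IsMass.scale {T : (Rn P.n → ℝ) → ℝ≥0∞} (hT : IsMass T) (f : Rn P.n → ℝ) {a b : ℝ}
    (hb : 0 ≤ b) : T (fun x => |b * f x| ^ a) = ENNReal.ofReal (b ^ a) * T (fun x => |f x| ^ a) := by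
  rw [← hT.const_mul (by positivity)]
  congr 1
  ext x
  rw [abs_mul, abs_of_nonneg hb, Real.mul_rpow hb (abs_nonneg _)]

lemma IsMass.normalize {T : (Rn P.n → ℝ) → ℝ≥0∞} (hT : IsMass T) {u w : Rn P.n → ℝ}
    {a A m c e : ℝ} (ha : 0 ≤ a) (hA : 0 < A) (hm : 0 < m) (hu : Measurable u) (hw : Measurable w)
    (h1 : T (fun x => |u x - c| ^ a) ≤ ENNReal.ofReal (m ^ a))
    (h2 : T (fun x => |w x - u x| ^ a) ≤ ENNReal.ofReal e) (he : e ≤ m ^ a)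
    (hAa : 2 ^ (a + 1) ≤ A ^ a) : T (fun x => |(w x - c) / (A * m)| ^ a) ≤ 1 := by
  have hma : 0 < m ^ a := by positivity
  have hAm : 0 < A ^ a := by positivity
  calc T (fun x => |(w x - c) / (A * m)| ^ a)
      = T (fun x => |(A * m)⁻¹ * ((w x - u x) + (u x - c))| ^ a) := by
        congr 1; ext x; congr 2; rw [div_eq_inv_mul]; ring
    _ = ENNReal.ofReal ((A * m)⁻¹ ^ a) * T (fun x => |(w x - u x) + (u x - c)| ^ a) :=
        hT.scale _ (by positivity)
    _ ≤ ENNReal.ofReal ((A * m)⁻¹ ^ a) * (ENNReal.ofReal (2 ^ a) *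
          (ENNReal.ofReal (m ^ a) + ENNReal.ofReal (m ^ a))) := by
        gcongr
        refine (hT.triangle ha (by fun_prop)).trans ?_
        gcongr
        exact h2.trans (ENNReal.ofReal_le_ofReal he)
    _ = ENNReal.ofReal (2 ^ (a + 1) / A ^ a) := by
        rw [← ENNReal.ofReal_add hma.le hma.le, ← ENNReal.ofReal_mul (by positivity),
          ← ENNReal.ofReal_mul (by positivity)]
        congr 1
        rw [Real.inv_rpow (by positivity), Real.mul_rpow hA.le hm.le, Real.rpow_add two_pos,
          Real.rpow_one]
        field_simp
        ring
    _ ≤ 1 := by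
        rw [← ENNReal.ofReal_one]
        exact ENNReal.ofReal_le_ofReal ((div_le_one hAm).2 hAa)

lemma IsMass.denormalize {T : (Rn P.n → ℝ) → ℝ≥0∞} (hT : IsMass T) {u w : Rn P.n → ℝ}
    {a b c d e ε t : ℝ} (ha : 0 ≤ a) (hb : 0 < b) (hu : Measurable u) (hw : Measurable w)
    (h1 : T (fun x => |(w x - c) / b - d| ^ a) ≤ ENNReal.ofReal ε)
    (h2 : T (fun x => |w x - u x| ^ a) ≤ ENNReal.ofReal e) (he : 0 ≤ e) (hε : 0 ≤ ε)
    (ht : 2 ^ a * (e + b ^ a * ε) ≤ t) :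
    T (fun x => |u x - (c + b * d)| ^ a) ≤ ENNReal.ofReal t := by
  have hba : 0 < b ^ a := by positivity
  calc T (fun x => |u x - (c + b * d)| ^ a)
      = T (fun x => |(w x - u x) + b * -((w x - c) / b - d)| ^ a) := by
        congr 1; ext x; rw [← abs_neg]; congr 2; field_simp; ring
    _ ≤ ENNReal.ofReal (2 ^ a) * (ENNReal.ofReal e + ENNReal.ofReal (b ^ a) * ENNReal.ofReal ε) := by
        refine (hT.triangle ha (by fun_prop)).trans ?_
        gcongr
        rw [hT.scale _ hb.le]
        simp only [abs_neg]
        gcongr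
    _ ≤ ENNReal.ofReal t := by
        rw [← ENNReal.ofReal_mul hba.le, ← ENNReal.ofReal_add he (by positivity),
          ← ENNReal.ofReal_mul (by positivity)]
        exact ENNReal.ofReal_le_ofReal ht

lemma lb_smul_le {σ e : ℝ} (hσ : 0 < σ) (hσ1 : σ ≤ 1) {F : Rn P.n → ℝ}
    (h : P.lb 1 F ≤ ENNReal.ofReal e) :
    P.lb 1 (fun x => F (σ • x)) ≤ ENNReal.ofReal ((σ ^ P.n)⁻¹ * e) := by
  rw [lb_smul hσ, mul_one, ENNReal.ofReal_mul (by positivity)]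
  gcongr
  exact (lb_mono_radius hσ1 F).trans h

lemma tl_smul_le {σ e : ℝ} (hσ : 0 < σ) (he : 0 ≤ e) {F : Rn P.n → ℝ}
    (h : P.lb 1 F ≤ ENNReal.ofReal e) (h2 : P.tl 1 F ≤ ENNReal.ofReal e) :
    P.tl 1 (fun x => F (σ • x)) ≤
      ENNReal.ofReal (σ ^ (P.s * P.p) * ((σ ^ P.N)⁻¹ + 1) * e) := by
  rw [tl_smul hσ, mul_one, mul_assoc, ENNReal.ofReal_mul (by positivity)]
  gcongr
  refine (tl_split hσ F).trans ?_
  rw [add_mul, one_mul, ENNReal.ofReal_add (by positivity) he,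
    ENNReal.ofReal_mul (by positivity)]
  gcongr

/-- The excess of `u` at `x₀` and scale `r`, relative to the constant `c`, is at most `m`. -/
def Exc (u : Rn P.n → ℝ) (x0 : Rn P.n) (r c m : ℝ) : Prop :=
  P.lb 1 (fun y => |u (x0 + r • y) - c| ^ P.q) ≤ ENNReal.ofReal (m ^ P.q) ∧
    P.tl 1 (fun y => |u (x0 + r • y) - c| ^ (P.p - 1)) ≤ ENNReal.ofReal (m ^ (P.p - 1))

lemma exists_normalizing : ∃ A : ℝ, 1 ≤ A ∧ 2 ^ (P.q + 1) ≤ A ^ P.q ∧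
    2 ^ (P.p - 1 + 1) ≤ A ^ (P.p - 1) := by
  have key : ∀ a : ℝ, 0 < a → ∀ B : ℝ, 0 ≤ B → (2 : ℝ) ^ (a + 1) ≤ (2 ^ ((a + 1) / a) + B) ^ a :=
    fun a ha B hB => by
    calc (2 : ℝ) ^ (a + 1) = (2 ^ ((a + 1) / a)) ^ a := by
          rw [← Real.rpow_mul two_pos.le, div_mul_cancel₀ _ ha.ne']
      _ ≤ _ := Real.rpow_le_rpow (by positivity) (by linarith) ha.le
  refine ⟨2 ^ ((P.q + 1) / P.q) + 2 ^ ((P.p - 1 + 1) / (P.p - 1)), ?_,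
    key _ P.q_pos _ (by positivity), ?_⟩
  · have hq := P.q_pos
    have : (1 : ℝ) ≤ 2 ^ ((P.q + 1) / P.q) := Real.one_le_rpow one_le_two (by positivity)
    have : (0 : ℝ) ≤ 2 ^ ((P.p - 1 + 1) / (P.p - 1)) := by positivity
    linarith
  · rw [add_comm (2 ^ ((P.q + 1) / P.q) : ℝ)]
    exact key _ P.p1_pos _ (by positivity)

variable (P) in
/-- Excess decay: if the measure is small compared with the excess, the excess halves at a smaller
scale. -/
lemma excess_decay : ∃ σ δ C : ℝ, 0 < σ ∧ σ ≤ 1 / 2 ∧ 0 < δ ∧ 0 < C ∧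
    ∀ (Ω : Set (Rn P.n)) (ν : Measure (Rn P.n)) (u : Rn P.n → ℝ), Measurable u → P.Approx Ω ν u →
      ∀ (x0 : Rn P.n) (r c m : ℝ), 0 < r → 0 < m → closedBall x0 r ⊆ Ω → P.Exc u x0 r c m →
        ν (closedBall x0 r) < ENNReal.ofReal (δ * m ^ (P.p - 1) * r ^ (P.n - P.s * P.p)) →
        ∃ c', |c' - c| ≤ C * m ∧ P.Exc u x0 (σ * r) c' (m / 2) := by
  obtain ⟨A, hA1, hAq, hAp⟩ := exists_normalizing (P := P)
  have hA : 0 < A := by linarith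
  have hq := P.q_pos
  have h1 := P.p1_pos
  set ε0 : ℝ := min ((1 / 2) ^ P.q / 2 / (2 ^ P.q * A ^ P.q))
    ((1 / 2) ^ (P.p - 1) / 2 / (2 ^ (P.p - 1) * A ^ (P.p - 1))) with hε0
  have hε0p : 0 < ε0 := by rw [hε0]; positivity
  obtain ⟨σ, δ, C, hσ, hσ1, hδ, hC, H⟩ := P.key_decay hε0p
  refine ⟨σ, δ, A * C, hσ, hσ1, hδ, by positivity, fun Ω ν u hu hap x0 r c m hr hm hb hexc hν => ?_⟩
  set K : ℝ := max ((σ ^ P.n)⁻¹) (σ ^ (P.s * P.p) * ((σ ^ P.N)⁻¹ + 1)) with hK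
  have hKp : 0 < K := by rw [hK]; positivity
  set e : ℝ := min (min (m ^ P.q) (m ^ (P.p - 1))) (min ((m / 2) ^ P.q / 2 / (2 ^ P.q * K))
    ((m / 2) ^ (P.p - 1) / 2 / (2 ^ (P.p - 1) * K))) with he
  have hep : 0 < e := by rw [he]; positivity
  obtain ⟨w, hw, -, hw1, hw2, hw3⟩ := hap x0 r _ e hr hb hν hep
  have hwm := hw.measurable
  have hb0 : 0 < A * m := by positivity
  set v : Rn P.n → ℝ := fun y => (w (x0 + r • y) - c) / (A * m) with hv
  have hv1 : P.InCls 0 1 δ v := by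
    refine (hw.zoom hr hb0.ne' c (by rw [mul_one])).mono le_rfl ?_
    rw [abs_of_pos hb0, Real.mul_rpow hA.le hm.le]
    have e1 : m ^ (1 - P.p) * m ^ (P.p - 1) = 1 := by
      rw [← Real.rpow_add hm]; simp
    have e2 : r ^ (P.s * P.p - P.n) * r ^ (P.n - P.s * P.p) = 1 := by
      rw [← Real.rpow_add hr]; simp
    have e3 : A ^ (1 - P.p) ≤ 1 := Real.rpow_le_one_of_one_le_of_nonpos hA1 (by linarith)
    calc _ = A ^ (1 - P.p) * δ * (m ^ (1 - P.p) * m ^ (P.p - 1)) *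
          (r ^ (P.s * P.p - P.n) * r ^ (P.n - P.s * P.p)) := by ring
      _ ≤ δ := by rw [e1, e2]; nlinarith
  have hum : Measurable fun y => u (x0 + r • y) := by fun_prop
  have hwm' : Measurable fun y => w (x0 + r • y) := by fun_prop
  obtain ⟨d, hd, hd1, hd2⟩ := H v hv1
    ((isMass_lb 1).normalize hq.le hA hm hum hwm' hexc.1 hw1
      ((min_le_left _ _).trans (min_le_left _ _)) hAq)
    ((isMass_tl 1).normalize h1.le hA hm hum hwm' hexc.2 hw3
      ((min_le_left _ _).trans (min_le_right _ _)) hAp)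
  have heq : ∀ y : Rn P.n, x0 + (σ * r) • y = x0 + r • (σ • y) := fun y => by
    rw [smul_smul, mul_comm]
  have hnum : ∀ a k : ℝ, 0 < a → 0 < k → k ≤ K → e ≤ (m / 2) ^ a / 2 / (2 ^ a * K) →
      ε0 ≤ (1 / 2) ^ a / 2 / (2 ^ a * A ^ a) →
      2 ^ a * (k * e + (A * m) ^ a * ε0) ≤ (m / 2) ^ a := fun a k ha hk hkK i1 i2 => by
    rw [le_div_iff₀ (by positivity)] at i1 i2
    have i3 : k * e ≤ K * e := by gcongr
    have i4 : (m / 2) ^ a = m ^ a * (1 / 2) ^ a := by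
      rw [← Real.mul_rpow hm.le (by norm_num)]; ring_nf
    have i5 := mul_le_mul_of_nonneg_left i2 (by positivity : 0 ≤ m ^ a)
    have i6 := mul_le_mul_of_nonneg_left i3 (by positivity : (0 : ℝ) ≤ 2 ^ a)
    rw [Real.mul_rpow hA.le hm.le]
    nlinarith
  refine ⟨c + A * m * d, ?_, ?_, ?_⟩
  · rw [add_sub_cancel_left, abs_mul, abs_of_pos hb0]
    nlinarith
  · simp only [heq]
    refine (isMass_lb 1).denormalize (w := fun y => w (x0 + r • (σ • y))) hq.le hb0 (by fun_prop)
      (by fun_prop) hd1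
      (lb_smul_le hσ (by linarith) (F := fun y => |w (x0 + r • y) - u (x0 + r • y)| ^ P.q) hw1)
      (by positivity) hε0p.le ?_
    exact hnum _ _ hq (by positivity) (le_max_left _ _) ((min_le_right _ _).trans (min_le_left _ _))
      (min_le_left _ _)
  · simp only [heq]
    refine (isMass_tl 1).denormalize (w := fun y => w (x0 + r • (σ • y))) h1.le hb0 (by fun_prop)
      (by fun_prop) hd2
      (tl_smul_le hσ hep.le (F := fun y => |w (x0 + r • y) - u (x0 + r • y)| ^ (P.p - 1)) hw2 hw3)
      (by positivity) hε0p.le ?_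
    exact hnum _ _ h1 (by positivity) (le_max_right _ _)
      ((min_le_right _ _).trans (min_le_right _ _)) (min_le_right _ _)

end Prm

namespace Prm

variable {P : Prm}

lemma IsMass.lt_top_of_sub {T : (Rn P.n → ℝ) → ℝ≥0∞} (hT : IsMass T) {u w : Rn P.n → ℝ}
    {a e : ℝ} (ha : 0 ≤ a) (hw : Measurable w) (h1 : T (fun x => |w x| ^ a) < ⊤)
    (h2 : T (fun x => |w x - u x| ^ a) ≤ ENNReal.ofReal e) : T (fun x => |u x| ^ a) < ⊤ := by
  calc T (fun x => |u x| ^ a) = T (fun x => |w x + -(w x - u x)| ^ a) := by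
        congr 1; ext x; congr 2; ring
    _ ≤ ENNReal.ofReal (2 ^ a) * (T (fun x => |w x| ^ a) + ENNReal.ofReal e) := by
        refine (hT.triangle ha hw).trans ?_
        simp only [abs_neg]
        gcongr
    _ < ⊤ := ENNReal.mul_lt_top ENNReal.ofReal_lt_top
        (ENNReal.add_lt_top.2 ⟨h1, ENNReal.ofReal_lt_top⟩)

lemma Approx.finite {Ω : Set (Rn P.n)} {ν : Measure (Rn P.n)} [IsFiniteMeasure ν] {u : Rn P.n → ℝ}
    (h : P.Approx Ω ν u) {x0 : Rn P.n} {r : ℝ} (hr : 0 < r) (hb : closedBall x0 r ⊆ Ω) :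
    ∫⁻ x in ball x0 r, ENNReal.ofReal (|u x| ^ P.q) < ⊤ ∧
      ∫⁻ x in ball x0 r, ENNReal.ofReal (|u x| ^ (P.p - 1)) < ⊤ ∧
      ∫⁻ x in (ball x0 r)ᶜ, ENNReal.ofReal (|u x| ^ (P.p - 1)) *
        ENNReal.ofReal (P.ker (x - x0)) < ⊤ := by
  have h1 := P.p1_pos
  obtain ⟨M, hM⟩ : ∃ M, ν (closedBall x0 r) < ENNReal.ofReal M := by
    refine ⟨(ν (closedBall x0 r)).toReal + 1, ?_⟩
    rw [ENNReal.ofReal_add ENNReal.toReal_nonneg zero_le_one,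
      ENNReal.ofReal_toReal (measure_ne_top _ _)]
    exact ENNReal.lt_add_right (measure_ne_top _ _) (by simp)
  obtain ⟨w, hw, ⟨i1, i2, i3⟩, j1, j2, j3⟩ := h x0 r M 1 hr hb hM one_pos
  have hwm := hw.measurable
  have hm : Measurable fun y => w (x0 + r • y) := by fun_prop
  have k1 := (isMass_lb 1).lt_top_of_sub P.q_pos.le hm i1 j1
  have k2 := (isMass_lb 1).lt_top_of_sub h1.le hm i2 j2
  have k3 := (isMass_tl 1).lt_top_of_sub h1.le hm i3 j3
  rw [lb_affine x0 hr (fun x => |u x| ^ P.q)] at k1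
  rw [lb_affine x0 hr (fun x => |u x| ^ (P.p - 1))] at k2
  rw [tl_affine x0 hr (fun x => |u x| ^ (P.p - 1))] at k3
  exact ⟨ENNReal.lt_top_of_mul_ne_top_right k1.ne (by simpa using by positivity),
    ENNReal.lt_top_of_mul_ne_top_right k2.ne (by simpa using by positivity),
    ENNReal.lt_top_of_mul_ne_top_right k3.ne (by simpa using by positivity)⟩

lemma exists_le_rpow {X : ℝ≥0∞} (hX : X < ⊤) {a : ℝ} (ha : 0 < a) :
    ∃ m0 : ℝ, 0 < m0 ∧ ∀ m, m0 ≤ m → X ≤ ENNReal.ofReal (m ^ a) := by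
  refine ⟨(X.toReal + 1) ^ a⁻¹, by positivity, fun m hm => ?_⟩
  rw [← ENNReal.ofReal_toReal hX.ne]
  refine ENNReal.ofReal_le_ofReal ?_
  calc X.toReal ≤ X.toReal + 1 := by linarith
    _ = ((X.toReal + 1) ^ a⁻¹) ^ a := by
        rw [← Real.rpow_mul (by positivity), inv_mul_cancel₀ ha.ne', Real.rpow_one]
    _ ≤ m ^ a := Real.rpow_le_rpow (by positivity) hm ha.le

lemma lint_tail_shift (x0 : Rn P.n) {r : ℝ} (hr : 0 < r) {x : Rn P.n} (hx : x ∈ ball x0 r)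
    (F : Rn P.n → ℝ≥0∞) :
    ∫⁻ y in (ball x r)ᶜ, F y * ENNReal.ofReal (P.ker (y - x)) ≤
      ENNReal.ofReal ((r ^ P.N)⁻¹) * (∫⁻ y in ball x0 (2 * r), F y) +
        ENNReal.ofReal (2 ^ P.N) *
          ∫⁻ y in (ball x0 (2 * r))ᶜ, F y * ENNReal.ofReal (P.ker (y - x0)) := by
  have hN := P.N_pos
  have hsub : (ball x r)ᶜ ⊆ (ball x0 (2 * r) ∩ (ball x r)ᶜ) ∪ (ball x0 (2 * r))ᶜ := fun y hy => by
    by_cases h : y ∈ ball x0 (2 * r)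
    · exact Or.inl ⟨h, hy⟩
    · exact Or.inr h
  refine (lintegral_mono_set hsub).trans ((lintegral_union_le _ _ _).trans ?_)
  gcongr
  · rw [← lintegral_const_mul' _ _ ENNReal.ofReal_ne_top]
    refine (setLIntegral_mono' (measurableSet_ball.inter measurableSet_ball.compl)
      (g := fun y => ENNReal.ofReal ((r ^ P.N)⁻¹) * F y) fun y hy => ?_).trans
        (lintegral_mono_set inter_subset_left)
    rw [mul_comm]
    gcongr
    refine P.ker_le_of_le hr ?_
    simpa [dist_eq_norm] using hy.2
  · rw [← lintegral_const_mul' _ _ ENNReal.ofReal_ne_top]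
    refine setLIntegral_mono' measurableSet_ball.compl fun y hy => ?_
    rw [mul_left_comm, ← ENNReal.ofReal_mul (by positivity)]
    gcongr
    have h1 : 2 * r ≤ ‖y - x0‖ := by simpa [dist_eq_norm] using hy
    have h2 : ‖x - x0‖ < r := by simpa [dist_eq_norm] using hx
    have h3 : ‖y - x0‖ ≤ ‖y - x‖ + ‖x - x0‖ := by
      simpa using norm_add_le (y - x) (x - x0)
    refine (P.ker_le_of_le (a := ‖y - x0‖ / 2) (by linarith) (by linarith)).trans (le_of_eq ?_)
    rw [Real.div_rpow (norm_nonneg _) two_pos.le, ker, inv_div, div_eq_mul_inv]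

/-- Locally uniform bound for the excess at a fixed scale. -/
lemma Approx.exists_exc {Ω : Set (Rn P.n)} {ν : Measure (Rn P.n)} [IsFiniteMeasure ν]
    {u : Rn P.n → ℝ} (h : P.Approx Ω ν u) {x0 : Rn P.n} {r : ℝ} (hr : 0 < r)
    (hb : closedBall x0 (2 * r) ⊆ Ω) :
    ∃ m0 : ℝ, 0 < m0 ∧ ∀ m, m0 ≤ m → ∀ x ∈ ball x0 r, P.Exc u x r 0 m := by
  obtain ⟨h1, h2, h3⟩ := h.finite (by positivity) hb
  obtain ⟨m1, hm1, H1⟩ := exists_le_rpow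
    (ENNReal.mul_lt_top (ENNReal.ofReal_lt_top (r := (r ^ P.n)⁻¹)) h1) P.q_pos
  obtain ⟨m2, hm2, H2⟩ := exists_le_rpow
    (ENNReal.mul_lt_top (ENNReal.ofReal_lt_top (r := r ^ (P.s * P.p))) (ENNReal.add_lt_top.2
      ⟨ENNReal.mul_lt_top (ENNReal.ofReal_lt_top (r := (r ^ P.N)⁻¹)) h2,
        ENNReal.mul_lt_top (ENNReal.ofReal_lt_top (r := 2 ^ P.N)) h3⟩)) P.p1_pos
  refine ⟨max m1 m2, lt_max_of_lt_left hm1, fun m hm x hx => ⟨?_, ?_⟩⟩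
  · simp only [sub_zero]
    rw [lb_affine x hr (fun x => |u x| ^ P.q)]
    refine le_trans ?_ (H1 m ((le_max_left _ _).trans hm))
    gcongr
    refine ball_subset_ball' ?_
    have := mem_ball.1 hx
    linarith
  · simp only [sub_zero]
    rw [tl_affine x hr (fun x => |u x| ^ (P.p - 1))]
    refine le_trans ?_ (H2 m ((le_max_right _ _).trans hm))
    gcongr
    exact lint_tail_shift x0 hr hx _

end Prm

/-- A Dini condition on a density function yields summable bounds along a geometric sequence of
radii. -/
lemma exists_summable_density {n : ℕ} {ν : Measure (Rn n)} {h : ℝ → ℝ} {e d r₁ r₀ σ δ : ℝ}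
    (hh : ∀ r, 0 ≤ h r) (he : 0 < e) (hd : 0 < d) (hr₀ : 0 < r₀) (hσ : 0 < σ) (hσ1 : σ < 1)
    (hδ : 0 < δ) (hr : r₀ / σ ≤ r₁)
    (hdini : (∫⁻ r in Ioc (0 : ℝ) r₁, ENNReal.ofReal (h r ^ (1 / e) / r)) < ⊤)
    (hdens : ∀ x r, 0 < r → ν (ball x r) ≤ ENNReal.ofReal (h r * r ^ d)) :
    ∃ a : ℕ → ℝ, (∀ k, 0 < a k) ∧ Summable a ∧ ∀ k x,
      ν (closedBall x (r₀ * σ ^ k)) < ENNReal.ofReal (δ * a k ^ e * (r₀ * σ ^ k) ^ d) := by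
  set F : ℝ → ℝ≥0∞ := fun r => ENNReal.ofReal (h r ^ (1 / e) / r) with hF
  set I : ℕ → Set ℝ := fun k => Ioo (r₀ * σ ^ k) (r₀ * σ ^ k / σ) with hI
  have hrk : ∀ k, 0 < r₀ * σ ^ k := fun k => by positivity
  have hIsub : ∀ k, I k ⊆ Ioc 0 r₁ := fun k ρ hρ => by
    refine ⟨(hrk k).trans hρ.1, hρ.2.le.trans (le_trans ?_ hr)⟩
    gcongr
    exact mul_le_of_le_one_right hr₀.le (pow_le_one₀ hσ.le hσ1.le)
  have hdisj : Pairwise (Function.onFun Disjoint I) := by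
    have key : ∀ j k, j < k → Disjoint (I j) (I k) := fun j k hjk => by
      rw [Set.disjoint_left]
      intro ρ h1 h2
      have h3 : r₀ * σ ^ k / σ ≤ r₀ * σ ^ j := by
        rw [div_le_iff₀ hσ, mul_assoc, ← pow_succ]
        exact mul_le_mul_of_nonneg_left (pow_le_pow_of_le_one hσ.le hσ1.le hjk) hr₀.le
      exact absurd (h1.1.trans h2.2) (not_lt.2 h3)
    intro j k hjk
    rcases lt_or_gt_of_ne hjk with h | h
    · exact key j k h
    · exact (key k j h).symm
  have hsum : ∑' k, ∫⁻ r in I k, F r < ⊤ := by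
    rw [← lintegral_iUnion (fun k => measurableSet_Ioo) hdisj]
    exact (lintegral_mono_set (iUnion_subset hIsub)).trans_lt hdini
  set j : ℕ → ℝ := fun k => (∫⁻ r in I k, F r).toReal with hj
  have hj0 : ∀ k, 0 ≤ j k := fun k => ENNReal.toReal_nonneg
  have hjs : Summable j := ENNReal.summable_toReal hsum.ne
  set b : ℕ → ℝ := fun k => (j k + (1 / 2) ^ k) / (1 - σ) with hb
  have h1σ : 0 < 1 - σ := by linarith
  have hb0 : ∀ k, 0 < b k := fun k => by
    have := hj0 k
    simp only [hb]
    positivity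
  have hbs : Summable b := (hjs.add summable_geometric_two).div_const _
  have hex : ∀ k, ∃ ρ ∈ I k, h ρ ^ (1 / e) < b k := fun k => by
    by_contra! hcon
    have hlow : ENNReal.ofReal (j k + (1 / 2) ^ k) ≤ ∫⁻ r in I k, F r := by
      calc ENNReal.ofReal (j k + (1 / 2) ^ k)
          = ∫⁻ _ in I k, ENNReal.ofReal (b k / (r₀ * σ ^ k / σ)) := by
            have hlen : 0 ≤ r₀ * σ ^ k / σ - r₀ * σ ^ k := by
              rw [sub_nonneg, le_div_iff₀ hσ]
              nlinarith [hrk k]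
            rw [setLIntegral_const, Real.volume_Ioo, ← ENNReal.ofReal_mul (by
              have := hb0 k; positivity)]
            congr 1
            simp only [hb]
            field_simp
        _ ≤ _ := setLIntegral_mono' measurableSet_Ioo fun ρ hρ => by
            have h0 : 0 < ρ := (hrk k).trans hρ.1
            have := hb0 k
            refine ENNReal.ofReal_le_ofReal ?_
            exact div_le_div₀ (by have := hh ρ; positivity) (hcon ρ hρ) h0 hρ.2.le
    have hfin : ∫⁻ r in I k, F r ≠ ⊤ :=
      ((lintegral_mono_set (hIsub k)).trans_lt hdini).ne
    rw [← ENNReal.ofReal_toReal hfin] at hlow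
    have h2 := (ENNReal.ofReal_le_ofReal_iff ENNReal.toReal_nonneg).1 hlow
    have : (0 : ℝ) < (1 / 2) ^ k := by positivity
    simp only [hj] at h2
    linarith
  set c : ℝ := (σ ^ (-d) / δ) ^ (1 / e) with hc
  have hc0 : 0 < c := by positivity
  refine ⟨fun k => b k * c, fun k => mul_pos (hb0 k) hc0, hbs.mul_right c, fun k x => ?_⟩
  obtain ⟨ρ, hρ, hlt⟩ := hex k
  have hρ0 : 0 < ρ := (hrk k).trans hρ.1
  have hbk := hb0 k
  have hpow : ∀ t : ℝ, 0 ≤ t → (t ^ (1 / e)) ^ e = t := fun t ht => by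
    rw [← Real.rpow_mul ht, one_div_mul_cancel he.ne', Real.rpow_one]
  refine ((measure_mono (closedBall_subset_ball hρ.1)).trans (hdens x ρ hρ0)).trans_lt ?_
  have hrk' := hrk k
  rw [ENNReal.ofReal_lt_ofReal_iff (by positivity)]
  have i1 : h ρ < b k ^ e := by
    calc h ρ = (h ρ ^ (1 / e)) ^ e := (hpow _ (hh ρ)).symm
      _ < b k ^ e := Real.rpow_lt_rpow (by have := hh ρ; positivity) hlt he
  have i2 : ρ ^ d ≤ (r₀ * σ ^ k) ^ d * σ ^ (-d) := by
    calc ρ ^ d ≤ (r₀ * σ ^ k / σ) ^ d := Real.rpow_le_rpow hρ0.le hρ.2.le hd.le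
      _ = _ := by rw [Real.div_rpow hrk'.le hσ.le, Real.rpow_neg hσ.le, div_eq_mul_inv]
  calc h ρ * ρ ^ d < b k ^ e * ((r₀ * σ ^ k) ^ d * σ ^ (-d)) :=
        mul_lt_mul i1 i2 (by positivity) (by positivity)
    _ = δ * (b k * c) ^ e * (r₀ * σ ^ k) ^ d := by
        rw [Real.mul_rpow hbk.le hc0.le, hc, hpow _ (by positivity)]
        field_simp

namespace Prm

variable {P : Prm}

variable (P) in
/-- Constant comparing the reference values at nearby centres. -/
def CD : ℝ := (2 ^ (P.q + 1) * 2 ^ P.n / P.ω) ^ (1 / P.q)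

lemma abs_sub_le_of_excess {u : Rn P.n → ℝ} (hu : Measurable u) {x y : Rn P.n} {r m c d : ℝ}
    (hr : 0 < r) (hm : 0 < m) (hxy : dist x y ≤ r / 2)
    (hx : ∫⁻ z in ball x r, ENNReal.ofReal (|u z - c| ^ P.q) ≤ ENNReal.ofReal (r ^ P.n * m ^ P.q))
    (hy : ∫⁻ z in ball y r, ENNReal.ofReal (|u z - d| ^ P.q) ≤ ENNReal.ofReal (r ^ P.n * m ^ P.q)) :
    |c - d| ≤ P.CD * m := by
  have hq := P.q_pos
  have hω := P.ω_pos
  have h1 : ENNReal.ofReal (|c - d| ^ P.q * ((r / 2) ^ P.n * P.ω)) ≤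
      ENNReal.ofReal (2 ^ P.q * (r ^ P.n * m ^ P.q + r ^ P.n * m ^ P.q)) := by
    calc ENNReal.ofReal (|c - d| ^ P.q * ((r / 2) ^ P.n * P.ω))
        = ∫⁻ _ in ball x (r / 2), ENNReal.ofReal (|c - d| ^ P.q) := by
          rw [setLIntegral_const, P.vol_ball x (by positivity), ENNReal.ofReal_mul (by positivity)]
      _ ≤ ∫⁻ z in ball x (r / 2), ENNReal.ofReal (2 ^ P.q) *
            (ENNReal.ofReal (|u z - c| ^ P.q) + ENNReal.ofReal (|u z - d| ^ P.q)) := by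
          refine lintegral_mono fun z => ?_
          rw [← ENNReal.ofReal_add (by positivity) (by positivity),
            ← ENNReal.ofReal_mul (by positivity)]
          refine ENNReal.ofReal_le_ofReal (le_trans ?_
            (add_rpow_le_two (abs_nonneg _) (abs_nonneg _) hq.le))
          refine Real.rpow_le_rpow (abs_nonneg _) ?_ hq.le
          rw [abs_sub_comm (u z) c]
          exact abs_sub_le _ _ _
      _ = ENNReal.ofReal (2 ^ P.q) * ((∫⁻ z in ball x (r / 2), ENNReal.ofReal (|u z - c| ^ P.q)) +
            ∫⁻ z in ball x (r / 2), ENNReal.ofReal (|u z - d| ^ P.q)) := by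
          rw [lintegral_const_mul' _ _ ENNReal.ofReal_ne_top, lintegral_add_left (by fun_prop)]
      _ ≤ _ := by
          rw [ENNReal.ofReal_mul (by positivity), ENNReal.ofReal_add (by positivity) (by positivity)]
          gcongr
          · exact (lintegral_mono_set (ball_subset_ball (by linarith))).trans hx
          · exact (lintegral_mono_set (ball_subset_ball' (by linarith))).trans hy
  rw [ENNReal.ofReal_le_ofReal_iff (by positivity)] at h1
  have h2 : |c - d| ^ P.q ≤ 2 ^ (P.q + 1) * 2 ^ P.n / P.ω * m ^ P.q := by
    rw [div_mul_eq_mul_div, le_div_iff₀ hω, Real.rpow_add two_pos, Real.rpow_one]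
    rw [div_pow] at h1
    have h3 : |c - d| ^ P.q * P.ω * r ^ P.n ≤ 2 ^ P.q * 2 * 2 ^ P.n * m ^ P.q * r ^ P.n := by
      have := mul_le_mul_of_nonneg_right h1 (by positivity : (0 : ℝ) ≤ 2 ^ P.n)
      have e : |c - d| ^ P.q * (r ^ P.n / 2 ^ P.n * P.ω) * 2 ^ P.n =
        |c - d| ^ P.q * P.ω * r ^ P.n := by field_simp
      rw [e] at this
      linarith
    exact le_of_mul_le_mul_right h3 (by positivity)
  have h4 := Real.rpow_le_rpow (by positivity) h2 (by positivity : 0 ≤ 1 / P.q)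
  rw [Real.mul_rpow (by positivity) (by positivity), ← Real.rpow_mul (abs_nonneg _),
    ← Real.rpow_mul hm.le, mul_one_div_cancel hq.ne', Real.rpow_one, Real.rpow_one] at h4
  exact h4

/-- A Campanato type criterion for continuity, without integrability assumptions. -/
lemma exists_continuousOn_of_excess {u : Rn P.n → ℝ} (hu : Measurable u) {U : Set (Rn P.n)}
    (hU : MeasurableSet U) {r m : ℕ → ℝ} {C : ℝ} {c : Rn P.n → ℕ → ℝ} (hr : ∀ k, 0 < r k)
    (hr0 : Tendsto r atTop (𝓝 0)) (hm : ∀ k, 0 < m k) (hms : Summable m)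
    (hc : ∀ x ∈ U, ∀ k, |c x (k + 1) - c x k| ≤ C * m k)
    (hex : ∀ x ∈ U, ∀ k, ∫⁻ z in ball x (r k), ENNReal.ofReal (|u z - c x k| ^ P.q) ≤
      ENNReal.ofReal (r k ^ P.n * m k ^ P.q)) :
    ∃ f : Rn P.n → ℝ, ContinuousOn f U ∧ ∀ᵐ x, x ∈ U → u x = f x := by
  classical
  have hq := P.q_pos
  have hω := P.ω_pos
  have hlim : ∀ x : Rn P.n, ∃ l, x ∈ U → Tendsto (c x) atTop (𝓝 l) := fun x => by
    by_cases hx : x ∈ U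
    · obtain ⟨l, hl⟩ := cauchySeq_tendsto_of_complete (cauchySeq_of_dist_le_of_summable (f := c x)
        (fun k => C * m k) (fun k => by rw [dist_comm, Real.dist_eq]; exact hc x hx k)
        (hms.mul_left C))
      exact ⟨l, fun _ => hl⟩
    · exact ⟨0, fun h => absurd h hx⟩
  choose f hf using hlim
  set τ : ℕ → ℝ := fun k => ∑' j, C * m (j + k) with hτ
  have hτ0 : Tendsto τ atTop (𝓝 0) := tendsto_sum_nat_add fun j => C * m j
  have hcf : ∀ x ∈ U, ∀ k, |c x k - f x| ≤ τ k := fun x hx k => by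
    have := dist_le_tsum_of_dist_le_of_tendsto (f := c x) (fun k => C * m k)
      (fun k => by rw [dist_comm, Real.dist_eq]; exact hc x hx k) (hms.mul_left C) (hf x hx) k
    simpa only [hτ, add_comm k, Real.dist_eq] using this
  have hT0 : Tendsto (fun k => τ k + τ k + P.CD * m k) atTop (𝓝 0) := by
    simpa using (hτ0.add hτ0).add (hms.tendsto_atTop_zero.const_mul P.CD)
  have hτn : ∀ x ∈ U, ∀ k, 0 ≤ τ k := fun x hx k => (abs_nonneg _).trans (hcf x hx k)
  have hnear : ∀ x ∈ U, ∀ y ∈ U, ∀ k, dist x y ≤ r k / 2 → |c x k - c y k| ≤ P.CD * m k :=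
    fun x hx y hy k hxy => abs_sub_le_of_excess hu (hr k) (hm k) hxy (hex x hx k) (hex y hy k)
  have hnear' : ∀ x ∈ U, ∀ y ∈ U, ∀ k, dist x y ≤ r k / 2 →
      |f y - c x k| ≤ τ k + τ k + P.CD * m k := fun x hx y hy k hxy => by
    have h1 := abs_le.1 (hcf y hy k)
    have h2 := abs_le.1 (hnear x hx y hy k hxy)
    have h3 := hτn x hx k
    rw [abs_le]
    constructor <;> linarith
  have hfc : ContinuousOn f U := by
    rw [Metric.continuousOn_iff]
    intro x hx ε hε
    obtain ⟨k, hk⟩ := ((tendsto_order.1 hT0).2 ε hε).exists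
    refine ⟨r k / 2, by have := hr k; positivity, fun y hy hxy => lt_of_le_of_lt ?_ hk⟩
    rw [dist_comm] at hxy
    have h1 := abs_le.1 (hcf y hy k)
    have h2 := abs_le.1 (hnear x hx y hy k hxy.le)
    have h3 := abs_le.1 (hcf x hx k)
    rw [Real.dist_eq, abs_le]
    constructor <;> linarith
  refine ⟨f, hfc, ?_⟩
  have key : ∀ ε : ℝ, 0 < ε → volume {x | x ∈ U ∧ ε < |u x - f x|} = 0 := fun ε hε => by
    have hfm : Measurable (U.piecewise f 0) :=
      hfc.measurable_piecewise (continuousOn_const (c := (0 : ℝ))) hU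
    have hE : MeasurableSet {x | x ∈ U ∧ ε < |u x - f x|} := by
      have : {x | x ∈ U ∧ ε < |u x - f x|} = U ∩ {x | ε < |u x - U.piecewise f 0 x|} := by
        ext x
        constructor
        · rintro ⟨h1, h2⟩
          refine ⟨h1, ?_⟩
          rwa [mem_ofPred_eq, Set.piecewise_eq_of_mem _ _ _ h1]
        · rintro ⟨h1, h2⟩
          rw [mem_ofPred_eq, Set.piecewise_eq_of_mem _ _ _ h1] at h2
          exact ⟨h1, h2⟩
      rw [this]
      exact hU.inter (measurableSet_lt measurable_const (by fun_prop))
    have hsub : ∀ x ∈ U, ∀ k, τ k + τ k + P.CD * m k ≤ ε / 2 →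
        volume ({x | x ∈ U ∧ ε < |u x - f x|} ∩ closedBall x (r k / 4)) /
          volume (closedBall x (r k / 4)) ≤
            ENNReal.ofReal (4 ^ P.n / ((ε / 2) ^ P.q * P.ω) * m k ^ P.q) := fun x hx k hk => by
      have hrk := hr k
      have hmk := hm k
      have h1 : volume ({x | x ∈ U ∧ ε < |u x - f x|} ∩ closedBall x (r k / 4)) ≤
          ENNReal.ofReal (r k ^ P.n * m k ^ P.q / (ε / 2) ^ P.q) := by
        rw [ENNReal.ofReal_div_of_pos (by positivity),
          ENNReal.le_div_iff_mul_le (Or.inl (by simpa using by positivity))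
            (Or.inl ENNReal.ofReal_ne_top), mul_comm]
        refine le_trans ?_ ((mul_meas_ge_le_lintegral (μ := volume.restrict (ball x (r k)))
          (f := fun z => ENNReal.ofReal (|u z - c x k| ^ P.q)) (by fun_prop)
          (ENNReal.ofReal ((ε / 2) ^ P.q))).trans (hex x hx k))
        refine mul_le_mul_right (le_trans (measure_mono (t := {z | ENNReal.ofReal ((ε / 2) ^ P.q) ≤
          ENNReal.ofReal (|u z - c x k| ^ P.q)} ∩ ball x (r k)) ?_)
            (Measure.le_restrict_apply (ball x (r k)) _)) _
        rintro y ⟨⟨hyU, hy⟩, hyx⟩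
        have hd := mem_closedBall.1 hyx
        refine ⟨?_, mem_ball.2 (by linarith)⟩
        have h2 := (hnear' x hx y hyU k (by rw [dist_comm]; linarith)).trans hk
        have h3 : |u y - f y| ≤ |u y - c x k| + |c x k - f y| := abs_sub_le _ _ _
        rw [abs_sub_comm (c x k)] at h3
        exact ENNReal.ofReal_le_ofReal
          (Real.rpow_le_rpow (by positivity) (by linarith) hq.le)
      calc _ ≤ ENNReal.ofReal (r k ^ P.n * m k ^ P.q / (ε / 2) ^ P.q) /
            ENNReal.ofReal ((r k / 4) ^ P.n * P.ω) := by
            rw [← P.vol_ball x (by positivity)]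
            gcongr
            exact ball_subset_closedBall
        _ = _ := by
            rw [← ENNReal.ofReal_div_of_pos (by positivity)]
            congr 1
            rw [div_pow]
            field_simp
    have hm0 : Tendsto (fun k => ENNReal.ofReal (4 ^ P.n / ((ε / 2) ^ P.q * P.ω) * m k ^ P.q))
        atTop (𝓝 0) := by
      rw [← ENNReal.ofReal_zero]
      refine ENNReal.tendsto_ofReal ?_
      have := (hms.tendsto_atTop_zero.rpow_const (Or.inr hq.le) (p := P.q)).const_mul
        (4 ^ P.n / ((ε / 2) ^ P.q * P.ω))
      rwa [Real.zero_rpow hq.ne', mul_zero] at this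
    have hev : ∀ᶠ k in atTop, τ k + τ k + P.CD * m k ≤ ε / 2 :=
      ((tendsto_order.1 hT0).2 _ (half_pos hε)).mono fun k hk => hk.le
    have hr4 : Tendsto (fun k => r k / 4) atTop (𝓝[>] 0) :=
      tendsto_nhdsWithin_iff.2 ⟨by simpa using hr0.div_const 4,
        Eventually.of_forall fun k => by have := hr k; exact mem_Ioi.2 (by positivity)⟩
    have hae := Besicovitch.ae_tendsto_measure_inter_div_of_measurableSet
      (volume : Measure (Rn P.n)) hE
    refine measure_mono_null (fun x hx => ?_) (ae_iff.1 hae)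
    rw [mem_ofPred_eq]
    intro hlim
    rw [Set.indicator_of_mem hx] at hlim
    have h0 := tendsto_of_tendsto_of_tendsto_of_le_of_le' tendsto_const_nhds hm0
      (Eventually.of_forall fun k => zero_le) (hev.mono fun k hk => hsub x hx.1 k hk)
    exact one_ne_zero (tendsto_nhds_unique (hlim.comp hr4) h0)
  have h2 : ∀ᵐ x, ∀ j : ℕ, ¬ (x ∈ U ∧ 1 / ((j : ℝ) + 1) < |u x - f x|) := by
    rw [ae_all_iff]
    intro j
    rw [ae_iff]
    simpa only [not_not] using key _ (by positivity)
  filter_upwards [h2] with x hx hxU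
  by_contra hne
  have : 0 < |u x - f x| := abs_pos.2 (sub_ne_zero.2 hne)
  obtain ⟨j, hj⟩ := exists_nat_one_div_lt this
  exact hx j ⟨hxU, hj⟩

end Prm

/-- The solution of `m (k + 1) = m k / 2 + a (k + 1)` starting from `m₀ + a 0`. -/
def halvingSeq (m₀ : ℝ) (a : ℕ → ℝ) : ℕ → ℝ
  | 0 => m₀ + a 0
  | k + 1 => halvingSeq m₀ a k / 2 + a (k + 1)

lemma halvingSeq_pos {m₀ : ℝ} {a : ℕ → ℝ} (hm : 0 < m₀) (ha : ∀ k, 0 < a k) :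
    ∀ k, 0 < halvingSeq m₀ a k
  | 0 => add_pos hm (ha 0)
  | k + 1 => add_pos (half_pos (halvingSeq_pos hm ha k)) (ha (k + 1))

lemma le_halvingSeq {m₀ : ℝ} {a : ℕ → ℝ} (hm : 0 < m₀) (ha : ∀ k, 0 < a k) (k : ℕ) :
    a k ≤ halvingSeq m₀ a k := by
  cases k with
  | zero => simp only [halvingSeq]; linarith
  | succ k =>
    have := halvingSeq_pos hm ha k
    simp only [halvingSeq]
    linarith

lemma summable_halvingSeq {m₀ : ℝ} {a : ℕ → ℝ} (hm : 0 < m₀) (ha : ∀ k, 0 < a k)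
    (hs : Summable a) : Summable (halvingSeq m₀ a) := by
  have key : ∀ k, ∑ i ∈ Finset.range k, halvingSeq m₀ a i + 2 * halvingSeq m₀ a k =
      2 * m₀ + 2 * ∑ i ∈ Finset.range (k + 1), a i := fun k => by
    induction k with
    | zero => simp [halvingSeq]; ring
    | succ k ih =>
      rw [Finset.sum_range_succ, Finset.sum_range_succ a]
      simp only [halvingSeq]
      linarith
  refine summable_of_sum_range_le (c := 2 * m₀ + 2 * ∑' i, a i)
    (fun k => (halvingSeq_pos hm ha k).le) fun k => ?_
  have h1 := key k
  have h2 := halvingSeq_pos hm ha k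
  have h3 := hs.sum_le_tsum (Finset.range (k + 1)) fun i _ => (ha i).le
  linarith

namespace Prm

variable {P : Prm}

lemma Exc.lintegral_le {u : Rn P.n → ℝ} {x : Rn P.n} {r c m : ℝ} (h : P.Exc u x r c m)
    (hr : 0 < r) : ∫⁻ z in ball x r, ENNReal.ofReal (|u z - c| ^ P.q) ≤
      ENNReal.ofReal (r ^ P.n * m ^ P.q) := by
  have h1 := h.1
  rw [lb_affine x hr (fun x => |u x - c| ^ P.q)] at h1
  have hrn : 0 < r ^ P.n := by positivity
  have h2 := mul_le_mul_right h1 (ENNReal.ofReal (r ^ P.n))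
  rwa [← mul_assoc, ← ENNReal.ofReal_mul hrn.le, mul_inv_cancel₀ hrn.ne', ENNReal.ofReal_one,
    one_mul, ← ENNReal.ofReal_mul hrn.le] at h2

lemma Exc.mono {u : Rn P.n → ℝ} {x : Rn P.n} {r c m m' : ℝ} (h : P.Exc u x r c m) (hm : 0 ≤ m)
    (hmm : m ≤ m') : P.Exc u x r c m' :=
  ⟨h.1.trans (ENNReal.ofReal_le_ofReal (Real.rpow_le_rpow hm hmm P.q_pos.le)),
    h.2.trans (ENNReal.ofReal_le_ofReal (Real.rpow_le_rpow hm hmm P.p1_pos.le))⟩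

lemma Approx.exists_continuousOn {Ω : Set (Rn P.n)} {ν : Measure (Rn P.n)} [IsFiniteMeasure ν]
    {u : Rn P.n → ℝ} (hap : P.Approx Ω ν u) (hΩ : IsOpen Ω) (hu : Measurable u)
    (hsp : P.s * P.p < P.n) {h : ℝ → ℝ} (hh : ∀ r, 0 ≤ h r) {r₁ : ℝ} (hr₁ : 0 < r₁)
    (hdini : (∫⁻ r in Ioc (0 : ℝ) r₁, ENNReal.ofReal (h r ^ (1 / (P.p - 1)) / r)) < ⊤)
    (hdens : ∀ x r, 0 < r → ν (ball x r) ≤ ENNReal.ofReal (h r * r ^ ((P.n : ℝ) - P.s * P.p)))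
    {x0 : Rn P.n} (hx0 : x0 ∈ Ω) :
    ∃ r, 0 < r ∧ ∃ f : Rn P.n → ℝ, ContinuousOn f (ball x0 r) ∧
      ∀ᵐ x, x ∈ ball x0 r → u x = f x := by
  obtain ⟨σ, δ, C, hσ, hσ1, hδ, hC, hstep⟩ := P.excess_decay
  obtain ⟨ε, hε, hεΩ⟩ := Metric.nhds_basis_closedBall.mem_iff.1 (hΩ.mem_nhds hx0)
  set r₀ : ℝ := min (ε / 2) (σ * r₁) with hr₀
  have hr₀p : 0 < r₀ := by rw [hr₀]; positivity
  have hb : closedBall x0 (2 * r₀) ⊆ Ω := by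
    refine (closedBall_subset_closedBall ?_).trans hεΩ
    have := min_le_left (ε / 2) (σ * r₁)
    linarith
  have hr₀σ : r₀ / σ ≤ r₁ := by
    rw [div_le_iff₀ hσ, mul_comm]
    exact min_le_right _ _
  obtain ⟨a, ha, has, haν⟩ := exists_summable_density hh P.p1_pos (sub_pos.2 hsp) hr₀p hσ
    (by linarith) hδ hr₀σ hdini hdens
  obtain ⟨m₀, hm₀, hinit⟩ := hap.exists_exc hr₀p hb
  set m := halvingSeq m₀ a with hm
  have hmp : ∀ k, 0 < m k := halvingSeq_pos hm₀ ha
  have hsub : ∀ x ∈ ball x0 r₀, ∀ k, closedBall x (r₀ * σ ^ k) ⊆ Ω := fun x hx k => by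
    refine (closedBall_subset_closedBall' ?_).trans hb
    have h1 : r₀ * σ ^ k ≤ r₀ := mul_le_of_le_one_right hr₀p.le (pow_le_one₀ hσ.le (by linarith))
    have h2 := mem_ball.1 hx
    linarith
  have hone : ∀ x ∈ ball x0 r₀, ∀ k d, P.Exc u x (r₀ * σ ^ k) d (m k) →
      ∃ d', |d' - d| ≤ C * m k ∧ P.Exc u x (r₀ * σ ^ (k + 1)) d' (m (k + 1)) := fun x hx k d hd => by
    have hak := ha k
    obtain ⟨d', h1, h2⟩ := hstep Ω ν u hu hap x (r₀ * σ ^ k) d (m k) (by positivity) (hmp k)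
      (hsub x hx k) hd ((haν k x).trans_le (ENNReal.ofReal_le_ofReal (by
        have := le_halvingSeq hm₀ ha k
        have := P.p1_pos
        gcongr)))
    refine ⟨d', h1, ?_⟩
    have h3 : σ * (r₀ * σ ^ k) = r₀ * σ ^ (k + 1) := by ring
    rw [h3] at h2
    refine h2.mono (half_pos (hmp k)).le ?_
    have := ha (k + 1)
    simp only [hm, halvingSeq]
    linarith
  have hseq : ∀ x, ∃ c : ℕ → ℝ, x ∈ ball x0 r₀ → ∀ k, P.Exc u x (r₀ * σ ^ k) (c k) (m k) ∧
      |c (k + 1) - c k| ≤ C * m k := fun x => by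
    by_cases hx : x ∈ ball x0 r₀
    · choose! g hg1 hg2 using hone x hx
      have hexc : ∀ k, P.Exc u x (r₀ * σ ^ k) (Nat.rec 0 g k : ℝ) (m k) := fun k => by
        induction k with
        | zero =>
          simp only [pow_zero, mul_one]
          refine hinit _ ?_ x hx
          have := ha 0
          simp only [hm, halvingSeq]
          linarith
        | succ k ih => exact hg2 k _ ih
      exact ⟨fun k => Nat.rec 0 g k, fun _ k => ⟨hexc k, hg1 k _ (hexc k)⟩⟩
    · exact ⟨fun _ => 0, fun h => absurd h hx⟩
  choose c hc using hseq
  refine ⟨r₀, hr₀p, exists_continuousOn_of_excess hu measurableSet_ball (r := fun k => r₀ * σ ^ k)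
    (m := m) (C := C) (c := c) (fun k => by positivity) ?_ hmp (summable_halvingSeq hm₀ ha has)
    (fun x hx k => (hc x hx k).2) fun x hx k => (hc x hx k).1.lintegral_le (by positivity)⟩
  simpa using (tendsto_pow_atTop_nhds_zero_of_lt_one hσ.le (by linarith)).const_mul r₀

end Prm

/-- Averages over small balls converge to the value of a continuous representative. -/
lemma tendsto_ballAvg {n : ℕ} {u f : Rn n → ℝ} {U : Set (Rn n)} (hU : IsOpen U)
    (hu : AEMeasurable u) (hf : ContinuousOn f U) (huf : ∀ᵐ x, x ∈ U → u x = f x) {x : Rn n}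
    (hx : x ∈ U) : Tendsto (fun ρ => ballAvg n u x ρ) (𝓝[>] (0 : ℝ)) (𝓝 (f x)) := by
  rw [Metric.tendsto_nhds]
  intro ε hε
  have h1 : ∀ᶠ y in 𝓝 x, y ∈ U ∧ f y ∈ closedBall (f x) (ε / 2) :=
    (hU.eventually_mem hx).and
      ((hf.continuousAt (hU.mem_nhds hx)).eventually (closedBall_mem_nhds _ (half_pos hε)))
  obtain ⟨d, hd, hball⟩ := Metric.eventually_nhds_iff_ball.1 h1
  filter_upwards [Ioo_mem_nhdsGT hd] with ρ hρ
  have hae : ∀ᵐ y ∂volume.restrict (ball x ρ), u y ∈ closedBall (f x) (ε / 2) := by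
    filter_upwards [ae_restrict_of_ae huf, ae_restrict_mem measurableSet_ball] with y h2 h3
    obtain ⟨h4, h5⟩ := hball y (ball_subset_ball hρ.2.le h3)
    rwa [h2 h4]
  have hmem : ballAvg n u x ρ ∈ closedBall (f x) (ε / 2) := by
    refine (convex_closedBall _ _).set_average_mem isClosed_closedBall
      (measure_ball_pos _ _ hρ.1).ne' measure_ball_lt_top.ne hae ?_
    refine Measure.integrableOn_of_bounded (M := |f x| + ε / 2) measure_ball_lt_top.ne
      hu.aestronglyMeasurable ?_
    filter_upwards [hae] with y hy
    rw [mem_closedBall, Real.dist_eq] at hy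
    rw [Real.norm_eq_abs]
    have := abs_sub_abs_le_abs_sub (u y) (f x)
    linarith
  rw [mem_closedBall] at hmem
  linarith

/-- Exponents slightly above `p - 1` are admissible. -/
lemma exists_small_exponent {n : ℕ} {s p : ℝ} (hn : 1 ≤ n) (hs : 0 < s) (hs1 : s < 1)
    (hp : 1 < p) : ∃ ξ : ℝ, 0 < ξ ∧ (p - 1) * (1 + ξ) ≤ p ∧
      (p - 1) * (1 + ξ) ≤ (p - 1 - ξ) * (1 + s * p / n) ∧ (p - 1) * (1 + ξ) < qBar n s p := by
  have hn0 : (0 : ℝ) < n := by exact_mod_cast hn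
  have hn1 : (1 : ℝ) ≤ n := by exact_mod_cast hn
  have hp1 : 0 < p - 1 := by linarith
  have hκ : 0 < s * p / n := by positivity
  have hlt : p - 1 < qBar n s p := by
    refine lt_min ?_ (by linarith)
    rw [lt_div_iff₀ (by linarith)]
    nlinarith
  have hf : Tendsto (fun ξ : ℝ => (p - 1) * (1 + ξ)) (𝓝[>] 0) (𝓝 (p - 1)) := by
    have : Continuous fun ξ : ℝ => (p - 1) * (1 + ξ) := by fun_prop
    simpa using (this.tendsto 0).mono_left nhdsWithin_le_nhds
  have hf2 : Tendsto (fun ξ : ℝ => (p - 1 - ξ) * (1 + s * p / n)) (𝓝[>] 0)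
      (𝓝 ((p - 1) * (1 + s * p / n))) := by
    have : Continuous fun ξ : ℝ => (p - 1 - ξ) * (1 + s * p / n) := by fun_prop
    simpa using (this.tendsto 0).mono_left nhdsWithin_le_nhds
  obtain ⟨ξ, h1, h2, h3, h4⟩ := ((hf.eventually_lt_const (show p - 1 < p by linarith)).and
    ((hf.eventually_lt hf2 (by nlinarith)).and ((hf.eventually_lt_const hlt).and
      self_mem_nhdsWithin))).exists
  exact ⟨ξ, h4, h1.le, h2.le, h3⟩

/-- The exponent range `[q_*, q̄)` is nonempty when `p > 2 - s / n`. -/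
lemma qStar_lt_qBar {n : ℕ} {s p : ℝ} (hn : 1 ≤ n) (hs : 0 < s) (hs1 : s < 1) (hp1 : 1 < p)
    (hp : 2 - s / (n : ℝ) < p) : qStar p < qBar n s p := by
  have hn1 : (1 : ℝ) ≤ n := by exact_mod_cast hn
  have h1 : s / (n : ℝ) * n = s := div_mul_cancel₀ _ (by positivity)
  refine max_lt (lt_min ?_ hp1) (lt_min ?_ (by linarith)) <;> rw [lt_div_iff₀ (by linarith)] <;>
    nlinarith

/-- Corollary 1.3, Measure density conditions imply continuity. -/
theorem measure_density_continuity
    (n : ℕ) (s p Λ : ℝ) (Φ : ℝ → ℝ) (K : Rn n → Rn n → ℝ)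
    (Ω : Set (Rn n)) (μ : MeasureTheory.SignedMeasure (Rn n)) (g u : Rn n → ℝ)
    (h : ℝ → ℝ)
    (hn : 2 ≤ n) (hs : 0 < s) (hs1 : s < 1) (hp : 2 - s / (n : ℝ) < p) (hΛ : 1 ≤ Λ)
    (hsp : s * p < n)
    (hK : KernelBounds n Λ s p K) (hΦ : PhiBounds Λ p Φ)
    (hΩo : IsOpen Ω) (hΩb : Bornology.IsBounded Ω)
    (hg : BoundaryDatum n s p g)
    (hu : IsSOLA n Φ K s p Ω μ g u)
    (hh : ∀ r : ℝ, 0 ≤ h r)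
    -- Dini-type condition ∫₀ h(r)^{1/(p-1)} dr/r < ∞
    (hdini : ∃ r₀ : ℝ, 0 < r₀ ∧
      (∫⁻ r in Ioc (0 : ℝ) r₀, ENNReal.ofReal (h r ^ (1 / (p - 1)) / r)) < ⊤)
    -- density condition |μ|(B_r) ≤ h(r) r^{n-sp} for every ball
    (hdens : ∀ x : Rn n, ∀ r : ℝ, 0 < r →
      μ.totalVariation (ball x r) ≤ ENNReal.ofReal (h r * r ^ ((n : ℝ) - s * p))) :
    ∃ utilde : Rn n → ℝ, ContinuousOn utilde Ω ∧
      ∀ x ∈ Ω, Tendsto (fun ρ => ballAvg n u x ρ) (𝓝[>] (0 : ℝ)) (𝓝 (utilde x)) := by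
  have hn0 : (2 : ℝ) ≤ n := by exact_mod_cast hn
  have hp1 : 1 < p := by
    have : s / (n : ℝ) < 1 := (div_lt_one (by linarith)).2 (by linarith)
    linarith
  obtain ⟨ξ, hξ, hq, hκ, hqb⟩ := exists_small_exponent (by omega : 1 ≤ n) hs hs1 hp1
  let P : Prm :=
    { n := n, s := s, p := p, ξ := ξ, L := Λ ^ 2, hn := by omega, hs := hs, hs1 := hs1, hp := hp1,
      hξ := hξ, hq := hq, hκ := hκ, hL := one_le_pow₀ hΛ }
  obtain ⟨-, -, hout, uj, μj, gj, happ⟩ := hu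
  obtain ⟨v, hv, huv, hap⟩ := Prm.exists_approx_of_sola (P := P) hΛ le_rfl hK hΦ hΩb happ hout hqb
    (qStar_lt_qBar (one_le_two.trans hn) hs hs1 hp1 hp)
  have hum : AEMeasurable u := ⟨v, hv, huv⟩
  have : IsFiniteMeasure μ.totalVariation := by
    unfold SignedMeasure.totalVariation
    infer_instance
  obtain ⟨r₁, hr₁, hd⟩ := hdini
  have hloc : ∀ x ∈ Ω, ∃ f : Rn n → ℝ, ContinuousAt f x ∧
      ∀ᶠ y in 𝓝 x, Tendsto (fun ρ => ballAvg n u y ρ) (𝓝[>] (0 : ℝ)) (𝓝 (f y)) := by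
    intro x hx
    obtain ⟨r, hr, f, hf, hvf⟩ := Prm.Approx.exists_continuousOn (P := P) hap hΩo hv hsp hh hr₁ hd
      hdens hx
    have huf : ∀ᵐ y, y ∈ ball x r → u y = f y := by
      filter_upwards [huv, hvf] with y h1 h2 h3
      rw [h1, h2 h3]
    refine ⟨f, hf.continuousAt (ball_mem_nhds x hr), ?_⟩
    filter_upwards [ball_mem_nhds x hr] with y hy
    exact tendsto_ballAvg isOpen_ball hum hf huf hy
  refine ⟨fun x => limUnder (𝓝[>] (0 : ℝ)) fun ρ => ballAvg n u x ρ, fun x hx => ?_,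
    fun x hx => ?_⟩
  · obtain ⟨f, hf, hlim⟩ := hloc x hx
    refine (hf.congr ?_).continuousWithinAt
    filter_upwards [hlim] with y hy using hy.limUnder_eq.symm
  · obtain ⟨f, -, hlim⟩ := hloc x hx
    exact tendsto_nhds_limUnder ⟨f x, hlim.self_of_nhds⟩
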